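/- Let σ : A → B be a flat ring homomorphism of Noetherian commutative rings, where A is a complete local ring with maximal ideal m and the extended ideal mB is contained in the Jacobson radical of B. If the fiber B/mB is geometrically normal over the field A/m and A is normal, then B is normal. -/

import Mathlib

open TensorProduct IsLocalRing

/-- A commutative ring is normal if its localization at every prime ideal is an
integrally closed domain. -/
def IsNormalRing (R : Type*) [CommRing R] : Prop :=
  ∀ (P : Ideal R) (hP : P.IsPrime),
    haveI : P.IsPrime := hP
    IsDomain (Localization.AtPrime P) ∧ IsIntegrallyClosed (Localization.AtPrime P)

universe u v

/-- An algebra `R` over a field `F` is geometrically normal if `L ⊗[F] R` is a normal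
ring for every finite field extension `L` of `F`. -/
def GeometricallyNormal (F : Type u) (R : Type v) [Field F] [CommRing R]
    [Algebra F R] : Prop :=
  ∀ (L : Type u) [Field L] [Algebra F L] [FiniteDimensional F L], IsNormalRing (L ⊗[F] R)

/-! ### Seydi's lemma -/

theorem exists_eq_pow_mul_not_dvd {S : Type*} [CommRing S] [IsNoetherianRing S] [IsLocalRing S]
    {t : S} (ht : t ∈ maximalIdeal S) {a : S} (ha : a ≠ 0) :
    ∃ (n : ℕ) (b : S), a = t ^ n * b ∧ ¬ t ∣ b := by
  have hfin : FiniteMultiplicity t a := by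
    by_contra h
    apply ha
    have h1 : ∀ n, t ^ n ∣ a := by
      intro n
      by_contra hn
      exact h ⟨n, fun hh => hn ((pow_dvd_pow t (Nat.le_succ n)).trans hh)⟩
    have h2 : a ∈ (⨅ i : ℕ, (maximalIdeal S) ^ i) := by
      rw [Ideal.mem_iInf]
      intro n
      obtain ⟨c, hc⟩ := h1 n
      rw [hc]
      exact Ideal.mul_mem_right _ _ (Ideal.pow_mem_pow ht n)
    rw [Ideal.iInf_pow_eq_bot_of_isLocalRing _ (Ideal.IsPrime.ne_top inferInstance)] at h2
    simpa using h2
  obtain ⟨c, hc, hc'⟩ := hfin.exists_eq_pow_mul_and_not_dvd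
  exact ⟨_, c, hc, hc'⟩

theorem isDomain_of_quotient {S : Type*} [CommRing S] [IsNoetherianRing S] [IsLocalRing S]
    {t : S} (ht : t ∈ maximalIdeal S) (hreg : t ∈ nonZeroDivisors S)
    [hd : IsDomain (S ⧸ Ideal.span {t})] : IsDomain S := by
  have hprime : ∀ a b : S, t ∣ a * b → t ∣ a ∨ t ∣ b := by
    have := (Ideal.Quotient.isDomain_iff_prime _).1 hd
    intro a b hab
    simpa [Ideal.mem_span_singleton] using this.mem_or_mem (Ideal.mem_span_singleton.2 hab)
  have : NoZeroDivisors S := by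
    refine ⟨fun {a b} hab => ?_⟩
    by_contra hcon
    push Not at hcon
    obtain ⟨n, a', rfl, ha'⟩ := exists_eq_pow_mul_not_dvd ht hcon.1
    obtain ⟨m, b', rfl, hb'⟩ := exists_eq_pow_mul_not_dvd ht hcon.2
    have h1 : a' * b' * t ^ (n + m) = 0 := by rw [← hab]; ring
    have h2 := (mul_right_mem_nonZeroDivisors_eq_zero_iff (pow_mem hreg (n + m))).1 h1
    rcases hprime a' b' (h2 ▸ dvd_zero t) with h | h
    · exact ha' h
    · exact hb' h
  exact NoZeroDivisors.to_isDomain S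

/-- an integral relation for `b / y`, in elements -/
theorem exists_relation_of_isIntegral {S K : Type*} [CommRing S] [IsDomain S] [Field K] [Algebra S K]
    [IsFractionRing S K] {b y : S} (hy : y ≠ 0)
    (h : IsIntegral S (algebraMap S K b / algebraMap S K y)) :
    ∃ (p : Polynomial S), p.Monic ∧
      ∑ i ∈ Finset.range (p.natDegree + 1), p.coeff i * b ^ i * y ^ (p.natDegree - i) = 0 := by
  obtain ⟨p, hp, h0⟩ := h
  refine ⟨p, hp, ?_⟩
  apply IsFractionRing.injective S K
  have hy' : algebraMap S K y ≠ 0 := by simpa using hy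
  rw [Polynomial.eval₂_eq_sum_range] at h0
  rw [map_zero, ← zero_mul ((algebraMap S K y) ^ p.natDegree), ← h0, Finset.sum_mul, map_sum]
  refine Finset.sum_congr rfl fun i hi => ?_
  have : i ≤ p.natDegree := by simpa [Nat.lt_succ_iff] using hi
  rw [map_mul, map_mul, map_pow, map_pow, div_pow]
  rw [← Nat.sub_add_cancel this]
  simp only [Nat.add_sub_cancel]
  rw [pow_add]
  field_simp

theorem isIntegral_of_relation {S K : Type*} [CommRing S] [Field K] [Algebra S K]
    {b y : S} (hy : algebraMap S K y ≠ 0) (p : Polynomial S) (hp : p.Monic)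
    (h : ∑ i ∈ Finset.range (p.natDegree + 1), p.coeff i * b ^ i * y ^ (p.natDegree - i) = 0) :
    IsIntegral S (algebraMap S K b / algebraMap S K y) := by
  refine ⟨p, hp, ?_⟩
  rw [Polynomial.eval₂_eq_sum_range]
  have : (∑ i ∈ Finset.range (p.natDegree + 1), algebraMap S K (p.coeff i) *
    (algebraMap S K b / algebraMap S K y) ^ i) * (algebraMap S K y) ^ p.natDegree = 0 := by
    rw [← map_zero (algebraMap S K), ← h, Finset.sum_mul, map_sum]
    refine Finset.sum_congr rfl fun i hi => ?_
    have : i ≤ p.natDegree := by simpa [Nat.lt_succ_iff] using hi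
    rw [map_mul, map_mul, map_pow, map_pow, div_pow]
    rw [← Nat.sub_add_cancel this]
    simp only [Nat.add_sub_cancel]
    rw [pow_add]
    field_simp
  exact (mul_eq_zero.1 this).resolve_right (pow_ne_zero _ hy)

/-- Divisibility criterion in an integrally closed domain. -/
theorem dvd_of_relation {S : Type*} [CommRing S] [IsDomain S] [IsIntegrallyClosed S]
    {b y : S} (hy : y ≠ 0) (p : Polynomial S) (hp : p.Monic)
    (h : ∑ i ∈ Finset.range (p.natDegree + 1), p.coeff i * b ^ i * y ^ (p.natDegree - i) = 0) :
    y ∣ b := by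
  have hy' : algebraMap S (FractionRing S) y ≠ 0 := by simpa using hy
  obtain ⟨c, hc⟩ := IsIntegrallyClosed.isIntegral_iff.1 (isIntegral_of_relation hy' p hp h)
  refine ⟨c, ?_⟩
  apply IsFractionRing.injective S (FractionRing S)
  rw [map_mul, hc]
  field_simp

theorem relation_map {S T : Type*} [CommRing S] [CommRing T] [Nontrivial T] (f : S →+* T) {b y : S}
    (p : Polynomial S) (hp : p.Monic)
    (h : ∑ i ∈ Finset.range (p.natDegree + 1), p.coeff i * b ^ i * y ^ (p.natDegree - i) = 0) :
    ∑ i ∈ Finset.range ((p.map f).natDegree + 1),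
      (p.map f).coeff i * (f b) ^ i * (f y) ^ ((p.map f).natDegree - i) = 0 := by
  rw [hp.natDegree_map]
  simpa using congrArg f h

theorem isIntegrallyClosed_of_quotient_aux {S : Type*} (K : Type*) [CommRing S] [IsNoetherianRing S] [IsLocalRing S]
    [IsDomain S] [Field K] [Algebra S K] [IsFractionRing S K] {t : S} (ht : t ∈ maximalIdeal S) (ht0 : t ≠ 0)
    [hd : IsDomain (S ⧸ Ideal.span {t})] [IsIntegrallyClosed (S ⧸ Ideal.span {t})] :
    IsIntegrallyClosed S := by
  have hprime : ∀ a b : S, t ∣ a * b → t ∣ a ∨ t ∣ b := by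
    have := (Ideal.Quotient.isDomain_iff_prime _).1 hd
    intro a b hab
    simpa [Ideal.mem_span_singleton] using this.mem_or_mem (Ideal.mem_span_singleton.2 hab)
  have htP : Prime t := ⟨ht0, (mem_maximalIdeal t).1 ht, hprime⟩
  have hinj : Function.Injective (algebraMap S K) := IsFractionRing.injective S K
  -- the core claim
  have core : ∀ b y : S, ¬ t ∣ y → y ≠ 0 → IsIntegral S (algebraMap S K b / algebraMap S K y) →
      ∃ s, algebraMap S K s = algebraMap S K b / algebraMap S K y := by
    intro b y hty hy0 hIntg
    have hy0' : algebraMap S K y ≠ 0 := by simpa using hy0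
    set z : K := algebraMap S K b / algebraMap S K y with hz
    let C : Subalgebra S K := Algebra.adjoin S {z}
    have hCfg : C.toSubmodule.FG := hIntg.fg_adjoin_singleton
    have hCy : ∀ c ∈ C, ∃ k : ℕ, ∃ s : S, algebraMap S K (y ^ k) * c = algebraMap S K s := by
      intro c hc
      induction hc using Algebra.adjoin_induction with
      | mem x hx =>
        rw [Set.mem_singleton_iff] at hx
        subst hx
        refine ⟨1, b, ?_⟩
        rw [hz, pow_one]; field_simp
      | algebraMap r => exact ⟨0, r, by simp⟩
      | add x x' _ _ h h' =>
        obtain ⟨k, s, h⟩ := h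
        obtain ⟨k', s', h'⟩ := h'
        refine ⟨k + k', y ^ k' * s + y ^ k * s', ?_⟩
        simp only [map_add, map_mul, ← h, ← h', map_pow]
        ring
      | mul x x' _ _ h h' =>
        obtain ⟨k, s, h⟩ := h
        obtain ⟨k', s', h'⟩ := h'
        refine ⟨k + k', s * s', ?_⟩
        simp only [map_mul, ← h, ← h', map_pow]
        ring
    obtain ⟨N, hN⟩ : ∃ N : ℕ, ∀ c ∈ C, ∃ s : S, algebraMap S K (y ^ N) * c = algebraMap S K s := by
      obtain ⟨G, hG⟩ := hCfg
      have hGC : ∀ g : G, ∃ k : ℕ, ∃ s : S, algebraMap S K (y ^ k) * g = algebraMap S K s := by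
        intro g
        apply hCy
        have : (g : K) ∈ C.toSubmodule := hG ▸ Submodule.subset_span g.2
        exact this
      choose k hk using hGC
      refine ⟨∑ g, k g, fun c hc => ?_⟩
      have hc' : c ∈ Submodule.span S (G : Set K) := hG ▸ hc
      induction hc' using Submodule.span_induction with
      | mem x hx =>
        obtain ⟨s, hs⟩ := hk ⟨x, hx⟩
        obtain ⟨j, hj⟩ : ∃ j, ∑ g, k g = k ⟨x, hx⟩ + j :=
          Nat.exists_eq_add_of_le (Finset.single_le_sum (f := k) (fun _ _ => Nat.zero_le _)
            (Finset.mem_univ _))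
        refine ⟨y ^ j * s, ?_⟩
        rw [hj, map_mul, ← hs, pow_add, map_mul]
        ring
      | zero => exact ⟨0, by simp⟩
      | add x x' hx hx' h h' =>
        obtain ⟨s, h⟩ := h (hG ▸ hx : x ∈ C.toSubmodule)
        obtain ⟨s', h'⟩ := h' (hG ▸ hx' : x' ∈ C.toSubmodule)
        exact ⟨s + s', by rw [mul_add, h, h', map_add]⟩
      | smul r x hx h =>
        obtain ⟨s, h⟩ := h (hG ▸ hx : x ∈ C.toSubmodule)
        exact ⟨r * s, by rw [map_mul, ← h, Algebra.smul_def]; ring⟩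
    let U : Subalgebra S K :=
      { carrier := {u | (∃ n : ℕ, algebraMap S K (t ^ n) * u ∈ C) ∧
          ∃ k : ℕ, ∃ s : S, algebraMap S K (y ^ k) * u = algebraMap S K s}
        mul_mem' := by
          rintro u u' ⟨⟨n, hn⟩, k, s, h⟩ ⟨⟨n', hn'⟩, k', s', h'⟩
          refine ⟨⟨n + n', ?_⟩, k + k', s * s', ?_⟩
          · have := C.mul_mem hn hn'
            convert this using 1
            rw [pow_add, map_mul]; ring
          · rw [map_mul, ← h, ← h', pow_add, map_mul]; ring
        add_mem' := by
          rintro u u' ⟨⟨n, hn⟩, k, s, h⟩ ⟨⟨n', hn'⟩, k', s', h'⟩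
          refine ⟨⟨n + n', ?_⟩, k + k', y ^ k' * s + y ^ k * s', ?_⟩
          · have := C.add_mem (C.mul_mem (C.algebraMap_mem (t ^ n')) hn)
              (C.mul_mem (C.algebraMap_mem (t ^ n)) hn')
            convert this using 1
            rw [pow_add, map_mul]; ring
          · simp only [map_add, map_mul, ← h, ← h', map_pow]
            ring
        algebraMap_mem' := fun r => ⟨⟨0, by simpa using C.algebraMap_mem r⟩, 0, r, by simp⟩ }
    have hCU : C ≤ U := fun c hc => ⟨⟨0, by simpa using hc⟩, hCy c hc⟩
    -- uniform denominators for U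
    have hUN : ∀ u ∈ U, ∃ s : S, algebraMap S K (y ^ N) * u = algebraMap S K s := by
      rintro u ⟨⟨n, hn⟩, k, s, h⟩
      obtain ⟨s', hs'⟩ := hN _ hn
      -- y^k s' = t^n y^N s
      have h1 : y ^ k * s' = t ^ n * (y ^ N * s) := by
        apply hinj
        rw [map_mul, ← hs', map_mul, map_mul, ← h]; ring
      have h2 : t ^ n ∣ s' := by
        refine htP.pow_dvd_of_dvd_mul_left n (fun hh => hty (htP.dvd_of_dvd_pow hh)) (a := y ^ k) ?_
        exact ⟨_, h1⟩
      obtain ⟨s'', rfl⟩ := h2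
      refine ⟨s'', ?_⟩
      have htn : algebraMap S K (t ^ n) ≠ 0 := by simpa using fun h => absurd h ht0
      apply mul_left_cancel₀ htn
      rw [← map_mul (algebraMap S K) (t ^ n) s'', ← hs']; ring
    have hyN : algebraMap S K (y ^ N) ≠ 0 := by simpa using fun h => absurd h hy0
    have hUfg : U.toSubmodule.FG := by
      have hle : U.toSubmodule ≤ Submodule.span S {(algebraMap S K (y ^ N))⁻¹} := by
        intro u hu
        obtain ⟨s, hs⟩ := hUN u hu
        rw [Submodule.mem_span_singleton]
        refine ⟨s, ?_⟩
        rw [Algebra.smul_def, ← hs]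
        field_simp
      have : IsNoetherian S (Submodule.span S {(algebraMap S K (y ^ N))⁻¹}) :=
        isNoetherian_of_fg_of_noetherian _ (Submodule.fg_span_singleton _)
      exact Submodule.FG.of_le (Submodule.fg_span_singleton _) hle
    have hUint : ∀ u ∈ U, IsIntegral S u := fun u hu => IsIntegral.of_mem_of_fg U hUfg u hu
    have key : U.toSubmodule ≤ (1 : Submodule S K) ⊔ (Ideal.span {t}) • U.toSubmodule := by
      intro u hu
      obtain ⟨c, hc⟩ := hUN u hu
      have hu' : u = algebraMap S K c / algebraMap S K (y ^ N) := by
        rw [← hc]; field_simp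
      obtain ⟨p, hp, hrel⟩ := exists_relation_of_isIntegral (K := K) (pow_ne_zero N hy0)
        (hu' ▸ hUint u hu)
      have hrel' := relation_map (Ideal.Quotient.mk (Ideal.span {t})) p hp hrel
      have hdv : Ideal.Quotient.mk (Ideal.span {t}) (y ^ N) ∣ Ideal.Quotient.mk (Ideal.span {t}) c := by
        refine dvd_of_relation ?_ _ (hp.map _) hrel'
        rw [Ne, Ideal.Quotient.eq_zero_iff_mem, Ideal.mem_span_singleton]
        exact fun hh => hty (htP.dvd_of_dvd_pow hh)
      obtain ⟨s, hs⟩ := hdv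
      obtain ⟨s, rfl⟩ := Ideal.Quotient.mk_surjective s
      rw [← map_mul, Ideal.Quotient.eq, Ideal.mem_span_singleton] at hs
      obtain ⟨d, hd⟩ := hs
      have ht0' : algebraMap S K t ≠ 0 := by simpa using ht0
      set w : K := algebraMap S K d / algebraMap S K (y ^ N) with hw
      have huw : u = algebraMap S K s + t • w := by
        rw [Algebra.smul_def, hu', hw, show c = y ^ N * s + t * d by rw [← hd]; ring, map_add,
          map_mul, map_mul]
        field_simp
      have hwU : w ∈ U := by
        refine ⟨?_, N, d, by rw [hw]; field_simp⟩
        obtain ⟨⟨n, hn⟩, -⟩ := hu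
        refine ⟨n + 1, ?_⟩
        have : algebraMap S K (t ^ (n+1)) * w =
          algebraMap S K (t ^ n) * u - algebraMap S K (t ^ n * s) := by
          rw [huw, Algebra.smul_def, pow_succ, map_mul, map_mul]; ring
        rw [this]
        exact C.sub_mem hn (C.algebraMap_mem _)
      rw [huw]
      refine Submodule.add_mem_sup ?_ (Submodule.smul_mem_smul (Ideal.mem_span_singleton_self t) hwU)
      rw [Submodule.mem_one]; exact ⟨s, rfl⟩
    have hle : U.toSubmodule ≤ (1 : Submodule S K) := by
      refine Submodule.le_of_le_smul_of_le_jacobson_bot hUfg ?_ key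
      rw [IsLocalRing.jacobson_eq_maximalIdeal _ bot_ne_top, Ideal.span_singleton_le_iff_mem]
      exact ht
    have hzU : z ∈ U := hCU (Algebra.self_mem_adjoin_singleton S z)
    exact Submodule.mem_one.1 (hle hzU)
  rw [isIntegrallyClosed_iff K]
  intro x hx
  obtain ⟨b, y, hy, rfl⟩ := IsFractionRing.div_surjective (A := S) x
  have hy0 : y ≠ 0 := nonZeroDivisors.ne_zero hy
  by_cases hb0 : b = 0
  · exact ⟨0, by simp [hb0]⟩
  obtain ⟨i, y', hyy, hy'⟩ := exists_eq_pow_mul_not_dvd ht hy0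
  obtain ⟨j, b', hbb, hb'⟩ := exists_eq_pow_mul_not_dvd ht hb0
  have ht0' : algebraMap S K t ≠ 0 := by simpa using ht0
  have hy'0 : y' ≠ 0 := fun h => hy' (h ▸ dvd_zero t)
  have hy'0' : algebraMap S K y' ≠ 0 := by simpa using hy'0
  rcases le_or_gt i j with hij | hij
  · obtain ⟨d, rfl⟩ := Nat.exists_eq_add_of_le hij
    have : algebraMap S K b / algebraMap S K y =
        algebraMap S K (t ^ d * b') / algebraMap S K y' := by
      rw [hyy, hbb]; simp only [map_mul, map_pow, pow_add]; field_simp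
    rw [this] at hx ⊢
    exact core _ _ hy' hy'0 hx
  · exfalso
    obtain ⟨d, rfl⟩ := Nat.exists_eq_add_of_lt hij
    have : algebraMap S K b / algebraMap S K y =
        algebraMap S K b' / algebraMap S K (t * (t ^ d * y')) := by
      rw [hyy, hbb]; simp only [map_mul, map_pow, pow_add]; field_simp
    rw [this] at hx
    obtain ⟨p, hp, hrel⟩ := exists_relation_of_isIntegral (K := K)
      (mul_ne_zero ht0 (mul_ne_zero (pow_ne_zero _ ht0) hy'0)) hx
    rw [Finset.sum_range_succ] at hrel
    simp only [hp.coeff_natDegree, one_mul, Nat.sub_self, pow_zero, mul_one] at hrel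
    have h1 : t ∣ b' ^ p.natDegree := by
      rw [← dvd_add_right (a := t) (b := ∑ i ∈ Finset.range p.natDegree, p.coeff i * b' ^ i *
        (t * (t ^ d * y')) ^ (p.natDegree - i)), hrel]
      · exact dvd_zero t
      · refine Finset.dvd_sum fun i hi => Dvd.dvd.mul_left ?_ _
        rw [Finset.mem_range] at hi
        exact (dvd_mul_right t _).trans (dvd_pow_self _ (by omega))
    exact hb' (htP.dvd_of_dvd_pow h1)

theorem isIntegrallyClosed_of_quotient {S : Type*} [CommRing S] [IsNoetherianRing S] [IsLocalRing S]
    [IsDomain S] {t : S} (ht : t ∈ maximalIdeal S) (ht0 : t ≠ 0)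
    [hd : IsDomain (S ⧸ Ideal.span {t})] [IsIntegrallyClosed (S ⧸ Ideal.span {t})] :
    IsIntegrallyClosed S :=
  isIntegrallyClosed_of_quotient_aux (FractionRing S) ht ht0

/-- In a Noetherian local ring, ideals are closed. -/
theorem mem_of_forall_mem_sup_pow {A : Type*} [CommRing A] [IsLocalRing A] [IsNoetherianRing A]
    (I : Ideal A) {x : A} (h : ∀ l, x ∈ I ⊔ maximalIdeal A ^ l) : x ∈ I := by
  have key : ∀ l, (Ideal.Quotient.mk I x : A ⧸ I) ∈ (maximalIdeal A ^ l • ⊤ : Submodule A (A ⧸ I)) := by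
    intro l
    obtain ⟨y, hy, z, hz, rfl⟩ := Submodule.mem_sup.1 (h l)
    have : (Ideal.Quotient.mk I (y + z) : A ⧸ I) = z • (1 : A ⧸ I) := by
      rw [map_add, Ideal.Quotient.eq_zero_iff_mem.2 hy, zero_add, Algebra.smul_def, mul_one]; rfl
    rw [this]
    exact Submodule.smul_mem_smul hz trivial
  have h2 := Ideal.iInf_pow_smul_eq_bot_of_isLocalRing (M := A ⧸ I) (maximalIdeal A)
    (Ideal.IsPrime.ne_top inferInstance)
  have h3 : (Ideal.Quotient.mk I x : A ⧸ I) ∈ (⨅ i : ℕ, maximalIdeal A ^ i • ⊤ : Submodule A (A ⧸ I)) := by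
    rw [Submodule.mem_iInf]; exact key
  rw [h2] at h3
  exact Ideal.Quotient.eq_zero_iff_mem.1 (by simpa using h3)

theorem exists_limit {A : Type*} [CommRing A] (I : Ideal A) [IsPrecomplete I A] (f : ℕ → A)
    (hf : ∀ n, f (n + 1) - f n ∈ I ^ n) : ∃ L, ∀ n, f n - L ∈ I ^ n := by
  have h2 : ∀ {m n}, m ≤ n → f n - f m ∈ I ^ m := by
    intro m n hmn
    induction n, hmn using Nat.le_induction with
    | base => simp
    | succ n hmn ih =>
      have := add_mem (Ideal.pow_le_pow_right hmn (hf n)) ih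
      simpa using this
  obtain ⟨L, hL⟩ := IsPrecomplete.prec (I := I) (M := A) inferInstance (f := f) (by
    intro m n hmn
    rw [SModEq.sub_mem]
    have := h2 hmn
    rw [← neg_sub]
    simpa [Ideal.smul_eq_mul] using neg_mem this)
  refine ⟨L, fun n => ?_⟩
  have := hL n
  rw [SModEq.sub_mem] at this
  simpa [Ideal.smul_eq_mul] using this

theorem isArtinianRing_quotient_of_pow_le {A : Type*} [CommRing A] [IsLocalRing A]
    [IsNoetherianRing A] {J : Ideal A} {l : ℕ} (h : maximalIdeal A ^ l ≤ J) :
    IsArtinianRing (A ⧸ J) := by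
  by_cases hJ : J = ⊤
  · have : Subsingleton (A ⧸ J) := Ideal.Quotient.subsingleton_iff.2 hJ
    infer_instance
  have : Nontrivial (A ⧸ J) := Ideal.Quotient.nontrivial_iff.2 hJ
  have : IsLocalRing (A ⧸ J) := .of_surjective' _ Ideal.Quotient.mk_surjective
  rw [isArtinianRing_iff_isNilpotent_maximalIdeal]
  refine ⟨l, ?_⟩
  have h1 : maximalIdeal (A ⧸ J) ≤ (maximalIdeal A).map (Ideal.Quotient.mk J) := by
    intro x hx
    obtain ⟨x, rfl⟩ := Ideal.Quotient.mk_surjective x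
    refine Ideal.mem_map_of_mem _ ?_
    rw [mem_maximalIdeal, mem_nonunits_iff] at hx ⊢
    exact fun hu => hx (hu.map _)
  rw [Ideal.zero_eq_bot, eq_bot_iff]
  refine (Ideal.pow_right_mono h1 l).trans ?_
  rw [← Ideal.map_pow, Ideal.map_le_iff_le_comap, ← RingHom.ker_eq_comap_bot, Ideal.mk_ker]
  exact h

/-- Chevalley's lemma. -/
theorem chevalley {A : Type*} [CommRing A] [IsLocalRing A] [IsNoetherianRing A]
    [IsAdicComplete (maximalIdeal A) A] (F : Set (Ideal A)) (hne : F.Nonempty)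
    (hdir : ∀ I ∈ F, ∀ J ∈ F, ∃ K ∈ F, K ≤ I ∧ K ≤ J) (hbot : ∀ x, (∀ I ∈ F, x ∈ I) → x = 0)
    (j : ℕ) : ∃ I ∈ F, I ≤ maximalIdeal A ^ j := by
  set m := maximalIdeal A with hm
  -- least element of the family I ⊔ m^l
  have step : ∀ l, ∃ I ∈ F, ∀ J ∈ F, I ⊔ m ^ l ≤ J ⊔ m ^ l := by
    intro l
    have hart : IsArtinianRing (A ⧸ m ^ l) := isArtinianRing_quotient_of_pow_le le_rfl
    obtain ⟨I0, hI0⟩ := hne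
    obtain ⟨J, ⟨I, hI, rfl⟩, hmin⟩ := (IsWellFounded.wf (r := ((· < ·) : Ideal (A ⧸ m ^ l) → _ → Prop))).has_min
      ((fun I : Ideal A => I.map (Ideal.Quotient.mk (m ^ l))) '' F) ⟨_, I0, hI0, rfl⟩
    refine ⟨I, hI, fun J hJ => ?_⟩
    obtain ⟨K, hK, hKI, hKJ⟩ := hdir I hI J hJ
    have h1 := hmin _ ⟨K, hK, rfl⟩
    have h2 : K.map (Ideal.Quotient.mk (m ^ l)) = I.map (Ideal.Quotient.mk (m ^ l)) := by
      by_contra hne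
      exact h1 (lt_of_le_of_ne (Ideal.map_mono hKI) hne)
    have h3 := congrArg (Ideal.comap (Ideal.Quotient.mk (m ^ l))) h2
    rw [Ideal.comap_map_of_surjective _ Ideal.Quotient.mk_surjective,
      Ideal.comap_map_of_surjective _ Ideal.Quotient.mk_surjective, ← RingHom.ker_eq_comap_bot,
      Ideal.mk_ker] at h3
    rw [← h3]
    exact sup_le_sup_right hKJ _
  choose I hIF hI using step
  by_contra! hcon
  have hlift : ∀ l, ∀ x ∈ I l ⊔ m ^ l, ∃ y ∈ I (l + 1) ⊔ m ^ (l + 1), y - x ∈ m ^ l := by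
    intro l x hx
    have := hI l _ (hIF (l + 1)) hx
    obtain ⟨a, ha, b, hb, rfl⟩ := Submodule.mem_sup.1 this
    exact ⟨a, Ideal.mem_sup_left ha, by simpa using hb⟩
  obtain ⟨x0, hx0, hx0'⟩ := SetLike.not_le_iff_exists.1 (hcon _ (hIF j))
  choose! g hg hg' using hlift
  let f : ℕ → A := fun n => Nat.rec x0 (fun i x => g (j + i) x) n
  have hf0 : ∀ n, f n ∈ I (j + n) ⊔ m ^ (j + n) := by
    intro n
    induction n with
    | zero => exact Ideal.mem_sup_left hx0
    | succ n ih => exact hg (j + n) _ ih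
  obtain ⟨L, hL⟩ := exists_limit m f (fun n => by
    have := hg' (j + n) _ (hf0 n)
    exact Ideal.pow_le_pow_right (by lia) this)
  have hf2 : ∀ n, f n - f 0 ∈ m ^ j := by
    intro n
    induction n with
    | zero => simp
    | succ n ih =>
      have := add_mem (Ideal.pow_le_pow_right (by lia : j ≤ j + n) (hg' (j + n) _ (hf0 n))) ih
      rw [sub_add_sub_cancel] at this
      exact this
  have hL0 : L = 0 := by
    refine hbot L fun K hK => mem_of_forall_mem_sup_pow K fun l => ?_
    have h1 : f l ∈ K ⊔ m ^ l :=
      (sup_le_sup_left (Ideal.pow_le_pow_right (by lia)) K) (hI (j + l) K hK (hf0 l))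
    have := sub_mem h1 (Ideal.mem_sup_right (hL l))
    simpa using this
  apply hx0'
  have h1 := hL j
  rw [hL0, sub_zero] at h1
  have h2 := sub_mem h1 (hf2 j)
  simpa [f] using h2

theorem eq_of_le_of_height_le_one {D : Type*} [CommRing D] [IsDomain D] {P Q : Ideal D}
    [P.IsPrime] [Q.IsPrime] (h : P ≤ Q) (hP : P ≠ ⊥) (hQ : Q.height ≤ 1) : P = Q := by
  by_contra hne
  have h1 := Ideal.height_add_one_le_of_lt_of_isPrime (lt_of_le_of_ne h hne)
  have h2 := Ideal.height_add_one_le_of_lt_of_isPrime (bot_lt_iff_ne_bot.2 hP)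
  rw [Ideal.height_bot, zero_add] at h2
  have h3 : (1 : ℕ∞) + 1 ≤ 1 := (add_le_add_left h2 1).trans (h1.trans hQ)
  exact absurd h3 (by decide)

theorem dimensionLEOne_of_forall_mem {D : Type*} [CommRing D] [IsDomain D] [IsNoetherianRing D]
    [IsLocalRing D] {f : D} (hf : f ≠ 0) (hfm : f ∈ maximalIdeal D)
    (h : ∀ P : Ideal D, P.IsPrime → P ≠ ⊥ → f ∈ P) : Ring.DimensionLEOne D := by
  have key : maximalIdeal D ∈ (Ideal.span {f}).minimalPrimes := by
    by_contra hcon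
    have hfin := Ideal.finite_minimalPrimes_of_isNoetherianRing D (Ideal.span {f})
    have hnot : ¬ ((maximalIdeal D : Set D) ⊆ ⋃ i ∈ (hfin.toFinset : Set (Ideal D)), (i : Set D)) := by
      rw [Ideal.subset_union_prime (f := fun i : Ideal D => i) ⊤ ⊤ (fun i hi _ _ => by
        simp at hi; exact hi.1.1)]
      rintro ⟨i, hi, hle⟩
      simp at hi
      have := hi.1.1
      have h2 : i = maximalIdeal D := le_antisymm (IsLocalRing.le_maximalIdeal this.ne_top) hle
      exact hcon (h2 ▸ hi)
    rw [Set.not_subset] at hnot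
    obtain ⟨g, hg, hgn⟩ := hnot
    obtain ⟨P2, hP2, -⟩ := Ideal.exists_minimalPrimes_le (I := Ideal.span {g}) (J := maximalIdeal D)
      (by simpa [Ideal.span_le] using hg)
    have := hP2.1.1
    have hfle : ∀ P : Ideal D, P ∈ (Ideal.span {f}).minimalPrimes → g ∉ P := by
      intro P hP hgP
      apply hgn
      simp only [Set.mem_iUnion]
      exact ⟨P, by simpa using hP, hgP⟩
    obtain ⟨P0, hP0, hP0m⟩ := Ideal.exists_minimalPrimes_le (I := Ideal.span {f}) (J := maximalIdeal D)
      (by simpa [Ideal.span_le] using hfm)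
    have hg0 : g ≠ 0 := by rintro rfl; exact hfle P0 hP0 (zero_mem _)
    have hgP2 : g ∈ P2 := hP2.1.2 (Ideal.mem_span_singleton_self g)
    have hP2b : P2 ≠ ⊥ := by rintro rfl; exact hg0 (by simpa using hgP2)
    obtain ⟨P3, hP3, hP3le⟩ := Ideal.exists_minimalPrimes_le (I := Ideal.span {f}) (J := P2)
      (by simpa [Ideal.span_le] using h P2 this hP2b)
    have := hP3.1.1
    have hP3b : P3 ≠ ⊥ := by
      rintro rfl; exact hf (by simpa using hP3.1.2 (Ideal.mem_span_singleton_self f))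
    have := eq_of_le_of_height_le_one hP3le hP3b
      (Ideal.height_le_one_of_isPrincipal_of_mem_minimalPrimes _ _ hP2)
    exact hfle P3 hP3 (this ▸ hgP2)
  have hht := Ideal.height_le_one_of_isPrincipal_of_mem_minimalPrimes _ _ key
  refine ⟨fun {p} hp hprime => ?_⟩
  rw [eq_of_le_of_height_le_one (IsLocalRing.le_maximalIdeal hprime.ne_top) hp hht]
  infer_instance

theorem exists_prime_dimensionLEOne {A : Type*} [CommRing A] [IsDomain A] [IsNoetherianRing A]
    [IsLocalRing A] (hA : maximalIdeal A ≠ ⊥) {f : A} (hf : f ≠ 0) :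
    ∃ P : Ideal A, P.IsPrime ∧ f ∉ P ∧ P ≠ maximalIdeal A ∧ Ring.DimensionLEOne (A ⧸ P) := by
  obtain ⟨a, ham, ha0⟩ := Submodule.exists_mem_ne_zero_of_ne_bot hA
  obtain ⟨P, ⟨hP, hafP⟩, hmax⟩ := set_has_maximal_iff_noetherian.2 (inferInstance : IsNoetherian A A)
    {P : Ideal A | P.IsPrime ∧ a * f ∉ P} ⟨⊥, Ideal.isPrime_bot, by simpa using ⟨ha0, hf⟩⟩
  have haP : a ∉ P := fun h => hafP (Ideal.mul_mem_right _ P h)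
  refine ⟨P, hP, fun h => hafP (Ideal.mul_mem_left P _ h), fun h => haP (h ▸ ham), ?_⟩
  have : IsLocalRing (A ⧸ P) := .of_surjective' _ Ideal.Quotient.mk_surjective
  refine dimensionLEOne_of_forall_mem (f := Ideal.Quotient.mk P (a * f)) ?_ ?_ ?_
  · rwa [Ne, Ideal.Quotient.eq_zero_iff_mem]
  · have : (Ideal.Quotient.mk P a) ∈ maximalIdeal (A ⧸ P) := by
      rw [mem_maximalIdeal, mem_nonunits_iff]
      intro hu
      obtain ⟨b, hb⟩ := hu.exists_right_inv
      obtain ⟨b, rfl⟩ := Ideal.Quotient.mk_surjective b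
      rw [← map_mul, ← map_one (Ideal.Quotient.mk P), Ideal.Quotient.eq] at hb
      have h1 := sub_mem (Ideal.mul_mem_right b _ ham) (IsLocalRing.le_maximalIdeal hP.ne_top hb)
      rw [sub_sub_cancel] at h1
      exact (Ideal.ne_top_iff_one _).1 (Ideal.IsPrime.ne_top inferInstance) h1
    rw [map_mul]
    exact Ideal.mul_mem_right _ _ this
  · intro Q hQ hQb
    by_contra hcon
    refine hmax (Q.comap (Ideal.Quotient.mk P)) ⟨inferInstance, hcon⟩ (lt_of_le_of_ne ?_ ?_)
    · intro x hx
      rw [Ideal.mem_comap, Ideal.Quotient.eq_zero_iff_mem.2 hx]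
      exact zero_mem _
    · intro h
      apply hQb
      rw [eq_bot_iff]
      intro x hx
      obtain ⟨x, rfl⟩ := Ideal.Quotient.mk_surjective x
      have : x ∈ P := by rw [h]; exact hx
      exact Ideal.Quotient.eq_zero_iff_mem.2 this

theorem exists_pow_mem_span {D : Type*} [CommRing D] [IsDomain D]
    [IsLocalRing D] [Ring.DimensionLEOne D] {a x : D} (ha : a ∈ maximalIdeal D) (hx : x ≠ 0) :
    ∃ N, x ∣ a ^ N := by
  have : a ∈ (Ideal.span {x}).radical := by
    rw [Ideal.radical_eq_sInf, Submodule.mem_sInf]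
    rintro P ⟨hxP, hP⟩
    have hPb : P ≠ ⊥ := by
      rintro rfl; exact hx (by simpa using hxP (Ideal.mem_span_singleton_self x))
    rw [IsLocalRing.eq_maximalIdeal (hP.isMaximal hPb)]
    exact ha
  obtain ⟨N, hN⟩ := this
  exact ⟨N, Ideal.mem_span_singleton.1 hN⟩

/-- Complete one-dimensional local domains have finite integral closure. -/
theorem finite_integralClosure {D : Type*} (F : Type*) [CommRing D] [IsDomain D] [IsNoetherianRing D]
    [IsLocalRing D] [Ring.DimensionLEOne D] [IsAdicComplete (maximalIdeal D) D]
    [Field F] [Algebra D F] [IsFractionRing D F] (hD : maximalIdeal D ≠ ⊥) :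
    Module.Finite D (integralClosure D F) := by
  obtain ⟨a, ham, ha0⟩ := Submodule.exists_mem_ne_zero_of_ne_bot hD
  have haF : algebraMap D F a ≠ 0 := by simpa using ha0
  let C := integralClosure D F
  -- the ideals
  let I : ℕ → Ideal D := fun n => (Ideal.span {algebraMap D C a ^ n}).comap (algebraMap D C)
  have hanti : Antitone I := by
    intro m n hmn
    refine Ideal.comap_mono ?_
    rw [Ideal.span_singleton_le_span_singleton]
    exact pow_dvd_pow _ hmn
  obtain ⟨j, hj⟩ : ∃ j, maximalIdeal D ^ j ≤ Ideal.span {a} := by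
    refine Ideal.exists_pow_le_of_le_radical_of_fg (fun x hx => ?_) (IsNoetherian.noetherian _)
    obtain ⟨N, hN⟩ := exists_pow_mem_span hx ha0
    exact ⟨N, Ideal.mem_span_singleton.2 hN⟩
  have hnu : ¬ IsUnit (algebraMap D C a) := by
    intro hu
    have : IsLocalHom (algebraMap D C) := Algebra.IsIntegral.isLocalHom D C
    exact ham (isUnit_of_map_unit _ _ hu)
  obtain ⟨_, ⟨n, rfl⟩, hn⟩ := chevalley (Set.range I) ⟨_, 0, rfl⟩
    (by
      rintro _ ⟨m, rfl⟩ _ ⟨n, rfl⟩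
      exact ⟨_, ⟨max m n, rfl⟩, hanti (le_max_left _ _), hanti (le_max_right _ _)⟩)
    (by
      intro x hx
      by_contra hx0
      obtain ⟨N, w, hw⟩ := exists_pow_mem_span ham hx0
      have h1 : x ∈ I (N + 1) := hx _ ⟨_, rfl⟩
      obtain ⟨c, hc⟩ := Ideal.mem_span_singleton.1 (Ideal.mem_comap.1 h1)
      apply hnu
      have h2 := congrArg (algebraMap D C) hw
      rw [map_pow, map_mul, hc] at h2
      have h3 : algebraMap D C a ≠ 0 := by
        intro h
        apply haF
        have := congrArg (algebraMap C F) h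
        rwa [← IsScalarTower.algebraMap_apply, map_zero] at this
      have h4 : algebraMap D C a ^ N * (algebraMap D C a * (c * algebraMap D C w)) = algebraMap D C a ^ N * 1 := by
        linear_combination -h2
      have h5 := mul_left_cancel₀ (pow_ne_zero N h3) h4
      exact IsUnit.of_mul_eq_one _ h5) j
  -- every integral element has denominator a ^ n
  have hclaim : ∀ z : C, ∃ d : D, algebraMap D F d = algebraMap D F a ^ n * (z : F) := by
    intro z
    obtain ⟨d, s, hs, hz⟩ := IsFractionRing.div_surjective (A := D) (z : F)
    obtain ⟨N, w, hw⟩ := exists_pow_mem_span ham (nonZeroDivisors.ne_zero hs)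
    have hex : ∃ k, ∃ d : D, algebraMap D F d = algebraMap D F a ^ (n + k) * (z : F) := by
      refine ⟨N, a ^ n * (w * d), ?_⟩
      have hs0 : algebraMap D F s ≠ 0 := by simpa using nonZeroDivisors.ne_zero hs
      rw [← hz, pow_add, ← map_pow _ _ N, hw]
      simp only [map_mul, map_pow]
      field_simp
    obtain ⟨k, hk⟩ := hex
    induction k with
    | zero => exact hk
    | succ k ih =>
      obtain ⟨e, he⟩ := hk
      have h1 : e ∈ I n := by
        refine Ideal.mem_comap.2 (Ideal.mem_span_singleton.2 ⟨algebraMap D C a ^ (k+1) * z, ?_⟩)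
        apply Subtype.ext
        change algebraMap D F e = _
        rw [he, ← add_assoc, pow_succ, pow_add]
        push_cast
        simp only [pow_succ]
        change _ = algebraMap D F a ^ n * (algebraMap D F a ^ k * algebraMap D F a * (z : F))
        ring
      obtain ⟨e', rfl⟩ := Ideal.mem_span_singleton.1 (hj (hn h1))
      apply ih
      refine ⟨e', ?_⟩
      rw [map_mul, ← add_assoc, pow_succ, mul_comm (_ ^ _), mul_assoc] at he
      exact mul_left_cancel₀ haF he
  let φ : C →ₗ[D] F := (LinearMap.mulLeft D (algebraMap D F a ^ n)) ∘ₗ C.toSubmodule.subtype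
  have hφ : Function.Injective φ := by
    intro x y hxy
    exact Subtype.ext (mul_left_cancel₀ (pow_ne_zero n haF) hxy)
  have hr : LinearMap.range φ ≤ LinearMap.range (Algebra.linearMap D F) := by
    rintro _ ⟨z, rfl⟩
    obtain ⟨d, hd⟩ := hclaim z
    exact ⟨d, hd⟩
  have : IsNoetherian D (LinearMap.range (Algebra.linearMap D F)) := inferInstance
  have : IsNoetherian D (LinearMap.range φ) := isNoetherian_of_le hr
  have : IsNoetherian D C := isNoetherian_of_injective φ.rangeRestrict (by
    intro x y h; exact hφ (congrArg Subtype.val h))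
  infer_instance

theorem isIntegrallyClosed_of_ringEquiv {R S : Type*} [CommRing R] [CommRing S] (e : R ≃+* S)
    (h : IsDomain R ∧ IsIntegrallyClosed R) : IsDomain S ∧ IsIntegrallyClosed S := by
  obtain ⟨h1, h2⟩ := h
  exact ⟨MulEquiv.isDomain R e.symm.toMulEquiv, IsIntegrallyClosed.of_equiv e⟩

theorem IsNormalRing.of_isLocalization {R R' : Type*} [CommRing R] [CommRing R'] [Algebra R R']
    (N : Submonoid R) [IsLocalization N R'] (h : IsNormalRing R) : IsNormalRing R' := by
  intro Q hQ
  have h2 : IsLocalization.AtPrime (Localization.AtPrime Q) (Q.comap (algebraMap R R')) :=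
    IsLocalization.isLocalization_isLocalization_atPrime_isLocalization N _ Q
  exact isIntegrallyClosed_of_ringEquiv
    (IsLocalization.algEquiv (Q.comap (algebraMap R R')).primeCompl
      (Localization.AtPrime (Q.comap (algebraMap R R'))) (Localization.AtPrime Q)).toRingEquiv
    (h _ inferInstance)

theorem IsNormalRing.of_ringEquiv {R R' : Type*} [CommRing R] [CommRing R'] (e : R ≃+* R')
    (h : IsNormalRing R) : IsNormalRing R' := by
  let _ := e.toRingHom.toAlgebra
  have : IsLocalization (⊥ : Submonoid R) R := IsLocalization.self bot_le
  have : IsLocalization (⊥ : Submonoid R) R' :=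
    IsLocalization.isLocalization_of_algEquiv ⊥ (AlgEquiv.ofRingEquiv (f := e) (fun _ => rfl) : R ≃ₐ[R] R')
  exact h.of_isLocalization ⊥

theorem IsNormalRing.of_isLocalRing {R : Type*} [CommRing R] [IsLocalRing R]
    (h : IsNormalRing R) : IsDomain R ∧ IsIntegrallyClosed R := by
  have h2 : IsLocalization.AtPrime R (maximalIdeal R) := by
    refine IsLocalization.self fun x hx => ?_
    exact (IsUnit.mem_submonoid_iff x).2 (by simpa using hx)
  exact isIntegrallyClosed_of_ringEquiv
    (IsLocalization.algEquiv (maximalIdeal R).primeCompl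
      (Localization.AtPrime (maximalIdeal R)) R).toRingEquiv
    (h _ inferInstance)


theorem normal_localization_quotient {T T' : Type*} [CommRing T] [CommRing T'] [Algebra T T']
    [IsLocalRing T'] (N : Submonoid T) [IsLocalization N T'] (I : Ideal T)
    (hI : I.map (algebraMap T T') ≠ ⊤) (h : IsNormalRing (T ⧸ I)) :
    IsDomain (T' ⧸ I.map (algebraMap T T')) ∧ IsIntegrallyClosed (T' ⧸ I.map (algebraMap T T')) := by
  let J := I.map (algebraMap T T')
  let _ : Algebra (T ⧸ I) (T' ⧸ J) :=
    (Ideal.quotientMap J (algebraMap T T') Ideal.le_comap_map).toAlgebra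
  have hloc : IsLocalization (Submonoid.map (Ideal.Quotient.mk I) N) (T' ⧸ J) := by
    refine IsLocalization.of_surjective N T' (Ideal.Quotient.mk I) Ideal.Quotient.mk_surjective
      (Ideal.Quotient.mk J) Ideal.Quotient.mk_surjective ?_ ?_
    · ext x; rfl
    · rw [Ideal.mk_ker, Ideal.mk_ker]
  have : Nontrivial (T' ⧸ J) := Ideal.Quotient.nontrivial_iff.2 hI
  have : IsLocalRing (T' ⧸ J) := .of_surjective' _ Ideal.Quotient.mk_surjective
  exact (h.of_isLocalization (R' := T' ⧸ J) (Submonoid.map (Ideal.Quotient.mk I) N)).of_isLocalRing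

/-- Normality of `S ⊗ V` at maximal ideals, for `V` a finite Dedekind `A`-algebra. -/
theorem normal_tensor_dedekind {A : Type u} {S : Type v} [CommRing A] [IsLocalRing A] [IsNoetherianRing A]
    [CommRing S] [IsLocalRing S] [IsNoetherianRing S] [Algebra A S] [IsLocalHom (algebraMap A S)]
    [Module.Flat A S]
    (hS : ∀ (L : Type u) [Field L] [Algebra A L] [Module.Finite A L], IsNormalRing (S ⊗[A] L))
    (V : Type u) [CommRing V] [IsDedekindDomain V] [Algebra A V] [Module.Finite A V]
    {a : A} (ham : a ∈ maximalIdeal A) (ha : algebraMap A V a ≠ 0)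
    (M : Ideal (S ⊗[A] V)) [hM : M.IsMaximal] :
    IsDomain (Localization.AtPrime M) ∧ IsIntegrallyClosed (Localization.AtPrime M) := by
  let iV : V →ₐ[A] S ⊗[A] V := Algebra.TensorProduct.includeRight
  have hMS : M.comap (algebraMap S (S ⊗[A] V)) = maximalIdeal S := by
    have : (M.comap (algebraMap S (S ⊗[A] V))).IsMaximal := Ideal.isMaximal_comap_of_isIntegral_of_isMaximal M
    exact IsLocalRing.eq_maximalIdeal this
  have haM : iV (algebraMap A V a) ∈ M := by
    rw [iV.commutes, IsScalarTower.algebraMap_apply A S]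
    change _ ∈ M.comap (algebraMap S (S ⊗[A] V))
    rw [hMS]
    rw [mem_maximalIdeal, mem_nonunits_iff] at ham ⊢
    exact fun hu => ham (isUnit_of_map_unit _ _ hu)
  let 𝔑 : Ideal V := M.comap iV
  have h𝔑p : 𝔑.IsPrime := Ideal.IsPrime.comap _
  have h𝔑b : 𝔑 ≠ ⊥ := by
    intro h
    apply ha
    have : algebraMap A V a ∈ 𝔑 := haM
    rw [h] at this
    simpa using this
  have h𝔑 : 𝔑.IsMaximal := h𝔑p.isMaximal h𝔑b
  let _ : Field (V ⧸ 𝔑) := Ideal.Quotient.field 𝔑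
  have hn := hS (V ⧸ 𝔑)
  -- the quotient
  let I : Ideal (S ⊗[A] V) := 𝔑.map iV
  have hIM : I ≤ M := Ideal.map_comap_le
  have hnI : IsNormalRing ((S ⊗[A] V) ⧸ I) := by
    let f : S ⊗[A] V →ₐ[A] S ⊗[A] (V ⧸ 𝔑) :=
      Algebra.TensorProduct.map (AlgHom.id A S) (Ideal.Quotient.mkₐ A 𝔑)
    have hf : Function.Surjective f :=
      TensorProduct.map_surjective Function.surjective_id (Ideal.Quotient.mkₐ_surjective A 𝔑)
    have hker : RingHom.ker f = I := by
      have := Algebra.TensorProduct.lTensor_ker (A := S) (Ideal.Quotient.mkₐ A 𝔑) (Ideal.Quotient.mkₐ_surjective A 𝔑)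
      refine this.trans ?_
      congr 1
      exact Ideal.Quotient.mkₐ_ker A 𝔑
    rw [← hker]
    exact hn.of_ringEquiv (RingHom.quotientKerEquivOfSurjective (f := f.toRingHom) hf).symm
  let TM := Localization.AtPrime M
  have hImap : I.map (algebraMap (S ⊗[A] V) TM) ≤ maximalIdeal TM := by
    rw [← Localization.AtPrime.map_eq_maximalIdeal]
    exact Ideal.map_mono hIM
  have hq := normal_localization_quotient (T' := TM) M.primeCompl I
    (fun h => Ideal.IsPrime.ne_top (I := maximalIdeal TM) inferInstance (top_le_iff.1 (h ▸ hImap))) hnI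
  -- uniformizer
  obtain ⟨π, hπ, hπ2⟩ : ∃ π ∈ 𝔑, π ∉ 𝔑 ^ 2 := by
    have : 𝔑 ^ 2 < 𝔑 := Ideal.pow_lt_self 𝔑 h𝔑b h𝔑.ne_top 2 le_rfl
    obtain ⟨π, h1, h2⟩ := SetLike.exists_of_lt this
    exact ⟨π, h1, h2⟩
  let t : TM := algebraMap (S ⊗[A] V) TM (iV π)
  have : IsNoetherianRing (S ⊗[A] V) := IsNoetherianRing.of_finite S _
  have : IsNoetherianRing TM := IsLocalization.isNoetherianRing M.primeCompl TM inferInstance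
  have hspan : I.map (algebraMap (S ⊗[A] V) TM) = Ideal.span {t} := by
    apply le_antisymm
    · refine Submodule.le_of_le_smul_of_le_jacobson_bot (I := maximalIdeal TM) (IsNoetherian.noetherian _)
        (by rw [IsLocalRing.jacobson_eq_maximalIdeal _ bot_ne_top]) ?_
      refine Ideal.map_le_iff_le_comap.2 (Ideal.map_le_iff_le_comap.2 ?_)
      intro c hc
      obtain ⟨d, e, he, rfl⟩ := Ideal.exists_mul_add_mem_pow_succ (i := 1) h𝔑b π c (by simpa using hπ) hπ2 (by simpa using hc)
      rw [Ideal.mem_comap, Ideal.mem_comap, map_add, map_add]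
      refine add_mem (Ideal.mem_sup_left ?_) (Ideal.mem_sup_right ?_)
      · rw [map_mul, map_mul]
        exact Ideal.mul_mem_right _ _ (Ideal.mem_span_singleton_self t)
      · have h1 : algebraMap (S ⊗[A] V) TM (iV e) ∈ ((𝔑 ^ 2).map iV).map (algebraMap (S ⊗[A] V) TM) :=
          Ideal.mem_map_of_mem _ (Ideal.mem_map_of_mem _ he)
        rw [Ideal.map_pow, Ideal.map_pow, pow_two] at h1
        exact Ideal.mul_mono_left hImap h1
    · rw [Ideal.span_singleton_le_iff_mem]
      exact Ideal.mem_map_of_mem _ (Ideal.mem_map_of_mem _ hπ)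
  rw [hspan] at hq
  have hπ0 : π ≠ 0 := by rintro rfl; exact hπ2 (zero_mem _)
  have htm : t ∈ maximalIdeal TM := hImap (hspan ▸ Ideal.mem_span_singleton_self t)
  have hreg : iV π ∈ nonZeroDivisors (S ⊗[A] V) := by
    rw [mem_nonZeroDivisors_iff_right]
    intro x hx
    have hinj : Function.Injective (LinearMap.lTensor S (LinearMap.mulLeft A π)) :=
      Module.Flat.lTensor_preserves_injective_linearMap _ (fun x y h => mul_left_cancel₀ hπ0 h)
    apply hinj
    rw [map_zero, ← hx]
    have : LinearMap.lTensor S (LinearMap.mulLeft A π) = LinearMap.mulRight A (iV π) := by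
      ext s v
      simp [iV, mul_comm]
    rw [this]; rfl
  have htreg : t ∈ nonZeroDivisors TM := IsLocalization.map_nonZeroDivisors_le M.primeCompl TM ⟨_, hreg, rfl⟩
  obtain ⟨hq1, hq2⟩ := hq
  have hdom := isDomain_of_quotient htm htreg
  exact ⟨hdom, isIntegrallyClosed_of_quotient htm (nonZeroDivisors.ne_zero htreg)⟩

/-- Completeness from limits. -/
theorem isPrecomplete_of_limit {R : Type*} [CommRing R] (I : Ideal R)
    (h : ∀ f : ℕ → R, (∀ n, f (n + 1) - f n ∈ I ^ n) → ∃ L, ∀ n, f n - L ∈ I ^ n) :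
    IsPrecomplete I R := by
  refine ⟨fun f hf => ?_⟩
  obtain ⟨L, hL⟩ := h f (fun n => by
    have := hf (Nat.le_succ n)
    rw [SModEq.sub_mem] at this
    rw [← neg_sub]
    simpa [Ideal.smul_eq_mul] using neg_mem this)
  refine ⟨L, fun n => ?_⟩
  rw [SModEq.sub_mem]
  simpa [Ideal.smul_eq_mul] using hL n

theorem isAdicComplete_of_surjective {A D : Type*} [CommRing A] [IsLocalRing A] [CommRing D]
    [IsLocalRing D] [IsNoetherianRing D] [IsAdicComplete (maximalIdeal A) A]
    (f : A →+* D) (hf : Function.Surjective f) : IsAdicComplete (maximalIdeal D) D := by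
  have hm := map_maximalIdeal_of_surjective f hf
  have hlift : ∀ n, ∀ x ∈ maximalIdeal D ^ n, ∃ y ∈ maximalIdeal A ^ n, f y = x := by
    intro n x hx
    rw [← hm, ← Ideal.map_pow] at hx
    exact (Ideal.mem_map_iff_of_surjective f hf).1 hx
  have : IsPrecomplete (maximalIdeal D) D := by
    refine isPrecomplete_of_limit _ fun g hg => ?_
    choose d hd hd' using fun n => hlift n _ (hg n)
    obtain ⟨g0, hg0⟩ := hf (g 0)
    let h : ℕ → A := fun n => g0 + ∑ i ∈ Finset.range n, d i
    obtain ⟨L, hL⟩ := exists_limit (maximalIdeal A) h (fun n => by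
      simp only [h, Finset.sum_range_succ]; ring_nf; exact hd n)
    have hfh : ∀ n, f (h n) = g n := by
      intro n
      induction n with
      | zero => simp [h, hg0]
      | succ n ih =>
        have : h (n + 1) = h n + d n := by simp only [h, Finset.sum_range_succ]; ring
        rw [this, map_add, ih, hd']; ring
    refine ⟨f L, fun n => ?_⟩
    rw [← hfh, ← map_sub, ← hm, ← Ideal.map_pow]
    exact Ideal.mem_map_of_mem _ (hL n)
  exact ⟨⟩

/-- `b/y` satisfies an integral equation. -/
def IntRel {S : Type*} [CommRing S] (b y : S) : Prop :=
  ∃ (p : Polynomial S), p.Monic ∧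
      ∑ i ∈ Finset.range (p.natDegree + 1), p.coeff i * b ^ i * y ^ (p.natDegree - i) = 0

theorem IntRel.map {S T : Type*} [CommRing S] [CommRing T] {b y : S} (h : IntRel b y) (f : S →+* T) :
    IntRel (f b) (f y) := by
  rcases subsingleton_or_nontrivial T with hT | hT
  · exact ⟨1, Polynomial.monic_one, Subsingleton.elim _ _⟩
  obtain ⟨p, hp, h⟩ := h
  exact ⟨p.map f, hp.map f, relation_map f p hp h⟩

theorem IntRel.dvd {S : Type*} [CommRing S] [IsDomain S] [IsIntegrallyClosed S] {b y : S}
    (h : IntRel b y) : y ∣ b := by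
  obtain ⟨p, hp, h⟩ := h
  by_cases hy : y = 0
  · subst hy
    have : b ^ p.natDegree = 0 := by
      rw [Finset.sum_range_succ, Finset.sum_eq_zero] at h
      · simpa [hp.coeff_natDegree] using h
      · intro i hi
        rw [zero_pow, mul_zero]
        have := Finset.mem_range.1 hi
        omega
    rw [(IsReduced.eq_zero b ⟨_, this⟩)]
  · exact dvd_of_relation hy p hp h

theorem dvd_of_forall_localization {T : Type*} [CommRing T] {b y : T}
    (h : ∀ (M : Ideal T) [M.IsMaximal], algebraMap T (Localization.AtPrime M) y ∣
      algebraMap T (Localization.AtPrime M) b) : y ∣ b := by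
  let I : Ideal T := (Ideal.span {y}).colon {b}
  by_contra hcon
  have hI : I ≠ ⊤ := by
    intro h1
    have : (1 : T) ∈ I := h1 ▸ trivial
    rw [Submodule.mem_colon_singleton] at this
    exact hcon (by simpa [Ideal.mem_span_singleton] using this)
  obtain ⟨M, hM, hIM⟩ := Ideal.exists_le_maximal I hI
  obtain ⟨c, hc⟩ := h M
  obtain ⟨c', s, rfl⟩ := IsLocalization.exists_mk'_eq M.primeCompl c
  have hc2 : algebraMap T (Localization.AtPrime M) (s * b) = algebraMap T (Localization.AtPrime M) (y * c') := by
    rw [map_mul, hc, map_mul, mul_left_comm, IsLocalization.mk'_spec'_mk]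
  obtain ⟨t, ht⟩ := (IsLocalization.eq_iff_exists M.primeCompl _).1 hc2
  have : ((t * s : M.primeCompl) : T) ∈ I := by
    rw [Submodule.mem_colon_singleton, smul_eq_mul, Ideal.mem_span_singleton]
    refine ⟨t * c', ?_⟩
    push_cast
    linear_combination ht
  exact (t * s).2 (hIM this)

def DivProp (A : Type u) (S : Type v) (W : Type u) [CommRing A] [CommRing S] [CommRing W] [Algebra A S] [Algebra A W] :
    Prop :=
  ∀ b y : S, IntRel b y → algebraMap S (S ⊗[A] W) y ∣ algebraMap S (S ⊗[A] W) b

theorem DivProp.prod {A : Type u} {S : Type v} {W W' : Type u} [CommRing A] [CommRing S] [CommRing W] [CommRing W'] [Algebra A S] [Algebra A W] [Algebra A W']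
    (h : DivProp A S W) (h' : DivProp A S W') : DivProp A S (W × W') := by
  intro b y hby
  obtain ⟨c, hc⟩ := h b y hby
  obtain ⟨c', hc'⟩ := h' b y hby
  let e := Algebra.TensorProduct.prodRight A S S W W'
  refine ⟨e.symm (c, c'), ?_⟩
  apply e.injective
  rw [map_mul, e.apply_symm_apply, AlgEquiv.commutes, AlgEquiv.commutes]
  ext
  · exact hc
  · exact hc'

theorem exists_density {A : Type u} {S : Type v} [CommRing A] [IsDomain A] [IsLocalRing A] [IsNoetherianRing A]
    [IsAdicComplete (maximalIdeal A) A]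
    [CommRing S] [IsLocalRing S] [IsNoetherianRing S] [Algebra A S] [IsLocalHom (algebraMap A S)]
    [Module.Flat A S]
    (hS : ∀ (L : Type u) [Field L] [Algebra A L] [Module.Finite A L], IsNormalRing (S ⊗[A] L))
    (hm : maximalIdeal A ≠ ⊥) (j : ℕ) :
    ∃ (W : Type u) (_ : CommRing W) (_ : Algebra A W), Module.Finite A W ∧
      RingHom.ker (algebraMap A W) ≤ maximalIdeal A ^ j ∧ DivProp A S W := by
  let F : Set (Ideal A) := {I | ∃ (W : Type u) (_ : CommRing W) (_ : Algebra A W), Module.Finite A W ∧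
      RingHom.ker (algebraMap A W) = I ∧ DivProp A S W}
  have hF : ∀ f : A, f ≠ 0 → ∃ I ∈ F, f ∉ I := by
    intro f hf
    obtain ⟨P, hP, hfP, hPm, hdim⟩ := exists_prime_dimensionLEOne hm hf
    have hloc : IsLocalRing (A ⧸ P) := .of_surjective' _ Ideal.Quotient.mk_surjective
    have : IsAdicComplete (maximalIdeal (A ⧸ P)) (A ⧸ P) :=
      isAdicComplete_of_surjective _ Ideal.Quotient.mk_surjective
    obtain ⟨a, ham, haP⟩ := SetLike.exists_of_lt (lt_of_le_of_ne (le_maximalIdeal hP.ne_top) hPm)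
    have hm' : maximalIdeal (A ⧸ P) ≠ ⊥ := by
      rw [← map_maximalIdeal_of_surjective (Ideal.Quotient.mk P) Ideal.Quotient.mk_surjective, Ne, Ideal.map_eq_bot_iff_le_ker,
        Ideal.mk_ker]
      exact fun h => haP (h ham)
    let V := integralClosure (A ⧸ P) (FractionRing (A ⧸ P))
    have hfin : Module.Finite (A ⧸ P) V := finite_integralClosure _ hm'
    have hnoeth : IsNoetherianRing V := IsNoetherianRing.of_finite (A ⧸ P) _
    have : Ring.DimensionLEOne V := Ring.DimensionLEOne.integralClosure _ _
    have : IsIntegrallyClosed V := integralClosure.isIntegrallyClosedOfFiniteExtension (FractionRing (A ⧸ P))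
    have : IsDedekindDomain V := { }
    have hfin' : Module.Finite A V := Module.Finite.trans (A ⧸ P) V
    have hker : RingHom.ker (algebraMap A V) = P := by
      ext x
      rw [RingHom.mem_ker, IsScalarTower.algebraMap_apply A (A ⧸ P) V]
      have : Function.Injective (algebraMap (A ⧸ P) V) := FaithfulSMul.algebraMap_injective _ _
      rw [map_eq_zero_iff _ this]
      exact Ideal.Quotient.eq_zero_iff_mem
    refine ⟨P, ⟨V, inferInstance, inferInstance, hfin', hker, ?_⟩, hfP⟩
    intro b y hby
    refine dvd_of_forall_localization fun M hM => ?_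
    obtain ⟨h1, h2⟩ := normal_tensor_dedekind hS V ham (fun h => haP (hker ▸ h)) M
    exact ((hby.map _).map _).dvd
  have hdir : ∀ I ∈ F, ∀ J ∈ F, ∃ K ∈ F, K ≤ I ∧ K ≤ J := by
    rintro I ⟨W, _, _, hW1, rfl, hW3⟩ J ⟨W', _, _, hW1', rfl, hW3'⟩
    refine ⟨_, ⟨W × W', inferInstance, inferInstance, inferInstance, rfl, hW3.prod hW3'⟩, ?_, ?_⟩
    · intro x hx
      exact congrArg Prod.fst hx
    · intro x hx
      exact congrArg Prod.snd hx
  obtain ⟨I, ⟨W, i1, i2, hW1, rfl, hW3⟩, hIj⟩ := chevalley F ((hF 1 one_ne_zero).imp fun _ h => h.1) hdir (fun x hx => by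
    by_contra h
    obtain ⟨I, hI, h'⟩ := hF x h
    exact h' (hx I hI)) j
  exact ⟨W, i1, i2, hW1, hIj, hW3⟩

theorem exists_density' {A : Type u} {S : Type v} [CommRing A] [IsDomain A] [IsLocalRing A] [IsNoetherianRing A]
    [IsAdicComplete (maximalIdeal A) A]
    [CommRing S] [IsLocalRing S] [IsNoetherianRing S] [Algebra A S] [IsLocalHom (algebraMap A S)]
    [Module.Flat A S]
    (hS : ∀ (L : Type u) [Field L] [Algebra A L] [Module.Finite A L], IsNormalRing (S ⊗[A] L))
    (j : ℕ) :
    ∃ (W : Type u) (_ : CommRing W) (_ : Algebra A W), Module.Finite A W ∧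
      RingHom.ker (algebraMap A W) ≤ maximalIdeal A ^ j ∧ DivProp A S W := by
  by_cases hm : maximalIdeal A = ⊥
  · have hf : IsField A := IsLocalRing.isField_iff_maximalIdeal_eq.2 hm
    let _ : Field A := hf.toField
    refine ⟨A, inferInstance, Algebra.id A, Module.Finite.self A, ?_, ?_⟩
    · intro x hx
      have : x = 0 := hx
      rw [this]; exact zero_mem _
    · intro b y hby
      have h1 : IsNormalRing (S ⊗[A] A) := hS A
      have h2 : IsNormalRing S := h1.of_ringEquiv (Algebra.TensorProduct.rid A A S).toRingEquiv
      obtain ⟨h3, h4⟩ := IsNormalRing.of_isLocalRing h2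
      exact map_dvd _ hby.dvd
  · exact exists_density hS hm j

theorem mem_map_ker_of_tmul_eq_zero {A : Type u} {S : Type v} {W : Type u} [CommRing A] [CommRing S] [CommRing W]
    [Algebra A S] [Algebra A W] [Module.Flat A S] {s : S} (h : algebraMap S (S ⊗[A] W) s = 0) :
    s ∈ (RingHom.ker (algebraMap A W)).map (algebraMap A S) := by
  set I := RingHom.ker (algebraMap A W)
  let f : A ⧸ I →ₗ[A] W := (Ideal.Quotient.liftₐ I (Algebra.ofId A W) (fun a ha => ha)).toLinearMap
  have hf : Function.Injective f := by
    intro x y hxy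
    obtain ⟨x, rfl⟩ := Ideal.Quotient.mk_surjective x
    obtain ⟨y, rfl⟩ := Ideal.Quotient.mk_surjective y
    refine Ideal.Quotient.eq.2 ?_
    change algebraMap A W x = algebraMap A W y at hxy
    change algebraMap A W (x - y) = 0
    rw [map_sub, hxy, sub_self]
  have h2 := Module.Flat.lTensor_preserves_injective_linearMap (M := S) f hf
  have h3 : s ⊗ₜ[A] (1 : A ⧸ I) = 0 := by
    apply h2
    rw [map_zero, LinearMap.lTensor_tmul, ← h]
    simp [f]
  have h4 := congrArg (TensorProduct.tensorQuotEquivQuotSMul S I) h3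
  rw [map_zero] at h4
  have h5 : (TensorProduct.tensorQuotEquivQuotSMul S I) (s ⊗ₜ[A] (1 : A ⧸ I)) = Submodule.Quotient.mk s := by
    have := TensorProduct.tensorQuotEquivQuotSMul_tmul_mk I s (1 : A)
    rw [one_smul] at this
    exact this
  rw [h5, Submodule.Quotient.mk_eq_zero] at h4
  rw [Ideal.smul_top_eq_map] at h4
  exact h4

theorem eq_zero_of_intRel_zero {A : Type u} {S : Type v} [CommRing A] [IsDomain A] [IsLocalRing A] [IsNoetherianRing A]
    [IsAdicComplete (maximalIdeal A) A]
    [CommRing S] [IsLocalRing S] [IsNoetherianRing S] [Algebra A S] [IsLocalHom (algebraMap A S)]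
    [Module.Flat A S]
    (hS : ∀ (L : Type u) [Field L] [Algebra A L] [Module.Finite A L], IsNormalRing (S ⊗[A] L)) :
    IsReduced S := by
  refine ⟨fun b hb => ?_⟩
  obtain ⟨n, hn⟩ := hb
  have hrel : IntRel b 0 := by
    refine ⟨Polynomial.X ^ n, Polynomial.monic_X_pow n, ?_⟩
    refine Finset.sum_eq_zero fun i hi => ?_
    rw [Polynomial.coeff_X_pow]
    split_ifs with h
    · simp [h, hn]
    · simp
  refine (Submodule.mem_bot S).1 (mem_of_forall_mem_sup_pow ⊥ fun l => ?_)
  obtain ⟨W, _, _, hW1, hW2, hW3⟩ := exists_density' hS l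
  obtain ⟨t, ht⟩ := hW3 b 0 hrel
  rw [map_zero, zero_mul] at ht
  have := Ideal.map_mono hW2 (mem_map_ker_of_tmul_eq_zero ht)
  rw [bot_sup_eq]
  rw [Ideal.map_pow] at this
  exact Ideal.pow_right_mono (map_maximalIdeal_le _) _ this

theorem regular_tensor_base {A : Type u} {S : Type v} {E : Type u} [CommRing A] [IsLocalRing A]
    [CommRing S] [Algebra A S] [AddCommGroup E] [Module A E] {y : S}
    (hy : ∀ s, y * s ∈ (maximalIdeal A).map (algebraMap A S) → s ∈ (maximalIdeal A).map (algebraMap A S))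
    (t : S ⊗[A] E) (ht : y • t = 0) :
    ∃ t', LinearMap.lTensor S (maximalIdeal A • (⊤ : Submodule A E)).subtype t' = t := by
  set m := maximalIdeal A
  let q : E →ₗ[A] E ⧸ (m • (⊤ : Submodule A E)) := Submodule.mkQ _
  have hex : Function.Exact (m • (⊤ : Submodule A E)).subtype q := LinearMap.exact_subtype_mkQ _
  have hex2 := lTensor_exact S hex (Submodule.mkQ_surjective _)
  refine (hex2 t).1 ?_
  have hqt : y • (LinearMap.lTensor S q t) = 0 := by
    have : ∀ t, LinearMap.lTensor S q (y • t) = y • LinearMap.lTensor S q t := 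
      fun t => map_smul (AlgebraTensorModule.lTensor S S q) y t
    rw [← this, ht, map_zero]
  generalize LinearMap.lTensor S q t = x at hqt
  let κ := A ⧸ m
  let _ : Field κ := Ideal.Quotient.field m
  -- κ case
  have hκ : ∀ x : S ⊗[A] κ, y • x = 0 → x = 0 := by
    intro x hx
    let e := TensorProduct.tensorQuotEquivQuotSMul S m
    have he : ∀ s : S, e (s ⊗ₜ[A] (1 : A ⧸ m)) = Submodule.Quotient.mk s := by
      intro s
      have := TensorProduct.tensorQuotEquivQuotSMul_tmul_mk m s (1 : A)
      rw [one_smul] at this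
      exact this
    obtain ⟨s, hs⟩ := Submodule.Quotient.mk_surjective _ (e x)
    have hxs : x = s ⊗ₜ[A] (1 : A ⧸ m) := by
      apply e.injective
      rw [he, hs]
    rw [hxs, smul_tmul', smul_eq_mul] at hx
    have h1 := congrArg e hx
    rw [he, map_zero, Submodule.Quotient.mk_eq_zero, Ideal.smul_top_eq_map] at h1
    have h2 := hy s h1
    rw [hxs]
    apply e.injective
    rw [he, map_zero, Submodule.Quotient.mk_eq_zero, Ideal.smul_top_eq_map]
    exact h2
  let b := Module.Free.chooseBasis κ (E ⧸ (m • (⊤ : Submodule A E)))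
  let ι := Module.Free.ChooseBasisIndex κ (E ⧸ (m • (⊤ : Submodule A E)))
  classical
  let e : (E ⧸ (m • (⊤ : Submodule A E))) ≃ₗ[A] (ι →₀ κ) := b.repr.restrictScalars A
  let e2 : S ⊗[A] (E ⧸ (m • (⊤ : Submodule A E))) ≃ₗ[S] (ι →₀ S ⊗[A] κ) :=
    (AlgebraTensorModule.congr (LinearEquiv.refl S S) e) ≪≫ₗ TensorProduct.finsuppRight A S S κ ι
  apply e2.injective
  rw [map_zero]
  ext i
  apply hκ
  rw [← Finsupp.smul_apply, ← map_smul, hqt, map_zero]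
  rfl

theorem regular_tensor {A : Type u} {S : Type v} {E : Type u} [CommRing A] [IsLocalRing A] [IsNoetherianRing A]
    [CommRing S] [IsLocalRing S] [IsNoetherianRing S] [Algebra A S] [IsLocalHom (algebraMap A S)]
    [Module.Flat A S] [AddCommGroup E] [Module A E] [Module.Finite A E] {y : S}
    (hy : ∀ s, y * s ∈ (maximalIdeal A).map (algebraMap A S) → s ∈ (maximalIdeal A).map (algebraMap A S))
    (t : S ⊗[A] E) (ht : y • t = 0) : t = 0 := by
  have key : ∀ (j : ℕ) (E : Type u) [AddCommGroup E] [Module A E] (t : S ⊗[A] E),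
      y • t = 0 → t ∈ maximalIdeal A ^ j • (⊤ : Submodule A (S ⊗[A] E)) := by
    intro j
    induction j with
    | zero => intro E _ _ t ht; simp
    | succ j ih =>
      intro E _ _ t ht
      obtain ⟨t', rfl⟩ := regular_tensor_base hy t ht
      set f := (maximalIdeal A • (⊤ : Submodule A E)).subtype
      have hf : Function.Injective (LinearMap.lTensor S f) :=
        Module.Flat.lTensor_preserves_injective_linearMap f (Submodule.subtype_injective _)
      have h1 : y • t' = 0 := by
        apply hf
        rw [map_zero, ← ht]
        exact map_smul (AlgebraTensorModule.lTensor S S f) y t'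
      have h2 := Submodule.mem_map_of_mem (f := LinearMap.lTensor S f) (ih _ t' h1)
      rw [Submodule.map_smul''] at h2
      rw [pow_succ, ← smul_eq_mul, Submodule.smul_assoc]
      refine Submodule.smul_mono le_rfl ?_ h2
      rw [Submodule.map_le_iff_le_comap]
      rintro x -
      rw [Submodule.mem_comap]
      induction x with
      | zero => rw [map_zero]; exact zero_mem _
      | add x y hx hy => rw [map_add]; exact add_mem hx hy
      | tmul s e =>
        rw [LinearMap.lTensor_tmul]
        obtain ⟨e, he⟩ := e
        change s ⊗ₜ[A] e ∈ _
        refine Submodule.smul_induction_on he ?_ ?_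
        · intro r hr n _
          rw [tmul_smul]
          exact Submodule.smul_mem_smul hr trivial
        · intro x y hx hy
          rw [tmul_add]
          exact add_mem hx hy
  have h2 := Ideal.iInf_pow_smul_eq_bot_of_isLocalRing (M := S ⊗[A] E) (maximalIdeal S)
    (Ideal.IsPrime.ne_top inferInstance)
  have h3 : t ∈ (⨅ i : ℕ, maximalIdeal S ^ i • ⊤ : Submodule S (S ⊗[A] E)) := by
    rw [Submodule.mem_iInf]
    intro j
    refine Submodule.smul_induction_on (key j E t ht) ?_ ?_
    · intro r hr n _
      rw [← algebraMap_smul S r n]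
      refine Submodule.smul_mem_smul ?_ trivial
      refine Ideal.pow_right_mono (map_maximalIdeal_le (algebraMap A S)) _ ?_
      rw [← Ideal.map_pow]
      exact Ideal.mem_map_of_mem _ hr
    · intro x y hx hy
      exact add_mem hx hy
  rw [h2] at h3
  simpa using h3

/-- Lemma J -/
theorem dvd_of_intRel {A : Type u} {S : Type v} [CommRing A] [IsDomain A] [IsLocalRing A] [IsNoetherianRing A]
    [IsAdicComplete (maximalIdeal A) A]
    [CommRing S] [IsLocalRing S] [IsNoetherianRing S] [Algebra A S] [IsLocalHom (algebraMap A S)]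
    [Module.Flat A S]
    (hS : ∀ (L : Type u) [Field L] [Algebra A L] [Module.Finite A L], IsNormalRing (S ⊗[A] L))
    {b y : S}
    (hy : ∀ s, y * s ∈ (maximalIdeal A).map (algebraMap A S) → s ∈ (maximalIdeal A).map (algebraMap A S))
    (hrel : IntRel b y) : y ∣ b := by
  rw [← Ideal.mem_span_singleton]
  refine mem_of_forall_mem_sup_pow _ fun l => ?_
  obtain ⟨W, _, _, hW1, hW2, hW3⟩ := exists_density' hS l
  obtain ⟨t, ht⟩ := hW3 b y hrel
  let f : A →ₗ[A] W := Algebra.linearMap A W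
  let q := (LinearMap.range f).mkQ
  have hex : Function.Exact f q := LinearMap.exact_map_mkQ_range f
  have hex2 := lTensor_exact S hex (Submodule.mkQ_surjective _)
  have hq : ∀ (s : S) t, LinearMap.lTensor S q (s • t) = s • LinearMap.lTensor S q t := 
      fun s t => map_smul (AlgebraTensorModule.lTensor S S q) s t
  have ht2 : algebraMap S (S ⊗[A] W) b = y • t := by rw [ht, Algebra.smul_def]
  have h0 : LinearMap.lTensor S q t = 0 := by
    apply regular_tensor hy
    rw [← hq, ← ht2]
    refine (hex2 _).2 ⟨b ⊗ₜ 1, ?_⟩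
    simp [f]
  obtain ⟨t', rfl⟩ := (hex2 _).1 h0
  obtain ⟨s, rfl⟩ := (TensorProduct.rid A S).symm.surjective t'
  have h1 : algebraMap S (S ⊗[A] W) (b - y * s) = 0 := by
    rw [map_sub, ht2, sub_eq_zero]
    simp [f, smul_tmul']
  have h2 := Ideal.map_mono hW2 (mem_map_ker_of_tmul_eq_zero h1)
  rw [Ideal.map_pow] at h2
  have h3 := Ideal.pow_right_mono (map_maximalIdeal_le _) _ h2
  refine Submodule.mem_sup.2 ⟨y * s, Ideal.mem_span_singleton.2 ⟨s, rfl⟩, b - y * s, h3, by ring⟩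

/-- Every square-zero extension of `ℓ` by `k`-algebras has a `k`-section. -/
def SectionProp (k : Type*) (ℓ : Type v) [Field k] [Field ℓ] [Algebra k ℓ] : Prop :=
  ∀ (E : Type v) [CommRing E] [Algebra k E] (f : E →ₐ[k] ℓ), Function.Surjective f →
    (∀ x y, f x = 0 → f y = 0 → x * y = 0) →
    ∃ S : Subalgebra k E, (∀ x ∈ S, f x = 0 → x = 0) ∧ ∀ z, ∃ x ∈ S, f x = z

theorem exists_maximal_subalgebra {k E ℓ : Type*} [Field k] [Field ℓ] [CommRing E] [Algebra k E] [Algebra k ℓ]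
    (f : E →ₐ[k] ℓ) (S0 : Subalgebra k E) (h0 : ∀ x ∈ S0, f x = 0 → x = 0) :
    ∃ S, S0 ≤ S ∧ Maximal (fun S : Subalgebra k E => ∀ x ∈ S, f x = 0 → x = 0) S := by
  refine zorn_le_nonempty₀ {S : Subalgebra k E | ∀ x ∈ S, f x = 0 → x = 0} ?_ S0 h0
  intro c hc hchain y hy
  have : Nonempty c := ⟨⟨y, hy⟩⟩
  have hdir : Directed (· ≤ ·) (fun S : c => (S : Subalgebra k E)) := hchain.directed
  refine ⟨⨆ S : c, (S : Subalgebra k E), ?_, fun z hz => le_iSup (fun S : c => (S : Subalgebra k E)) ⟨z, hz⟩⟩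
  intro x hx hfx
  rw [← SetLike.mem_coe, Subalgebra.coe_iSup_of_directed hdir, Set.mem_iUnion] at hx
  obtain ⟨S, hS⟩ := hx
  exact hc S.2 x hS hfx

theorem exists_of_maximal {k E ℓ : Type*} [Field k] [Field ℓ] [CommRing E] [Algebra k E] [Algebra k ℓ]
    (f : E →ₐ[k] ℓ) (S : Subalgebra k E)
    (hmax : Maximal (fun S : Subalgebra k E => ∀ x ∈ S, f x = 0 → x = 0) S) (t : E)
    (h : ∀ q : Polynomial S, (q.map (f.comp S.val).toRingHom).eval (f t) = 0 → Polynomial.aeval t q = 0) :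
    t ∈ S := by
  let S' : Subalgebra k E := (Polynomial.aeval (R := S) t).range.restrictScalars k
  have hle : S ≤ S' := by
    intro x hx
    exact ⟨Polynomial.C ⟨x, hx⟩, by simp⟩
  have hS' : ∀ x ∈ S', f x = 0 → x = 0 := by
    rintro _ ⟨q, rfl⟩ hq
    apply h
    rw [← hq, Polynomial.eval_map]
    exact (Polynomial.hom_eval₂ q (algebraMap S E) f.toRingHom t).symm
  exact hmax.2 hS' hle ⟨Polynomial.X, by simp⟩

theorem sectionProp_of_charZero (k : Type*) (ℓ : Type v) [Field k] [Field ℓ] [Algebra k ℓ] [CharZero k] :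
    SectionProp k ℓ := by
  intro E _ _ f hf hsq
  obtain ⟨S, -, hS⟩ := exists_maximal_subalgebra f ⊥ (by
    rintro x hx hfx
    obtain ⟨a, rfl⟩ := Algebra.mem_bot.1 hx
    rw [AlgHom.commutes, map_eq_zero] at hfx
    rw [hfx, map_zero])
  have hunit : ∀ x : E, f x ≠ 0 → IsUnit x := by
    intro x hx
    obtain ⟨y, hy⟩ := hf (f x)⁻¹
    have h1 : f (1 - x * y) = 0 := by rw [map_sub, map_one, map_mul, hy, mul_inv_cancel₀ hx, sub_self]
    have h2 := hsq _ _ h1 h1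
    exact IsUnit.of_mul_eq_one (y * (2 - x * y)) (by linear_combination -h2)
  have hfield : IsField S := by
    refine ⟨⟨0, 1, fun h => ?_⟩, mul_comm, ?_⟩
    · have h1 : (0 : E) = 1 := congrArg Subtype.val h
      have := congrArg f h1
      simp at this
    · intro x hx
      have hfx : f x ≠ 0 := fun h => hx (Subtype.ext (hS.1 _ x.2 h))
      obtain ⟨w, hw⟩ := hunit _ hfx
      let S' : Subalgebra k E :=
        { carrier := {y | ∃ n : ℕ, (x : E) ^ n * y ∈ S}
          mul_mem' := by
            rintro a b ⟨n, hn⟩ ⟨m, hm⟩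
            refine ⟨n + m, ?_⟩
            have := S.mul_mem hn hm
            convert this using 1; ring
          add_mem' := by
            rintro a b ⟨n, hn⟩ ⟨m, hm⟩
            refine ⟨n + m, ?_⟩
            have := S.add_mem (S.mul_mem (S.pow_mem x.2 m) hn) (S.mul_mem (S.pow_mem x.2 n) hm)
            convert this using 1; ring
          algebraMap_mem' := fun r => ⟨0, by simp⟩ }
      have hle : S ≤ S' := fun y hy => ⟨0, by simpa using hy⟩
      have h2 : S' ≤ S := by
        refine hS.2 ?_ hle
        rintro y ⟨n, hn⟩ hy
        have := hS.1 _ hn (by rw [map_mul, hy, mul_zero])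
        rw [← hw] at this
        exact ((w.isUnit.pow n).mul_right_eq_zero).1 this
      have h3 : ((w⁻¹ : Eˣ) : E) ∈ S := h2 ⟨1, by rw [← hw]; simp⟩
      exact ⟨⟨_, h3⟩, Subtype.ext (by change (x : E) * _ = 1; rw [← hw]; simp)⟩
  let _ : Field S := hfield.toField
  let _ : Algebra S ℓ := (f.comp S.val).toRingHom.toAlgebra
  have : CharZero S := charZero_of_injective_algebraMap (FaithfulSMul.algebraMap_injective k S)
  refine ⟨S, hS.1, fun z => ?_⟩
  obtain ⟨t, rfl⟩ := hf z
  have hev : ∀ (q : Polynomial S) (t : E), f (Polynomial.aeval t q) = Polynomial.aeval (f t) q := by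
    intro q t
    rw [Polynomial.aeval_def, Polynomial.aeval_def]
    exact (Polynomial.hom_eval₂ q (algebraMap S E) f.toRingHom t)
  obtain ⟨t', ht', h0⟩ : ∃ t', f t' = f t ∧ Polynomial.aeval t' (minpoly S (f t)) = 0 := by
    by_cases halg : IsIntegral S (f t)
    · have hsep : (minpoly S (f t)).Separable := (minpoly.irreducible halg).separable
      obtain ⟨r, ⟨hr1, hr2⟩, -⟩ := Polynomial.existsUnique_nilpotent_sub_and_aeval_eq_zero (P := minpoly S (f t)) (x := t)
        ⟨2, by rw [pow_two]; apply hsq <;> rw [hev, minpoly.aeval]⟩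
        (by
          apply hunit
          rw [hev]
          exact hsep.aeval_derivative_ne_zero (minpoly.aeval _ _))
      refine ⟨r, ?_, hr2⟩
      have := (hr1.map f).eq_zero
      rw [map_sub, sub_eq_zero] at this
      exact this.symm
    · exact ⟨t, rfl, by rw [minpoly.eq_zero halg, map_zero]⟩
  refine ⟨t', exists_of_maximal f S hS t' fun q hq => ?_, ht'⟩
  rw [ht', Polynomial.eval_map] at hq
  obtain ⟨r, hr⟩ := minpoly.dvd S (f t) (p := q) hq
  rw [hr, map_mul, h0, zero_mul]

/-- Linear disjointness. -/
def LD (p : ℕ) [Fact p.Prime] (k : Type u) (ℓ : Type v) [Field k] [Field ℓ] [Algebra k ℓ] [CharP k p] [CharP ℓ p] :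
    Prop :=
  ∀ (ι : Type u) (e : ι → k), LinearIndependent (frobenius k p).fieldRange e →
    LinearIndependent (frobenius ℓ p).fieldRange (fun i => algebraMap k ℓ (e i))

theorem ld_zmod (p : ℕ) [Fact p.Prime] (ℓ : Type v) [Field ℓ] [Algebra (ZMod p) ℓ] [CharP ℓ p] :
    LD p (ZMod p) ℓ := by
  intro ι e he
  have : Subsingleton ι := by
    refine ⟨fun i j => ?_⟩
    by_contra hij
    have h2 : LinearIndependent (frobenius (ZMod p) p).fieldRange ![e i, e j] := by
      have := he.comp ![i, j] (by intro a b; fin_cases a <;> fin_cases b <;> simp [hij, Ne.symm hij])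
      convert this using 1
      ext a; fin_cases a <;> rfl
    rw [LinearIndependent.pair_iff] at h2
    have := h2 ⟨e j, ⟨e j, ZMod.frobenius_zmod p ▸ rfl⟩⟩ (-⟨e i, ⟨e i, ZMod.frobenius_zmod p ▸ rfl⟩⟩) (by
      rw [Subfield.smul_def, Subfield.smul_def]; simp [mul_comm])
    exact he.ne_zero j (congrArg Subtype.val this.1)
  rcases isEmpty_or_nonempty ι with h | ⟨⟨i⟩⟩
  · exact linearIndependent_empty_type
  · refine LinearIndependent.of_subsingleton i ?_
    simpa using he.ne_zero i

theorem ld_aux (p : ℕ) [Fact p.Prime] {k : Type u} {ℓ : Type v} [Field k] [Field ℓ] [Algebra k ℓ]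
    [CharP ℓ p] {L : Type*} [Field L] [Algebra k L] [hred : IsReduced (ℓ ⊗[k] L)]
    {ι : Type*} [Fintype ι] (r : ι → L) (e : ι → k) (hr : ∀ i, r i ^ p = algebraMap k L (e i))
    (hli : LinearIndependent k r) (y : ι → ℓ) (hy : ∑ i, y i ^ p * algebraMap k ℓ (e i) = 0) (i : ι) : y i = 0 := by
  have : CharP (ℓ ⊗[k] L) p := charP_of_injective_algebraMap (FaithfulSMul.algebraMap_injective ℓ (ℓ ⊗[k] L)) p
  have hli2 : LinearIndependent ℓ (fun i => (1 : ℓ) ⊗ₜ[k] r i) := Module.Flat.linearIndependent_one_tmul hli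
  rw [Fintype.linearIndependent_iff] at hli2
  refine hli2 y ?_ i
  refine IsReduced.eq_zero _ ⟨p, ?_⟩
  rw [sum_pow_char]
  have : (algebraMap ℓ (ℓ ⊗[k] L)) (∑ i, y i ^ p * algebraMap k ℓ (e i)) = 0 := by rw [hy, map_zero]
  rw [← this, map_sum]
  refine Finset.sum_congr rfl fun i _ => ?_
  rw [Algebra.smul_def, mul_pow, Algebra.TensorProduct.tmul_pow, hr, map_mul, map_pow]
  congr 1
  rw [one_pow, ← IsScalarTower.algebraMap_apply k ℓ (ℓ ⊗[k] L)]
  exact (Algebra.TensorProduct.includeRight : L →ₐ[k] ℓ ⊗[k] L).commutes (e i)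

theorem ld_of_isReduced (p : ℕ) [Fact p.Prime] (k : Type u) (ℓ : Type v) [Field k] [Field ℓ] [Algebra k ℓ]
    [CharP k p] [CharP ℓ p]
    (h : ∀ (L : Type u) [Field L] [Algebra k L] [FiniteDimensional k L], IsReduced (ℓ ⊗[k] L)) :
    LD p k ℓ := by
  intro ι e he
  rw [linearIndependent_iff'] at he ⊢
  intro s g hg
  have hp := (Fact.out : p.Prime)
  choose y hy using fun i => (g i).2
  choose r hr using fun i => IsAlgClosed.exists_pow_nat_eq (algebraMap k (AlgebraicClosure k) (e i)) hp.pos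
  let L := IntermediateField.adjoin k (r '' (s : Set ι))
  have hfin : FiniteDimensional k L := by
    have : Finite (r '' (s : Set ι)) := (s.finite_toSet.image r)
    exact IntermediateField.finiteDimensional_adjoin fun x _ => Algebra.IsIntegral.isIntegral x
  have hmem : ∀ i : s, r i ∈ L := fun i => IntermediateField.subset_adjoin _ _ ⟨i, i.2, rfl⟩
  let r' : s → L := fun i => ⟨r i, hmem i⟩
  have hr' : ∀ i, r' i ^ p = algebraMap k L (e i) := fun i => Subtype.ext (hr i)
  have hred := h L
  have : CharP L p := charP_of_injective_algebraMap (FaithfulSMul.algebraMap_injective k L) p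
  have : CharP (ℓ ⊗[k] L) p := charP_of_injective_algebraMap (FaithfulSMul.algebraMap_injective ℓ (ℓ ⊗[k] L)) p
  have hli : LinearIndependent k r' := by
    rw [Fintype.linearIndependent_iff]
    intro c hc i
    have h1 : ∑ i : s, c i ^ p * e i = 0 := by
      apply FaithfulSMul.algebraMap_injective k L
      rw [map_sum, map_zero]
      have := congrArg (fun x => x ^ p) hc
      rw [sum_pow_char, zero_pow hp.ne_zero] at this
      rw [← this]
      refine Finset.sum_congr rfl fun i _ => ?_
      rw [Algebra.smul_def, mul_pow, hr', map_mul, map_pow]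
    classical
    have h2 := he s (fun i => if hi : i ∈ s then ⟨c ⟨i, hi⟩ ^ p, ⟨c ⟨i, hi⟩, rfl⟩⟩ else 0) (by
      rw [← h1, ← Finset.sum_coe_sort]
      refine Finset.sum_congr rfl fun i _ => ?_
      rw [dif_pos i.2, Subfield.smul_def]; rfl) i i.2
    rw [dif_pos i.2] at h2
    have := congrArg Subtype.val h2
    exact pow_eq_zero_iff hp.ne_zero |>.1 this
  have hsum : ∑ i : s, y i ^ p * algebraMap k ℓ (e i) = 0 := by
    refine Eq.trans ?_ hg
    rw [← Finset.sum_coe_sort s]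
    refine Finset.sum_congr rfl fun i _ => ?_
    rw [Subfield.smul_def, ← hy]; rfl
  have hfin := ld_aux (ι := s) p r' (fun i : s => e i) hr' hli (fun i : s => y i) hsum
  intro i hi
  apply Subtype.ext
  rw [← hy, hfin ⟨i, hi⟩]
  simp

theorem sectionProp_of_ld (p : ℕ) [Fact p.Prime] (k : Type u) (ℓ : Type v) [Field k] [Field ℓ] [Algebra k ℓ]
    [CharP k p] [CharP ℓ p] (hld : LD p k ℓ) : SectionProp k ℓ := by
  intro E _ _ f hf hsq
  have hp := (Fact.out : p.Prime)
  have : Nontrivial E := f.toRingHom.domain_nontrivial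
  have : CharP E p := charP_of_injective_algebraMap (FaithfulSMul.algebraMap_injective k E) p
  have hker : ∀ x, f x = 0 → x ^ p = 0 := by
    intro x hx
    obtain ⟨n, hn⟩ := Nat.exists_eq_add_of_le hp.two_le
    rw [hn, pow_add, pow_two, hsq x x hx hx, zero_mul]
  let ps : Submonoid E := MonoidHom.mrange (powMonoidHom p : E →* E)
  let S0 := Algebra.adjoin k (ps : Set E)
  let b := Module.Free.chooseBasis (frobenius k p).fieldRange k
  let ι := Module.Free.ChooseBasisIndex (frobenius k p).fieldRange k
  have hbk : ∀ a : k, ∃ c : ι →₀ k, a = c.sum fun i x => x ^ p * b i := by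
    intro a
    choose c hc using fun i => (b.repr a i).2
    refine ⟨(Finsupp.onFinset (b.repr a).support c (fun i hi => ?_)), ?_⟩
    · rw [Finsupp.mem_support_iff]
      intro h
      have := hc i
      rw [h] at this
      exact hi (by simpa [frobenius_def, hp.ne_zero] using this)
    · rw [Finsupp.onFinset_sum _ (by intro i; simp [hp.ne_zero])]
      conv_lhs => rw [← b.linearCombination_repr a, Finsupp.linearCombination_apply, Finsupp.sum]
      refine Finset.sum_congr rfl fun i _ => ?_
      rw [Subfield.smul_def, ← hc i]; rfl
  let F : (ι →₀ E) → E := fun c => c.sum fun i x => x ^ p * algebraMap k E (b i)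
  have hFadd : ∀ c d, F (c + d) = F c + F d := by
    intro c d
    refine Finsupp.sum_add_index' (fun i => by simp [hp.ne_zero]) (fun i x y => ?_)
    rw [add_pow_char, add_mul]
  have hform : ∀ z ∈ Submodule.span k (ps : Set E), ∃ c, z = F c := by
    intro z hz
    have hsum : ∀ (s : Finset ι) (g : ι → E), (∀ i ∈ s, ∃ c, g i = F c) → ∃ c, ∑ i ∈ s, g i = F c := by
      intro s g hg
      refine Finset.sum_induction _ (fun x => ∃ c, x = F c) ?_ ?_ hg
      · rintro _ _ ⟨c, rfl⟩ ⟨d, rfl⟩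
        exact ⟨c + d, (hFadd c d).symm⟩
      · exact ⟨0, by simp [F]⟩
    have hsingle : ∀ (i : ι) (x : E), F (Finsupp.single i x) = x ^ p * algebraMap k E (b i) := by
      intro i x
      exact Finsupp.sum_single_index (by simp [hp.ne_zero])
    have hsm : ∀ (a : k) (x : E), ∃ c, a • (x ^ p) = F c := by
      intro a x
      obtain ⟨c, hc⟩ := hbk a
      have : a • (x ^ p) = ∑ i ∈ c.support, F (Finsupp.single i (c i • x)) := by
        rw [hc, Finsupp.sum, Finset.sum_smul]
        refine Finset.sum_congr rfl fun i _ => ?_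
        rw [hsingle, Algebra.smul_def, Algebra.smul_def, map_mul, map_pow]; ring
      rw [this]
      exact hsum _ _ fun i _ => ⟨_, rfl⟩
    induction hz using Submodule.span_induction with
    | mem x h =>
      obtain ⟨y, rfl⟩ := h
      simpa using hsm 1 y
    | zero => exact ⟨0, by simp [F]⟩
    | add x y _ _ hx hy =>
      obtain ⟨c, rfl⟩ := hx
      obtain ⟨d, rfl⟩ := hy
      exact ⟨c + d, (hFadd c d).symm⟩
    | smul a x _ hx =>
      obtain ⟨c, rfl⟩ := hx
      have : a • F c = ∑ i ∈ c.support, (a * b i) • (c i ^ p) := by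
        simp only [F, Finsupp.sum, Finset.smul_sum]
        refine Finset.sum_congr rfl fun i _ => ?_
        rw [Algebra.smul_def, Algebra.smul_def, map_mul]; ring
      rw [this]
      exact hsum _ _ fun i _ => hsm _ _
  have hS0 : ∀ x ∈ S0, f x = 0 → x = 0 := by
    intro x hx hfx
    have hx2 : x ∈ Submodule.span k (ps : Set E) := by
      have : x ∈ Subalgebra.toSubmodule S0 := hx
      rwa [Algebra.adjoin_eq_span, Submonoid.closure_eq] at this
    obtain ⟨c, rfl⟩ := hform x hx2
    have hli := hld ι b b.linearIndependent
    rw [linearIndependent_iff'] at hli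
    have h1 := hli c.support (fun i => ⟨f (c i) ^ p, ⟨f (c i), rfl⟩⟩) (by
      rw [← hfx]
      simp only [F, Finsupp.sum, map_sum, map_mul, map_pow, AlgHom.commutes]
      rfl)
    refine Finset.sum_eq_zero fun i hi => ?_
    have h2 : f (c i) ^ p = 0 := congrArg Subtype.val (h1 i hi)
    simp only
    rw [hker _ ((pow_eq_zero_iff hp.ne_zero).1 h2), zero_mul]
  obtain ⟨S, hS0S, hS⟩ := exists_maximal_subalgebra f S0 hS0
  have hpS : ∀ x : E, x ^ p ∈ S := fun x => hS0S (Algebra.subset_adjoin ⟨x, rfl⟩)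
  have hfield : IsField S := by
    refine ⟨⟨0, 1, fun h => ?_⟩, mul_comm, ?_⟩
    · have h1 : (0 : E) = 1 := congrArg Subtype.val h
      have := congrArg f h1
      simp at this
    · intro x hx
      have hfx : f x ≠ 0 := fun h => hx (Subtype.ext (hS.1 _ x.2 h))
      obtain ⟨y, hy⟩ := hf (f x)⁻¹
      refine ⟨⟨_, S.mul_mem (S.pow_mem x.2 (p - 1)) (hpS y)⟩, Subtype.ext ?_⟩
      change (x : E) * ((x : E) ^ (p - 1) * y ^ p) = 1
      rw [← mul_assoc, ← pow_succ', Nat.sub_add_cancel hp.one_le, ← mul_pow, ← sub_eq_zero, ← one_pow p, ← sub_pow_char]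
      apply hker
      rw [map_sub, map_mul, hy, mul_inv_cancel₀ hfx, map_one, sub_self]
  let _ : Field S := hfield.toField
  let _ : Algebra S ℓ := (f.comp S.val).toRingHom.toAlgebra
  refine ⟨S, hS.1, fun z => ?_⟩
  by_contra hcon
  push Not at hcon
  obtain ⟨t, rfl⟩ := hf z
  apply hcon t _ rfl
  refine exists_of_maximal f S hS t fun q hq => ?_
  let a : S := ⟨t ^ p, hpS t⟩
  have hirr : Irreducible (Polynomial.X ^ p - Polynomial.C a) := by
    refine X_pow_sub_C_irreducible_of_prime hp fun c hc => hcon c c.2 ?_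
    have h1 : (c : E) ^ p = t ^ p := congrArg Subtype.val hc
    have h2 := congrArg f h1
    have : CharP ℓ p := inferInstance
    rw [map_pow, map_pow] at h2
    exact frobenius_inj ℓ p h2
  have hmin := minpoly.eq_of_irreducible_of_monic (x := f t) hirr (by
    rw [map_sub, map_pow, Polynomial.aeval_X, Polynomial.aeval_C, sub_eq_zero, ← map_pow]; rfl)
    (Polynomial.monic_X_pow_sub_C a hp.ne_zero)
  rw [Polynomial.eval_map] at hq
  obtain ⟨r, hr⟩ := minpoly.dvd S (f t) (p := q) hq
  rw [hr, ← hmin, map_mul, map_sub, map_pow, Polynomial.aeval_X, Polynomial.aeval_C]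
  have : algebraMap S E a = t ^ p := rfl
  rw [this, sub_self, zero_mul]

section cohen

variable {Λ0 : Type*} [CommRing Λ0] {k : Type*} [Field k] [Algebra Λ0 k]
  {R : Type v} [CommRing R] [IsLocalRing R] [Algebra Λ0 R]

/-- Approximate coefficient rings. -/
structure ApproxCoeff (π : Λ0) (S : Subalgebra Λ0 R) (j : ℕ) : Prop where
  le : ∀ x ∈ maximalIdeal R ^ j, x ∈ S
  onto : ∀ z : ResidueField R, ∃ x ∈ S, residue R x = z
  ker : ∀ x ∈ S, x ∈ maximalIdeal R → ∃ y ∈ S, x - algebraMap Λ0 R π * y ∈ maximalIdeal R ^ j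

theorem ApproxCoeff.step [Algebra k (ResidueField R)] [IsScalarTower Λ0 k (ResidueField R)]
    (π : Λ0) (hk : Function.Surjective (algebraMap Λ0 k)) (hker : ∀ a, algebraMap Λ0 k a = 0 → π ∣ a)
    (hπ : algebraMap Λ0 k π = 0) (hsec : SectionProp k (ResidueField R))
    (S : Subalgebra Λ0 R) (j : ℕ) (hj : 1 ≤ j) (hS : ApproxCoeff π S j) :
    ∃ S' ≤ S, ApproxCoeff π S' (j + 1) ∧ ∀ x ∈ S, ∃ y ∈ S', x - y ∈ maximalIdeal R ^ j := by
  have hπn : algebraMap Λ0 R π ∈ maximalIdeal R := by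
    rw [← residue_eq_zero_iff]
    change algebraMap R (ResidueField R) _ = 0
    rw [← IsScalarTower.algebraMap_apply, IsScalarTower.algebraMap_apply Λ0 k, hπ, map_zero]
  let J : Ideal S := Ideal.span {algebraMap Λ0 S π} ⊔ (maximalIdeal R ^ (j + 1)).comap S.val
  have hJ : ∀ x : S, x ∈ J ↔ ∃ y ∈ S, (x : R) - algebraMap Λ0 R π * y ∈ maximalIdeal R ^ (j + 1) := by
    intro x
    constructor
    · intro hx
      obtain ⟨a, ha, b, hb, rfl⟩ := Submodule.mem_sup.1 hx
      obtain ⟨y, rfl⟩ := Ideal.mem_span_singleton.1 ha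
      refine ⟨y, y.2, ?_⟩
      have : ((algebraMap Λ0 S π * y + b : S) : R) - algebraMap Λ0 R π * y = S.val b := by
        simp
      rw [this]; exact hb
    · rintro ⟨y, hy, h⟩
      have : x = algebraMap Λ0 S π * ⟨y, hy⟩ + (x - algebraMap Λ0 S π * ⟨y, hy⟩) := by ring
      rw [this]
      refine Submodule.add_mem_sup (Ideal.mul_mem_right _ _ (Ideal.mem_span_singleton_self _)) ?_
      exact h
  have hJn : ∀ x : S, x ∈ J → (x : R) ∈ maximalIdeal R := by
    intro x hx
    obtain ⟨y, -, h⟩ := (hJ x).1 hx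
    have h1 := Ideal.pow_le_self (by omega) h
    have := Ideal.add_mem _ h1 (Ideal.mul_mem_right y _ hπn)
    simpa using this
  let E := S ⧸ J
  let κ : k →+* E := RingHom.liftOfSurjective (algebraMap Λ0 k) hk ⟨algebraMap Λ0 E, by
    intro a ha
    obtain ⟨c, rfl⟩ := hker a ha
    rw [RingHom.mem_ker, map_mul, IsScalarTower.algebraMap_apply Λ0 S E]
    have : algebraMap S E (algebraMap Λ0 S π) = 0 :=
      Ideal.Quotient.eq_zero_iff_mem.2 (Ideal.mem_sup_left (Ideal.mem_span_singleton_self _))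
    rw [this, zero_mul]⟩
  have hκ : ∀ a, κ (algebraMap Λ0 k a) = algebraMap Λ0 E a := fun a =>
    RingHom.liftOfRightInverse_comp_apply _ _ _ _ _
  let _ : Algebra k E := κ.toAlgebra
  let f0 : E →+* ResidueField R := Ideal.Quotient.lift J ((residue R).comp S.val.toRingHom) (by
    intro x hx
    exact (residue_eq_zero_iff _).2 (hJn x hx))
  have hf0 : ∀ x : S, f0 (Ideal.Quotient.mk J x) = residue R x := fun x => rfl
  let f : E →ₐ[k] ResidueField R := { f0 with
    commutes' := by
      intro c
      obtain ⟨a, rfl⟩ := hk c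
      change f0 (κ _) = _
      rw [hκ, ← IsScalarTower.algebraMap_apply]
      rfl }
  have hf : ∀ x : S, f (Ideal.Quotient.mk J x) = residue R x := fun x => rfl
  obtain ⟨T, hT1, hT2⟩ := hsec E f
    (by
      intro z
      obtain ⟨x, hx, rfl⟩ := hS.onto z
      exact ⟨Ideal.Quotient.mk J ⟨x, hx⟩, rfl⟩)
    (by
      intro x y hx hy
      obtain ⟨x, rfl⟩ := Ideal.Quotient.mk_surjective x
      obtain ⟨y, rfl⟩ := Ideal.Quotient.mk_surjective y
      rw [hf, residue_eq_zero_iff] at hx hy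
      obtain ⟨x', hx', hx2⟩ := hS.ker x x.2 hx
      obtain ⟨y', hy', hy2⟩ := hS.ker y y.2 hy
      rw [← map_mul, Ideal.Quotient.eq_zero_iff_mem, hJ]
      refine ⟨x' * y + ((x : R) - algebraMap Λ0 R π * x') * y',
        S.add_mem (S.mul_mem hx' y.2) (S.mul_mem (hS.le _ hx2) hy'), ?_⟩
      have h3 := Ideal.mul_mem_mul hx2 hy2
      rw [← pow_add] at h3
      have h4 := Ideal.pow_le_pow_right (show j + 1 ≤ j + j by omega) h3
      convert h4 using 1
      push_cast; ring)
  let S' : Subalgebra Λ0 R :=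
    { carrier := {x | ∃ h : x ∈ S, Ideal.Quotient.mk J ⟨x, h⟩ ∈ T}
      mul_mem' := by
        rintro a b ⟨ha, ha'⟩ ⟨hb, hb'⟩
        exact ⟨S.mul_mem ha hb, T.mul_mem ha' hb'⟩
      add_mem' := by
        rintro a b ⟨ha, ha'⟩ ⟨hb, hb'⟩
        exact ⟨S.add_mem ha hb, T.add_mem ha' hb'⟩
      algebraMap_mem' := by
        intro r
        refine ⟨S.algebraMap_mem r, ?_⟩
        have := T.algebraMap_mem (algebraMap Λ0 k r)
        change κ _ ∈ T at this
        rw [hκ] at this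
        exact this }
  have hle' : ∀ x ∈ maximalIdeal R ^ (j + 1), x ∈ S' := by
    intro x hx
    have h1 := hS.le x (Ideal.pow_le_pow_right (by omega) hx)
    refine ⟨h1, ?_⟩
    have : Ideal.Quotient.mk J ⟨x, h1⟩ = 0 := by
      rw [Ideal.Quotient.eq_zero_iff_mem]
      exact Ideal.mem_sup_right hx
    rw [this]
    exact T.zero_mem
  have honto' : ∀ z : ResidueField R, ∃ x ∈ S', residue R x = z := by
    intro z
    obtain ⟨t, ht, rfl⟩ := hT2 z
    obtain ⟨x, rfl⟩ := Ideal.Quotient.mk_surjective t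
    exact ⟨x, ⟨x.2, ht⟩, rfl⟩
  have hdens0 : ∀ i, ∀ x ∈ S, ∃ y ∈ S', ∃ d ∈ S, x - y - algebraMap Λ0 R π ^ i * d ∈ maximalIdeal R ^ j := by
    intro i
    induction i with
    | zero => intro x hx; exact ⟨0, S'.zero_mem, x, hx, by simp⟩
    | succ i ih =>
      intro x hx
      obtain ⟨y, hy, d, hd, h⟩ := ih x hx
      obtain ⟨d', hd', hd2⟩ := honto' (residue R d)
      have : d - d' ∈ maximalIdeal R := by
        rw [← residue_eq_zero_iff, map_sub, hd2, sub_self]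
      obtain ⟨c, hc, hc2⟩ := hS.ker (d - d') (S.sub_mem hd hd'.1) this
      refine ⟨y + algebraMap Λ0 R π ^ i * d', S'.add_mem hy (S'.mul_mem (S'.pow_mem (S'.algebraMap_mem _) _) hd'),
        c, hc, ?_⟩
      have := Ideal.add_mem _ h (Ideal.mul_mem_left _ (algebraMap Λ0 R π ^ i) hc2)
      convert this using 1
      ring
  have hdens : ∀ x ∈ S, ∃ y ∈ S', x - y ∈ maximalIdeal R ^ j := by
    intro x hx
    obtain ⟨y, hy, d, hd, h⟩ := hdens0 j x hx
    refine ⟨y, hy, ?_⟩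
    have := Ideal.add_mem _ h (Ideal.mul_mem_right d _ (Ideal.pow_mem_pow hπn j))
    simpa using this
  refine ⟨S', fun x hx => hx.1, ⟨hle', honto', ?_⟩, hdens⟩
  rintro x ⟨hxS, hxT⟩ hxn
  have h0 := hT1 _ hxT ((residue_eq_zero_iff _).2 hxn)
  rw [Ideal.Quotient.eq_zero_iff_mem, hJ] at h0
  obtain ⟨c, hc, hc2⟩ := h0
  obtain ⟨y, hy, hy2⟩ := hdens c hc
  refine ⟨y, hy, ?_⟩
  have h5 := Ideal.mul_mem_mul hπn hy2
  rw [← pow_succ'] at h5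
  have := Ideal.add_mem _ hc2 h5
  convert this using 1
  simp only; ring

theorem exists_coeffRing [IsNoetherianRing R] [IsAdicComplete (maximalIdeal R) R]
    [Algebra k (ResidueField R)] [IsScalarTower Λ0 k (ResidueField R)]
    (π : Λ0) (hk : Function.Surjective (algebraMap Λ0 k)) (hker : ∀ a, algebraMap Λ0 k a = 0 → π ∣ a)
    (hπ : algebraMap Λ0 k π = 0) (hsec : SectionProp k (ResidueField R))
    (hreg : algebraMap Λ0 R π = 0 ∨ ∀ x, algebraMap Λ0 R π * x = 0 → x = 0) :
    ∃ Λ : Subalgebra Λ0 R, (∀ z : ResidueField R, ∃ x ∈ Λ, residue R x = z) ∧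
      (∀ x ∈ Λ, x ∈ maximalIdeal R → ∃ y ∈ Λ, x = algebraMap Λ0 R π * y) ∧
      (∀ x, (∀ n, ∃ y ∈ Λ, x - y ∈ maximalIdeal R ^ n) → x ∈ Λ) := by
  have step : ∀ (S : Subalgebra Λ0 R) (j : ℕ), ApproxCoeff π S (j + 1) → ∃ S' ≤ S, ApproxCoeff π S' (j + 1 + 1) ∧
      ∀ x ∈ S, ∃ y ∈ S', x - y ∈ maximalIdeal R ^ (j + 1) := fun S j h =>
    h.step π hk hker hπ hsec S (j + 1) (by omega)
  choose nx hnx1 hnx2 hnx3 using step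
  let seq : (j : ℕ) → {S : Subalgebra Λ0 R // ApproxCoeff π S (j + 1)} := fun j =>
    Nat.rec ⟨⊤, ⟨fun x _ => trivial, fun z => by
      obtain ⟨x, rfl⟩ := residue_surjective z
      exact ⟨x, trivial, rfl⟩, fun x _ hx => ⟨0, trivial, by simpa using hx⟩⟩⟩
      (fun j S => ⟨nx S.1 j S.2, hnx2 S.1 j S.2⟩) j
  have hle : ∀ j, (seq (j + 1)).1 ≤ (seq j).1 := fun j => hnx1 (seq j).1 j (seq j).2
  have hd : ∀ j, ∀ x ∈ (seq j).1, ∃ y ∈ (seq (j + 1)).1, x - y ∈ maximalIdeal R ^ (j + 1) :=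
    fun j => hnx3 (seq j).1 j (seq j).2
  have hanti : Antitone (fun j => (seq j).1) := antitone_nat_of_succ_le hle
  let Λ : Subalgebra Λ0 R := ⨅ j, (seq j).1
  have hΛ : ∀ x, x ∈ Λ ↔ ∀ j, x ∈ (seq j).1 := fun x => Algebra.mem_iInf
  have hlift : ∀ j, ∀ x ∈ (seq j).1, ∃ L ∈ Λ, x - L ∈ maximalIdeal R ^ (j + 1) := by
    intro j x hx
    choose! g hg1 hg2 using hd
    let xs : ℕ → R := fun i => Nat.rec x (fun i y => g (j + i) y) i
    have hxs : ∀ i, xs i ∈ (seq (j + i)).1 := by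
      intro i
      induction i with
      | zero => exact hx
      | succ i ih => exact hg1 _ _ ih
    have hxs2 : ∀ i, xs i - xs (i + 1) ∈ maximalIdeal R ^ (j + i + 1) := fun i => hg2 _ _ (hxs i)
    obtain ⟨L, hL⟩ := exists_limit (maximalIdeal R) xs (fun n => by
      rw [← neg_mem_iff, neg_sub]
      exact Ideal.pow_le_pow_right (by omega) (hxs2 n))
    have hx0 : ∀ i, x - xs i ∈ maximalIdeal R ^ (j + 1) := by
      intro i
      induction i with
      | zero => change x - x ∈ _; simp
      | succ i ih =>
        have := Ideal.add_mem _ ih (Ideal.pow_le_pow_right (by omega) (hxs2 i))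
        simpa using this
    refine ⟨L, (hΛ L).2 fun i => ?_, ?_⟩
    · have h1 := hanti (show i ≤ j + (i + 1) by omega) (hxs (i + 1))
      have h2 := (seq i).2.le _ (hL (i + 1))
      have := (seq i).1.sub_mem h1 h2
      simpa using this
    · have := Ideal.add_mem _ (hx0 (j + 1)) (hL (j + 1))
      simpa using this
  have hclosed : ∀ x, (∀ n, ∃ y ∈ Λ, x - y ∈ maximalIdeal R ^ n) → x ∈ Λ := by
    intro x hx
    rw [hΛ]
    intro j
    obtain ⟨y, hy, h⟩ := hx (j + 1)
    have := (seq j).1.add_mem ((seq j).2.le _ h) ((hΛ y).1 hy j)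
    simpa using this
  have hkrull : ∀ x : R, (∀ n, x ∈ maximalIdeal R ^ n) → x = 0 := by
    intro x hx
    have := mem_of_forall_mem_sup_pow (⊥ : Ideal R) (x := x) (fun l => Ideal.mem_sup_right (hx l))
    simpa using this
  refine ⟨Λ, ?_, ?_, hclosed⟩
  · intro z
    obtain ⟨x, hx, rfl⟩ := (seq 0).2.onto z
    obtain ⟨L, hL, h⟩ := hlift 0 x hx
    refine ⟨L, hL, ?_⟩
    rw [← sub_eq_zero, ← map_sub, residue_eq_zero_iff, ← neg_mem_iff, neg_sub]
    simpa using h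
  · intro x hx hxn
    have happ : ∀ J, ∃ y ∈ Λ, x - algebraMap Λ0 R π * y ∈ maximalIdeal R ^ J := by
      intro J
      obtain ⟨y, hy, h⟩ := (seq J).2.ker x ((hΛ x).1 hx J) hxn
      obtain ⟨L, hL, h2⟩ := hlift J y hy
      refine ⟨L, hL, Ideal.pow_le_pow_right (Nat.le_succ J) ?_⟩
      have := Ideal.add_mem _ h (Ideal.mul_mem_left _ (algebraMap Λ0 R π) h2)
      convert this using 1
      ring
    rcases hreg with h0 | hreg
    · refine ⟨0, Λ.zero_mem, ?_⟩
      rw [mul_zero]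
      refine hkrull x fun n => ?_
      obtain ⟨y, -, h⟩ := happ n
      simpa [h0] using h
    · set p := algebraMap Λ0 R π
      obtain ⟨c, hc⟩ := Ideal.exists_pow_inf_eq_pow_smul (maximalIdeal R) (Ideal.span {p} : Submodule R R)
      have har : ∀ n δ, p * δ ∈ maximalIdeal R ^ (n + c) → δ ∈ maximalIdeal R ^ n := by
        intro n δ hδ
        have h1 := hc (n + c) (by omega)
        have h2 : p * δ ∈ (maximalIdeal R ^ (n + c) • ⊤ ⊓ Ideal.span {p} : Submodule R R) := by
          refine ⟨?_, Ideal.mul_mem_right _ _ (Ideal.mem_span_singleton_self p)⟩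
          simpa using hδ
        rw [h1, Nat.add_sub_cancel] at h2
        have h3 := Submodule.smul_mono (le_refl (maximalIdeal R ^ n)) inf_le_right h2
        rw [smul_eq_mul, Ideal.mem_mul_span_singleton] at h3
        obtain ⟨z, hz, hzp⟩ := h3
        have : δ = z := by
          rw [← sub_eq_zero]
          apply hreg
          rw [mul_sub, ← hzp]; ring
        rwa [this]
      choose y hy hy2 using happ
      obtain ⟨L, hL⟩ := exists_limit (maximalIdeal R) (fun n => y (n + c)) (fun n => by
        apply har
        have h1 := Ideal.pow_le_pow_right (show n + c ≤ n + 1 + c by omega) (hy2 (n + 1 + c))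
        have h2 := hy2 (n + c)
        have := Ideal.sub_mem _ h2 h1
        convert this using 1
        ring)
      refine ⟨L, hclosed L fun n => ⟨y (n + c), hy _, ?_⟩, ?_⟩
      · rw [← neg_mem_iff, neg_sub]; exact hL n
      · rw [← sub_eq_zero]
        refine hkrull _ fun n => ?_
        have h1 := Ideal.pow_le_pow_right (show n ≤ n + c by omega) (hy2 (n + c))
        have := Ideal.add_mem _ h1 (Ideal.mul_mem_left _ p (hL n))
        convert this using 1
        ring

end cohen

theorem isDomain_and_isPrincipalIdealRing {Λ : Type*} [CommRing Λ] [Nontrivial Λ] (ϖ : Λ)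
    (h : ∀ x : Λ, x ≠ 0 → ∃ (i : ℕ) (w : Λˣ), x = ϖ ^ i * w) (hϖ : ϖ = 0 ∨ ∀ i, ϖ ^ i ≠ 0) :
    IsDomain Λ ∧ IsPrincipalIdealRing Λ := by
  classical
  have hnzd : NoZeroDivisors Λ := by
    refine ⟨fun {x y} hxy => ?_⟩
    by_contra hcon
    push Not at hcon
    obtain ⟨i, w, rfl⟩ := h x hcon.1
    obtain ⟨j, w', rfl⟩ := h y hcon.2
    have h1 : ϖ ^ (i + j) = 0 := by
      have : ϖ ^ (i + j) * ((w * w' : Λˣ) : Λ) = 0 := by rw [← hxy]; push_cast; ring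
      exact (Units.mul_left_eq_zero _).1 this
    rcases hϖ with h0 | h0
    · subst h0
      have hi : i = 0 := by
        by_contra hi; exact hcon.1 (by rw [zero_pow hi, zero_mul])
      have hj : j = 0 := by
        by_contra hi; exact hcon.2 (by rw [zero_pow hi, zero_mul])
      subst hi hj
      simp at h1
    · exact h0 _ h1
  refine ⟨NoZeroDivisors.to_isDomain Λ, ⟨fun I => ?_⟩⟩
  by_cases hI : I = ⊥
  · subst hI; infer_instance
  have key : ∀ x ∈ I, x ≠ 0 → ∃ (i : ℕ) (w : Λˣ), x = ϖ ^ i * w ∧ ϖ ^ i ∈ I := by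
    intro x hx hx0
    obtain ⟨i, w, rfl⟩ := h x hx0
    refine ⟨i, w, rfl, ?_⟩
    have := Ideal.mul_mem_right ((w⁻¹ : Λˣ) : Λ) I hx
    simpa [mul_assoc] using this
  have hex : ∃ i, ϖ ^ i ∈ I := by
    obtain ⟨x, hx, hx0⟩ := Submodule.exists_mem_ne_zero_of_ne_bot hI
    obtain ⟨i, w, -, hi⟩ := key x hx hx0
    exact ⟨i, hi⟩
  refine ⟨⟨ϖ ^ Nat.find hex, le_antisymm (fun x hx => ?_) ?_⟩⟩
  · by_cases hx0 : x = 0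
    · subst hx0; exact zero_mem _
    obtain ⟨i, w, rfl, hi⟩ := key x hx hx0
    have hle := Nat.find_min' hex hi
    refine Ideal.mem_span_singleton.2 ?_
    exact (pow_dvd_pow ϖ hle).mul_right _
  · rw [Submodule.span_singleton_le_iff_mem]
    exact Nat.find_spec hex

theorem coeffRing_props {Λ0 R : Type*} [CommRing Λ0] [CommRing R] [IsLocalRing R] [Algebra Λ0 R]
    [IsNoetherianRing R] [IsAdicComplete (maximalIdeal R) R] (π : Λ0)
    (hπ : algebraMap Λ0 R π ∈ maximalIdeal R)
    (hreg : algebraMap Λ0 R π = 0 ∨ ∀ x, algebraMap Λ0 R π * x = 0 → x = 0)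
    (Λ : Subalgebra Λ0 R) (h1 : ∀ z : ResidueField R, ∃ x ∈ Λ, residue R x = z)
    (h2 : ∀ x ∈ Λ, x ∈ maximalIdeal R → ∃ y ∈ Λ, x = algebraMap Λ0 R π * y)
    (h3 : ∀ x, (∀ n, ∃ y ∈ Λ, x - y ∈ maximalIdeal R ^ n) → x ∈ Λ) :
    IsDomain Λ ∧ IsPrincipalIdealRing Λ ∧ ∃ _ : IsLocalRing Λ, IsAdicComplete (maximalIdeal Λ) Λ ∧
      maximalIdeal Λ = Ideal.span {algebraMap Λ0 Λ π} ∧ IsLocalHom Λ.val := by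
  set p := algebraMap Λ0 R π with hp
  set ϖ := algebraMap Λ0 Λ π with hϖ
  have hpϖ : (ϖ : R) = p := rfl
  have hkrull : ∀ x : R, (∀ n, x ∈ maximalIdeal R ^ n) → x = 0 := by
    intro x hx
    have := mem_of_forall_mem_sup_pow (⊥ : Ideal R) (x := x) (fun l => Ideal.mem_sup_right (hx l))
    simpa using this
  have h1p : ∀ w ∈ Λ, IsUnit (p * w - 1) := by
    intro w _
    have : p * w ∈ maximalIdeal R := Ideal.mul_mem_right _ _ hπ
    by_contra hn
    have h4 : p * w - 1 ∈ maximalIdeal R := hn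
    have := Ideal.sub_mem _ this h4
    rw [sub_sub_cancel] at this
    exact (Ideal.ne_top_iff_one _).1 (Ideal.IsPrime.ne_top inferInstance) this
  have hgeo : ∀ w ∈ Λ, ∃ v ∈ Λ, v * (1 - p * w) = 1 := by
    intro w hw
    obtain ⟨u, hu⟩ := h1p w hw
    have hv : (-(u⁻¹ : Rˣ) : R) * (1 - p * w) = 1 := by
      have : (1 - p * w) = - (u : R) := by rw [hu]; ring
      rw [this]; simp
    refine ⟨_, h3 _ fun n => ⟨∑ i ∈ Finset.range n, (p * w) ^ i, Λ.sum_mem fun i _ =>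
      Λ.pow_mem (Λ.mul_mem (Λ.algebraMap_mem _) hw) _, ?_⟩, hv⟩
    have hg := geom_sum_mul_neg (p * w) n
    have : (-(u⁻¹ : Rˣ) : R) - ∑ i ∈ Finset.range n, (p * w) ^ i = (p * w) ^ n * (-(u⁻¹ : Rˣ) : R) := by
      have h5 : (-(u⁻¹ : Rˣ) : R) * ((∑ i ∈ Finset.range n, (p * w) ^ i) * (1 - p * w)) = ∑ i ∈ Finset.range n, (p * w) ^ i := by
        rw [mul_left_comm, hv, mul_one]
      rw [← h5, hg]; ring
    rw [this]
    exact Ideal.mul_mem_right _ _ (Ideal.pow_mem_pow (Ideal.mul_mem_right _ _ hπ) n)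
  have hunit : ∀ x : Λ, (x : R) ∉ maximalIdeal R → IsUnit x := by
    intro x hx
    have hx0 : residue R x ≠ 0 := fun h => hx ((residue_eq_zero_iff _).1 h)
    obtain ⟨y, hy, hy2⟩ := h1 (residue R x)⁻¹
    obtain ⟨w, hw, hw2⟩ := h2 (1 - x * y) (Λ.sub_mem Λ.one_mem (Λ.mul_mem x.2 hy)) (by
      rw [← residue_eq_zero_iff, map_sub, map_mul, hy2, mul_inv_cancel₀ hx0, map_one, sub_self])
    obtain ⟨v, hv, hv2⟩ := hgeo w hw
    refine IsUnit.of_mul_eq_one (⟨y * v, Λ.mul_mem hy hv⟩ : Λ) (Subtype.ext ?_)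
    change (x : R) * (y * v) = 1
    rw [← hv2, ← hw2]; ring
  have hunit' : ∀ x : Λ, IsUnit x ↔ (x : R) ∉ maximalIdeal R := by
    intro x
    refine ⟨fun hu hx => ?_, hunit x⟩
    exact (mem_maximalIdeal _).1 hx (hu.map Λ.val)
  have hloc : IsLocalRing Λ := by
    refine IsLocalRing.of_nonunits_add fun a b ha hb => ?_
    rw [mem_nonunits_iff, hunit', not_not] at ha hb ⊢
    exact Ideal.add_mem _ ha hb
  have hmem : ∀ x : Λ, x ∈ maximalIdeal Λ ↔ (x : R) ∈ maximalIdeal R := by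
    intro x
    rw [mem_maximalIdeal, mem_nonunits_iff, hunit', not_not]
  have hmax : maximalIdeal Λ = Ideal.span {ϖ} := by
    apply le_antisymm
    · intro x hx
      obtain ⟨y, hy, hxy⟩ := h2 x x.2 ((hmem x).1 hx)
      exact Ideal.mem_span_singleton.2 ⟨⟨y, hy⟩, Subtype.ext hxy⟩
    · rw [Ideal.span_singleton_le_iff_mem, hmem]
      exact hπ
  have hnil : ϖ = 0 ∨ ∀ i, ϖ ^ i ≠ 0 := by
    rcases hreg with h0 | h0
    · exact Or.inl (Subtype.ext h0)
    · right
      intro i hi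
      have hi' : p ^ i = 0 := congrArg Subtype.val hi
      clear hi
      induction i with
      | zero => simp at hi'
      | succ i ih =>
        rw [pow_succ'] at hi'
        exact ih (h0 _ hi')
  obtain ⟨hdom, hpid⟩ := isDomain_and_isPrincipalIdealRing ϖ (by
    intro x hx
    by_contra hcon
    push Not at hcon
    apply hx
    have : ∀ i, ∃ y : Λ, x = ϖ ^ i * y := by
      intro i
      induction i with
      | zero => exact ⟨x, by simp⟩
      | succ i ih =>
        obtain ⟨y, hy⟩ := ih
        have : y ∈ maximalIdeal Λ := by
          intro hu
          obtain ⟨w, rfl⟩ := hu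
          exact hcon i w hy
        rw [hmax, Ideal.mem_span_singleton] at this
        obtain ⟨z, rfl⟩ := this
        exact ⟨z, by rw [hy]; ring⟩
    refine Subtype.ext (hkrull x fun n => ?_)
    obtain ⟨y, hy⟩ := this n
    have : (x : R) = p ^ n * y := by rw [hy]; rfl
    rw [this]
    exact Ideal.mul_mem_right _ _ (Ideal.pow_mem_pow hπ n)) hnil
  refine ⟨hdom, hpid, hloc, ?_, hmax, ⟨fun x hx => hunit x fun h => (mem_maximalIdeal _).1 h hx⟩⟩
  have : IsPrecomplete (maximalIdeal Λ) Λ := by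
    refine isPrecomplete_of_limit _ fun f hf => ?_
    have hf' : ∀ n, ∃ g : Λ, f (n + 1) - f n = ϖ ^ n * g := by
      intro n
      have := hf n
      rw [hmax, Ideal.span_singleton_pow, Ideal.mem_span_singleton] at this
      exact this
    choose g hg using hf'
    have hlim : ∀ n, ∃ h : Λ, ∀ m, (∑ i ∈ Finset.range m, p ^ i * (g (n + i) : R)) - h ∈ maximalIdeal R ^ m := by
      intro n
      obtain ⟨L, hL⟩ := exists_limit (maximalIdeal R) (fun m => ∑ i ∈ Finset.range m, p ^ i * (g (n + i) : R)) (by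
        intro m
        rw [Finset.sum_range_succ, add_sub_cancel_left]
        exact Ideal.mul_mem_right _ _ (Ideal.pow_mem_pow hπ m))
      refine ⟨⟨L, h3 L fun m => ⟨∑ i ∈ Finset.range m, p ^ i * (g (n + i) : R), Λ.sum_mem fun i _ => Λ.mul_mem (Λ.pow_mem (Λ.algebraMap_mem π) i) (g (n + i)).2, ?_⟩⟩, hL⟩
      rw [← neg_mem_iff, neg_sub]; exact hL m
    choose h hh using hlim
    have hfn : ∀ n, f n = f 0 + ∑ i ∈ Finset.range n, ϖ ^ i * g i := by
      intro n
      induction n with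
      | zero => simp
      | succ n ih => rw [Finset.sum_range_succ, ← hg, ← add_assoc, ← ih]; ring
    refine ⟨f 0 + h 0, fun n => ?_⟩
    rw [hmax, Ideal.span_singleton_pow, Ideal.mem_span_singleton]
    refine ⟨- h n, ?_⟩
    rw [hfn n, ← sub_eq_zero]
    refine Subtype.ext (hkrull _ fun m => ?_)
    have e1 := Ideal.pow_le_pow_right (show m ≤ n + m by omega) (hh 0 (n + m))
    have e2 := Ideal.mul_mem_left _ (p ^ n) (hh n m)
    have := Ideal.sub_mem _ e1 e2
    convert this using 1
    rw [Finset.sum_range_add]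
    simp only [zero_add, pow_add, mul_assoc, ← Finset.mul_sum]
    simp only [AddSubgroupClass.coe_sub, Subalgebra.coe_add, Subalgebra.coe_mul, Subalgebra.coe_neg, SubmonoidClass.coe_pow, AddSubmonoidClass.coe_finsetSum, hpϖ]
    ring
  exact { }

section ps
open PowerSeries

theorem mem_maximalIdeal_powerSeries {R : Type*} [CommRing R] [IsLocalRing R] (f : PowerSeries R) :
    f ∈ maximalIdeal (PowerSeries R) ↔ constantCoeff f ∈ maximalIdeal R := by
  rw [mem_maximalIdeal, mem_maximalIdeal, mem_nonunits_iff, mem_nonunits_iff, PowerSeries.isUnit_iff_constantCoeff]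

theorem mem_maximalIdeal_pow_powerSeries {R : Type*} [CommRing R] [IsLocalRing R] (n : ℕ) (f : PowerSeries R) :
    f ∈ maximalIdeal (PowerSeries R) ^ n ↔ ∀ i, coeff i f ∈ maximalIdeal R ^ (n - i) := by
  constructor
  · intro hf
    induction n generalizing f with
    | zero => simp
    | succ n ih =>
      rw [pow_succ'] at hf
      refine Submodule.mul_induction_on hf ?_ ?_
      · intro a ha b hb i
        rw [mem_maximalIdeal_powerSeries] at ha
        rw [coeff_mul]
        refine Ideal.sum_mem _ fun x hx => ?_
        rw [Finset.HasAntidiagonal.mem_antidiagonal] at hx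
        have hb2 := ih b hb x.2
        rcases Nat.eq_zero_or_pos x.1 with h0 | h0
        · rw [h0, coeff_zero_eq_constantCoeff_apply]
          have := Ideal.mul_mem_mul ha hb2
          rw [← pow_succ'] at this
          exact Ideal.pow_le_pow_right (by omega) this
        · exact Ideal.mul_mem_left _ _ (Ideal.pow_le_pow_right (by omega) hb2)
      · intro a b ha hb i
        rw [map_add]
        exact Ideal.add_mem _ (ha i) (hb i)
  · intro hf
    induction n generalizing f with
    | zero => simp
    | succ n ih =>
      obtain ⟨g, hg⟩ : X ∣ (f - C (constantCoeff f)) := by rw [X_dvd_iff]; simp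
      have hf2 : f = C (constantCoeff f) + X * g := by rw [← hg]; ring
      rw [hf2]
      refine Ideal.add_mem _ ?_ ?_
      · have h0 := hf 0
        rw [coeff_zero_eq_constantCoeff_apply] at h0
        have h1 := Ideal.mem_map_of_mem (C (R := R)) h0
        rw [Ideal.map_pow] at h1
        refine Ideal.pow_right_mono ?_ _ h1
        rw [Ideal.map_le_iff_le_comap]
        intro x hx
        rw [Ideal.mem_comap, mem_maximalIdeal_powerSeries]
        simpa using hx
      · rw [pow_succ']
        refine Ideal.mul_mem_mul ?_ (ih g fun i => ?_)
        · rw [mem_maximalIdeal_powerSeries]; simp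
        · have := hf (i + 1)
          rw [hf2, map_add, coeff_succ_X_mul, coeff_C, if_neg (by omega), zero_add] at this
          exact Ideal.pow_le_pow_right (by omega) this

theorem maximalIdeal_powerSeries (R : Type*) [CommRing R] [IsLocalRing R] :
    maximalIdeal (PowerSeries R) = (maximalIdeal R).map (C (R := R)) ⊔ Ideal.span {X} := by
  apply le_antisymm
  · intro f hf
    rw [mem_maximalIdeal_powerSeries] at hf
    obtain ⟨g, hg⟩ : X ∣ (f - C (constantCoeff f)) := by rw [X_dvd_iff]; simp
    have hf2 : f = C (constantCoeff f) + X * g := by rw [← hg]; ring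
    rw [hf2]
    exact Submodule.add_mem_sup (Ideal.mem_map_of_mem _ hf) (Ideal.mul_mem_right _ _ (Ideal.mem_span_singleton_self _))
  · refine sup_le ?_ ?_
    · rw [Ideal.map_le_iff_le_comap]
      intro x hx
      rw [Ideal.mem_comap, mem_maximalIdeal_powerSeries]
      simpa using hx
    · rw [Ideal.span_singleton_le_iff_mem, mem_maximalIdeal_powerSeries]
      simp

instance isAdicComplete_powerSeries (R : Type*) [CommRing R] [IsLocalRing R] [IsNoetherianRing R]
    [IsAdicComplete (maximalIdeal R) R] : IsAdicComplete (maximalIdeal (PowerSeries R)) (PowerSeries R) := by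
  have : IsPrecomplete (maximalIdeal (PowerSeries R)) (PowerSeries R) := by
    refine isPrecomplete_of_limit _ fun f hf => ?_
    have hlim : ∀ i, ∃ L, ∀ n, coeff i (f (n + i)) - L ∈ maximalIdeal R ^ n := by
      intro i
      refine exists_limit (maximalIdeal R) (fun n => coeff i (f (n + i))) fun n => ?_
      have := (mem_maximalIdeal_pow_powerSeries _ _).1 (hf (n + i)) i
      rw [Nat.add_sub_cancel, map_sub] at this
      rw [show n + 1 + i = n + i + 1 by omega]
      exact this
    choose L hL using hlim
    refine ⟨PowerSeries.mk L, fun n => ?_⟩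
    rw [mem_maximalIdeal_pow_powerSeries]
    intro i
    rw [map_sub, coeff_mk]
    rcases le_or_gt i n with h | h
    · have := hL i (n - i)
      rwa [Nat.sub_add_cancel h] at this
    · rw [show n - i = 0 by omega]; simp
  exact { }

theorem isIntegrallyClosed_powerSeries (R : Type*) [CommRing R] [IsLocalRing R] [IsNoetherianRing R]
    [IsDomain R] [IsIntegrallyClosed R] : IsIntegrallyClosed (PowerSeries R) := by
  have hker : RingHom.ker (constantCoeff (R := R)) = Ideal.span {X} := by
    ext f
    rw [RingHom.mem_ker, Ideal.mem_span_singleton, X_dvd_iff]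
  let e : R ≃+* PowerSeries R ⧸ Ideal.span {(X : PowerSeries R)} :=
    ((Ideal.quotEquivOfEq hker.symm).trans
      (RingHom.quotientKerEquivOfSurjective (f := constantCoeff (R := R)) (fun a => ⟨C a, by simp⟩))).symm
  obtain ⟨h1, h2⟩ := isIntegrallyClosed_of_ringEquiv e ⟨inferInstance, inferInstance⟩
  exact isIntegrallyClosed_of_quotient (t := (X : PowerSeries R))
    (by rw [mem_maximalIdeal_powerSeries]; simp) X_ne_zero

theorem map_maximalIdeal_powerSeries {R S : Type*} [CommRing R] [IsLocalRing R] [CommRing S] [IsLocalRing S]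
    (ψ : R →+* S) (h : (maximalIdeal R).map ψ = maximalIdeal S) :
    (maximalIdeal (PowerSeries R)).map (PowerSeries.map ψ) = maximalIdeal (PowerSeries S) := by
  rw [maximalIdeal_powerSeries, maximalIdeal_powerSeries, Ideal.map_sup, Ideal.map_map, ← h, Ideal.map_map,
    Ideal.map_span]
  congr 2
  · ext; simp
  · simp

/-- Evaluation of power series at an element of the maximal ideal. -/
theorem exists_eval {R A : Type*} [CommRing R] [CommRing A] [IsLocalRing A] [IsNoetherianRing A]
    [IsAdicComplete (maximalIdeal A) A] (α : R →+* A) (x : A) (hx : x ∈ maximalIdeal A) :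
    ∃ F : PowerSeries R →+* A, (∀ n f, F f - (trunc n f).eval₂ α x ∈ maximalIdeal A ^ n) := by
  have hlim : ∀ f : PowerSeries R, ∃ L, ∀ n, (trunc n f).eval₂ α x - L ∈ maximalIdeal A ^ n := by
    intro f
    refine exists_limit (maximalIdeal A) (fun n => (trunc n f).eval₂ α x) fun n => ?_
    rw [trunc_succ, Polynomial.eval₂_add, add_sub_cancel_left, Polynomial.eval₂_monomial]
    exact Ideal.mul_mem_left _ _ (Ideal.pow_mem_pow hx n)
  choose F hF using hlim
  have hF' : ∀ n f, F f - (trunc n f).eval₂ α x ∈ maximalIdeal A ^ n := fun n f => by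
    rw [← neg_mem_iff, neg_sub]; exact hF f n
  have hkrull : ∀ x y : A, (∀ n, x - y ∈ maximalIdeal A ^ n) → x = y := by
    intro x y hx
    have := mem_of_forall_mem_sup_pow (⊥ : Ideal A) (x := x - y) (fun l => Ideal.mem_sup_right (hx l))
    exact sub_eq_zero.1 (by simpa using this)
  have hlow : ∀ (n : ℕ) (p : Polynomial R), (∀ i < n, p.coeff i = 0) → p.eval₂ α x ∈ maximalIdeal A ^ n := by
    intro n p hp
    obtain ⟨q, rfl⟩ := (Polynomial.X_pow_dvd_iff).2 hp
    rw [Polynomial.eval₂_mul, Polynomial.eval₂_X_pow]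
    exact Ideal.mul_mem_right _ _ (Ideal.pow_mem_pow hx n)
  have hadd : ∀ f g, F (f + g) = F f + F g := by
    intro f g
    refine hkrull _ _ fun n => ?_
    have h1 := hF' n (f + g)
    rw [map_add (trunc n), Polynomial.eval₂_add] at h1
    have := Ideal.sub_mem _ (Ideal.sub_mem _ h1 (hF' n f)) (hF' n g)
    convert this using 1; ring
  have hmul : ∀ f g, F (f * g) = F f * F g := by
    intro f g
    refine hkrull _ _ fun n => ?_
    have h1 := hF' n (f * g)
    have h2 : (trunc n (f * g)).eval₂ α x - (trunc n f).eval₂ α x * (trunc n g).eval₂ α x ∈ maximalIdeal A ^ n := by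
      rw [← Polynomial.eval₂_mul, ← Polynomial.eval₂_sub]
      refine hlow n _ fun i hi => ?_
      rw [Polynomial.coeff_sub, coeff_trunc, if_pos hi, ← Polynomial.coeff_coe, Polynomial.coe_mul,
        coeff_mul_eq_coeff_trunc_mul_trunc f g hi, sub_self]
    have h3 := Ideal.mul_mem_left _ (F g) (hF' n f)
    have h4 := Ideal.mul_mem_left _ ((trunc n f).eval₂ α x) (hF' n g)
    have := Ideal.sub_mem _ (Ideal.add_mem _ h1 h2) (Ideal.add_mem _ h3 h4)
    convert this using 1; ring
  have hC : ∀ r, F (C r) = α r := by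
    intro r
    refine hkrull _ _ fun n => ?_
    have h1 := hF' (n + 1) (C r)
    rw [trunc_C, Polynomial.eval₂_C] at h1
    exact Ideal.pow_le_pow_right (Nat.le_succ n) h1
  exact ⟨{ toFun := F
           map_one' := by rw [← map_one C, hC, map_one]
           map_zero' := by rw [← map_zero C, hC, map_zero]
           map_add' := hadd
           map_mul' := hmul }, hF'⟩

theorem exists_eval_pair {R S A B : Type*} [CommRing R] [CommRing S] [CommRing A] [IsLocalRing A] [IsNoetherianRing A]
    [IsAdicComplete (maximalIdeal A) A] [CommRing B] [IsLocalRing B] [IsNoetherianRing B]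
    [IsAdicComplete (maximalIdeal B) B] (α : R →+* A) (x : A) (hx : x ∈ maximalIdeal A)
    (ψ : R →+* S) (σ : A →+* B) [IsLocalHom σ] (β : S →+* B) (hcomp : σ.comp α = β.comp ψ) :
    ∃ (F : PowerSeries R →+* A) (G : PowerSeries S →+* B), F X = x ∧ (∀ r, F (C r) = α r) ∧ (∀ r, G (C r) = β r) ∧
      σ.comp F = G.comp (PowerSeries.map ψ) := by
  have hσ : ∀ n y, y ∈ maximalIdeal A ^ n → σ y ∈ maximalIdeal B ^ n := by
    intro n y hy
    have h1 := Ideal.mem_map_of_mem σ hy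
    rw [Ideal.map_pow] at h1
    exact Ideal.pow_right_mono (map_maximalIdeal_le σ) n h1
  obtain ⟨F, hF⟩ := exists_eval α x hx
  obtain ⟨G, hG⟩ := exists_eval β (σ x) (by simpa using hσ 1 x (by simpa using hx))
  have hkrullA : ∀ x y : A, (∀ n, x - y ∈ maximalIdeal A ^ n) → x = y := by
    intro x y hx
    have := mem_of_forall_mem_sup_pow (⊥ : Ideal A) (x := x - y) (fun l => Ideal.mem_sup_right (hx l))
    exact sub_eq_zero.1 (by simpa using this)
  have hkrullB : ∀ x y : B, (∀ n, x - y ∈ maximalIdeal B ^ n) → x = y := by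
    intro x y hx
    have := mem_of_forall_mem_sup_pow (⊥ : Ideal B) (x := x - y) (fun l => Ideal.mem_sup_right (hx l))
    exact sub_eq_zero.1 (by simpa using this)
  refine ⟨F, G, ?_, ?_, ?_, ?_⟩
  · refine hkrullA _ _ fun n => ?_
    have h1 := hF (n + 2) X
    rw [trunc_X, Polynomial.eval₂_X] at h1
    exact Ideal.pow_le_pow_right (by omega) h1
  · intro r
    refine hkrullA _ _ fun n => ?_
    have h1 := hF (n + 1) (C r)
    rw [trunc_C, Polynomial.eval₂_C] at h1
    exact Ideal.pow_le_pow_right (by omega) h1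
  · intro r
    refine hkrullB _ _ fun n => ?_
    have h1 := hG (n + 1) (C r)
    rw [trunc_C, Polynomial.eval₂_C] at h1
    exact Ideal.pow_le_pow_right (by omega) h1
  · ext f
    refine hkrullB _ _ fun n => ?_
    have h1 := hσ n _ (hF n f)
    have h2 := hG n (PowerSeries.map ψ f)
    rw [map_sub, Polynomial.hom_eval₂, hcomp] at h1
    rw [trunc_map, Polynomial.eval₂_map] at h2
    have := Ideal.sub_mem _ h1 h2
    simpa using this

end ps

/-- Existence of enough compatible `p`-root-linear functionals. -/
def FProp (p : ℕ) {A0 : Type u} {B0 : Type v} [CommRing A0] [CommRing B0] (ψ : A0 →+* B0) : Prop :=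
  ∀ w : A0, w ≠ 0 → ∃ (φA : A0 →+ A0) (φB : B0 →+ B0), (∀ a, ψ (φA a) = φB (ψ a)) ∧
    (∀ f g, φA (f ^ p * g) = f * φA g) ∧ (∀ f g, φB (f ^ p * g) = f * φB g) ∧ φA w ≠ 0

theorem fProp_one {A0 : Type u} {B0 : Type v} [CommRing A0] [CommRing B0] (ψ : A0 →+* B0) : FProp 1 ψ :=
  fun w hw => ⟨AddMonoidHom.id _, AddMonoidHom.id _, by simp, by simp, by simp, by simpa using hw⟩

theorem FProp.of_equiv {p : ℕ} {A0 : Type u} {B0 : Type v} [CommRing A0] [CommRing B0] {ψ : A0 →+* B0}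
    {A1 : Type u} {B1 : Type v} [CommRing A1] [CommRing B1] {ψ1 : A1 →+* B1} (e : A0 ≃+* A1) (e' : B0 ≃+* B1)
    (he : ∀ a, e' (ψ a) = ψ1 (e a)) (h : FProp p ψ1) : FProp p ψ := by
  intro w hw
  obtain ⟨φA, φB, h1, h2, h3, h4⟩ := h (e w) (by simpa using hw)
  refine ⟨(e.symm : A1 →+ A0).comp (φA.comp (e : A0 →+ A1)), (e'.symm : B1 →+ B0).comp (φB.comp (e' : B0 →+ B1)),
    fun a => ?_, fun f g => ?_, fun f g => ?_, ?_⟩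
  · apply e'.injective
    simp [he, h1]
  · simp [h2]
  · simp [h3]
  · simpa using h4

theorem exists_root_functional {p : ℕ} [Fact p.Prime] {k : Type*} [Field k] [CharP k p]
    (lam : k →ₗ[(frobenius k p).fieldRange] (frobenius k p).fieldRange) :
    ∃ φ : k →+ k, (∀ x, φ x ^ p = lam x) ∧ ∀ f g, φ (f ^ p * g) = f * φ g := by
  have hex : ∀ x, ∃ y : k, y ^ p = lam x := fun x => (lam x).2
  choose φ hφ using hex
  refine ⟨AddMonoidHom.mk' φ fun a b => ?_, hφ, fun f g => ?_⟩
  · apply frobenius_inj k p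
    rw [map_add, frobenius_def, frobenius_def, frobenius_def, hφ, hφ, hφ, map_add]; rfl
  · apply frobenius_inj k p
    change φ (f ^ p * g) ^ p = (f * φ g) ^ p
    rw [hφ, mul_pow, hφ]
    have : f ^ p * g = (⟨f ^ p, ⟨f, rfl⟩⟩ : (frobenius k p).fieldRange) • g := rfl
    rw [this, map_smul]; rfl

theorem fProp_of_ld (p : ℕ) [Fact p.Prime] (k : Type u) (ℓ : Type v) [Field k] [Field ℓ] [Algebra k ℓ]
    [CharP k p] [CharP ℓ p] (hld : LD p k ℓ) : FProp p (algebraMap k ℓ) := by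
  intro w hw
  let b := Module.Free.chooseBasis (frobenius k p).fieldRange k
  obtain ⟨i, hi⟩ : ∃ i, b.repr w i ≠ 0 := by
    by_contra hcon
    push Not at hcon
    apply hw
    apply b.repr.injective
    ext i
    simp [hcon i]
  have hli := hld _ b b.linearIndependent
  let c := Module.Basis.span hli
  obtain ⟨lam', hlam'⟩ := LinearMap.exists_extend (c.coord i)
  have hcb : ∀ j, lam' (algebraMap k ℓ (b j)) = c.coord i (c j) := by
    intro j
    rw [← hlam']
    simp only [LinearMap.comp_apply, Submodule.subtype_apply]
    rw [Module.Basis.span_apply]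
  obtain ⟨φA, hA1, hA2⟩ := exists_root_functional (b.coord i)
  obtain ⟨φB, hB1, hB2⟩ := exists_root_functional lam'
  refine ⟨φA, φB, fun a => ?_, hA2, hB2, ?_⟩
  · apply frobenius_inj ℓ p
    rw [frobenius_def, frobenius_def]
    rw [hB1, ← map_pow, hA1]
    have hmap : ∀ s : (frobenius k p).fieldRange, algebraMap k ℓ s ∈ (frobenius ℓ p).fieldRange := by
      rintro ⟨_, ⟨y, rfl⟩⟩
      exact ⟨algebraMap k ℓ y, by simp [frobenius_def]⟩
    have hsm : ∀ (s : (frobenius k p).fieldRange) (y : k), lam' (algebraMap k ℓ (s • y)) =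
        (⟨_, hmap s⟩ : (frobenius ℓ p).fieldRange) * lam' (algebraMap k ℓ y) := by
      intro s y
      rw [Subfield.smul_def, smul_eq_mul, map_mul, ← smul_eq_mul (a := (⟨_, hmap s⟩ : (frobenius ℓ p).fieldRange)), ← map_smul]
      rfl
    let Φ : k →+ ℓ := (algebraMap k ℓ : k →+ ℓ).comp
      (((frobenius k p).fieldRange.subtype : _ →+ k).comp (b.coord i : k →+ (frobenius k p).fieldRange))
    let Ψ : k →+ ℓ := ((frobenius ℓ p).fieldRange.subtype : _ →+ ℓ).comp
      ((lam' : ℓ →+ (frobenius ℓ p).fieldRange).comp (algebraMap k ℓ : k →+ ℓ))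
    change Φ a = Ψ a
    rw [← b.linearCombination_repr a, Finsupp.linearCombination_apply, Finsupp.sum, map_sum, map_sum]
    refine Finset.sum_congr rfl fun j _ => ?_
    change algebraMap k ℓ (b.coord i (b.repr a j • b j) : k) = (lam' (algebraMap k ℓ (b.repr a j • b j)) : ℓ)
    rw [hsm, hcb, map_smul, Module.Basis.coord_apply, Module.Basis.coord_apply, Module.Basis.repr_self, Module.Basis.repr_self]
    by_cases hij : i = j
    · subst hij; simp
    · simp [Finsupp.single_apply, Ne.symm hij]
  · intro h0
    have := hA1 w
    rw [h0, zero_pow (Fact.out : p.Prime).ne_zero] at this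
    exact hi (Subtype.ext this.symm)

section ps
open PowerSeries

theorem coeff_pow_char {p : ℕ} [hp : Fact p.Prime] {R : Type*} [CommRing R] [CharP R p] (f : PowerSeries R) (i : ℕ) :
    coeff i (f ^ p) = if p ∣ i then coeff (i / p) f ^ p else 0 := by
  have h1 : coeff i (f ^ p) = coeff i (((trunc (i + 1) f : Polynomial R) : PowerSeries R) ^ p) := by
    rw [← coeff_coe_trunc_of_lt (Nat.lt_succ_self i), ← trunc_trunc_pow, coeff_coe_trunc_of_lt (Nat.lt_succ_self i)]
  rw [h1, ← Polynomial.coe_pow, Polynomial.coeff_coe, ← Polynomial.map_frobenius_expand, Polynomial.coeff_map,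
    Polynomial.coeff_expand hp.out.pos, apply_ite (frobenius R p), map_zero, coeff_trunc,
    if_pos (Nat.lt_succ_of_le (Nat.div_le_self i p)), frobenius_def]

/-- The induced functional on power series. -/
theorem exists_functional_powerSeries {p : ℕ} [hp : Fact p.Prime] {R : Type*} [CommRing R] [CharP R p]
    (φ : R →+ R) (hφ : ∀ f g, φ (f ^ p * g) = f * φ g) (r : ℕ) (hr : r < p) :
    ∃ φ' : PowerSeries R →+ PowerSeries R, (∀ g n, coeff n (φ' g) = φ (coeff (p * n + r) g)) ∧
      ∀ f g, φ' (f ^ p * g) = f * φ' g := by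
  let φ' : PowerSeries R →+ PowerSeries R := AddMonoidHom.mk' (fun g => PowerSeries.mk fun n => φ (coeff (p * n + r) g))
    (by intro a b; ext n; simp)
  have h1 : ∀ g n, coeff n (φ' g) = φ (coeff (p * n + r) g) := fun g n => by simp [φ']
  refine ⟨φ', h1, fun f g => ?_⟩
  ext n
  rw [h1, coeff_mul, coeff_mul, map_sum]
  have hpos := hp.out.pos
  symm
  refine Finset.sum_of_injOn (fun x : ℕ × ℕ => (p * x.1, p * x.2 + r)) ?_ ?_ ?_ ?_
  · intro x _ y _ hxy
    simp only [Prod.mk.injEq] at hxy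
    have e1 := Nat.eq_of_mul_eq_mul_left hpos hxy.1
    have e2 := Nat.eq_of_mul_eq_mul_left hpos (Nat.add_right_cancel hxy.2)
    exact Prod.ext e1 e2
  · intro x hx
    have hx' := Finset.HasAntidiagonal.mem_antidiagonal.1 hx
    refine Finset.HasAntidiagonal.mem_antidiagonal.2 ?_
    simp only
    rw [← hx']; ring
  · intro y hy hy2
    have hy' := Finset.HasAntidiagonal.mem_antidiagonal.1 hy
    rw [coeff_pow_char]
    split_ifs with hd
    · exfalso
      apply hy2
      obtain ⟨a, ha⟩ := hd
      have han : a ≤ n := by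
        by_contra hcon
        push Not at hcon
        have : p * (n + 1) ≤ p * a := Nat.mul_le_mul_left p hcon
        rw [mul_add, mul_one] at this
        omega
      obtain ⟨c, rfl⟩ := Nat.exists_eq_add_of_le han
      refine ⟨(a, c), Finset.mem_coe.2 (Finset.HasAntidiagonal.mem_antidiagonal.2 rfl), ?_⟩
      refine Prod.ext ha.symm ?_
      simp only
      rw [mul_add] at hy'
      omega
    · rw [zero_mul, map_zero]
  · intro x _
    simp only
    rw [coeff_pow_char, if_pos (dvd_mul_right _ _), Nat.mul_div_cancel_left _ hpos, hφ, h1]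

theorem fProp_powerSeries {p : ℕ} {A0 : Type u} {B0 : Type v} [CommRing A0] [CommRing B0] {ψ : A0 →+* B0}
    (hp : p = 1 ∨ (p.Prime ∧ CharP A0 p ∧ CharP B0 p)) (h : FProp p ψ) : FProp p (PowerSeries.map ψ) := by
  rcases hp with rfl | ⟨hp, hA, hB⟩
  · exact fProp_one _
  have : Fact p.Prime := ⟨hp⟩
  intro w hw
  obtain ⟨N, hN⟩ : ∃ N, coeff N w ≠ 0 := by
    by_contra hcon
    push Not at hcon
    exact hw (by ext n; simp [hcon n])
  obtain ⟨φA, φB, h1, h2, h3, h4⟩ := h _ hN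
  obtain ⟨φA', hA1, hA2⟩ := exists_functional_powerSeries φA h2 (N % p) (Nat.mod_lt _ hp.pos)
  obtain ⟨φB', hB1, hB2⟩ := exists_functional_powerSeries φB h3 (N % p) (Nat.mod_lt _ hp.pos)
  refine ⟨φA', φB', fun a => ?_, hA2, hB2, fun h0 => h4 ?_⟩
  · ext n
    rw [coeff_map, hA1, hB1, coeff_map, h1]
  · have := hA1 w (N / p)
    rw [h0, map_zero, Nat.div_add_mod] at this
    exact this.symm

end ps

/-- A regular coefficient pair mapping to `A → R`. -/
structure Tower (p : ℕ) (A : Type u) (R : Type v) [CommRing A] [CommRing R] [IsLocalRing A] [IsLocalRing R]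
    [Algebra A R] (d : ℕ) (J : Ideal A) where
  /-- base -/
  A0 : Type u
  /-- big base -/
  B0 : Type v
  [cA : CommRing A0]
  [cB : CommRing B0]
  [dA : IsDomain A0]
  [dB : IsDomain B0]
  [nA : IsNoetherianRing A0]
  [nB : IsNoetherianRing B0]
  [lA : IsLocalRing A0]
  [lB : IsLocalRing B0]
  [aA : IsAdicComplete (maximalIdeal A0) A0]
  [aB : IsAdicComplete (maximalIdeal B0) B0]
  [iB : IsIntegrallyClosed B0]
  [iA : IsIntegrallyClosed A0]
  /-- map -/
  ψ : A0 →+* B0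
  /-- map -/
  α : A0 →+* A
  /-- map -/
  β : B0 →+* R
  comm : (algebraMap A R).comp α = β.comp ψ
  mapψ : (maximalIdeal A0).map ψ = maximalIdeal B0
  mapα : (maximalIdeal A0).map α = J
  gen : ∃ s : Finset A0, s.card ≤ d ∧ Ideal.span (s : Set A0) = maximalIdeal A0
  surα : Function.Surjective ((residue A).comp α)
  surβ : Function.Surjective ((residue R).comp β)
  char : p = 1 ∨ (p.Prime ∧ CharP A0 p ∧ CharP B0 p)
  fprop : FProp p ψ

theorem Tower.step {p : ℕ} {A : Type u} {R : Type v} [CommRing A] [CommRing R] [IsLocalRing A] [IsLocalRing R]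
    [Algebra A R] [IsNoetherianRing A] [IsNoetherianRing R] [IsAdicComplete (maximalIdeal A) A]
    [IsAdicComplete (maximalIdeal R) R] [IsLocalHom (algebraMap A R)] {d : ℕ} {J : Ideal A}
    (T : Tower p A R d J) (x : A) (hx : x ∈ maximalIdeal A) : Nonempty (Tower p A R (d + 1) (J ⊔ Ideal.span {x})) := by
  classical
  obtain ⟨A0, B0, ψ, α, β, comm, mapψ, mapα, ⟨s, hs, hs'⟩, surα, surβ, char, fprop⟩ := T
  obtain ⟨F, G, hFX, hFC, hGC, hFG⟩ := exists_eval_pair α x hx ψ (algebraMap A R) β comm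
  have : IsIntegrallyClosed (PowerSeries B0) := isIntegrallyClosed_powerSeries B0
  have : IsIntegrallyClosed (PowerSeries A0) := isIntegrallyClosed_powerSeries A0
  refine ⟨{
    A0 := PowerSeries A0
    B0 := PowerSeries B0
    ψ := PowerSeries.map ψ
    α := F
    β := G
    comm := hFG
    mapψ := map_maximalIdeal_powerSeries ψ mapψ
    mapα := ?_
    gen := ?_
    surα := ?_
    surβ := ?_
    char := ?_
    fprop := fProp_powerSeries char fprop }⟩
  · rw [maximalIdeal_powerSeries, Ideal.map_sup, Ideal.map_map, Ideal.map_span, Set.image_singleton, hFX]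
    have : F.comp PowerSeries.C = α := RingHom.ext hFC
    rw [this, mapα]
  · refine ⟨insert PowerSeries.X (s.image PowerSeries.C), ?_, ?_⟩
    · exact (Finset.card_insert_le _ _).trans (Nat.succ_le_succ (Finset.card_image_le.trans hs))
    · rw [maximalIdeal_powerSeries, ← hs', Finset.coe_insert, Finset.coe_image, Ideal.span_insert, Ideal.map_span, sup_comm]
  · intro z
    obtain ⟨a, ha⟩ := surα z
    exact ⟨PowerSeries.C a, by simpa [hFC] using ha⟩
  · intro z
    obtain ⟨a, ha⟩ := surβ z
    exact ⟨PowerSeries.C a, by simpa [hGC] using ha⟩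
  · rcases char with h | ⟨h1, h2, h3⟩
    · exact Or.inl h
    · exact Or.inr ⟨h1, charP_of_injective_ringHom PowerSeries.C_injective p, charP_of_injective_ringHom PowerSeries.C_injective p⟩

theorem Tower.steps {p : ℕ} {A : Type u} {R : Type v} [CommRing A] [CommRing R] [IsLocalRing A] [IsLocalRing R]
    [Algebra A R] [IsNoetherianRing A] [IsNoetherianRing R] [IsAdicComplete (maximalIdeal A) A]
    [IsAdicComplete (maximalIdeal R) R] [IsLocalHom (algebraMap A R)] {d : ℕ} {J : Ideal A}
    (T : Tower p A R d J) (s : Finset A) (hs : ∀ x ∈ s, x ∈ maximalIdeal A) :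
    Nonempty (Tower p A R (d + s.card) (J ⊔ Ideal.span (s : Set A))) := by
  classical
  induction s using Finset.induction_on with
  | empty => simpa using ⟨T⟩
  | insert x s hx ih =>
    obtain ⟨T'⟩ := ih fun y hy => hs y (Finset.mem_insert_of_mem hy)
    have := T'.step x (hs x (Finset.mem_insert_self _ _))
    rwa [Finset.card_insert_of_notMem hx, Finset.coe_insert, Ideal.span_insert, sup_comm (Ideal.span {x}), ← sup_assoc, ← add_assoc]

theorem exists_tower_base {Λ0 k0 : Type*} [CommRing Λ0] [Field k0] [Algebra Λ0 k0] {A : Type u} {R : Type v}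
    [CommRing A] [CommRing R] [IsLocalRing A] [IsLocalRing R] [IsDomain A]
    [Algebra A R] [IsNoetherianRing A] [IsNoetherianRing R] [IsAdicComplete (maximalIdeal A) A]
    [IsAdicComplete (maximalIdeal R) R] [IsLocalHom (algebraMap A R)] [Module.Flat A R]
    [Algebra Λ0 A] [Algebra k0 (ResidueField A)] [IsScalarTower Λ0 k0 (ResidueField A)]
    (π : Λ0) (hk : Function.Surjective (algebraMap Λ0 k0)) (hker : ∀ a, algebraMap Λ0 k0 a = 0 → π ∣ a)
    (hπ : algebraMap Λ0 k0 π = 0) (hsec : SectionProp k0 (ResidueField A))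
    (hsec' : SectionProp (ResidueField A) (ResidueField R)) (p d : ℕ) (hd : algebraMap Λ0 A π = 0 ∨ 1 ≤ d)
    (hp : p = 1 ∨ (∃ (_ : Fact p.Prime) (_ : CharP (ResidueField A) p) (_ : CharP (ResidueField R) p), 
      algebraMap Λ0 A π = 0 ∧ LD p (ResidueField A) (ResidueField R))) :
    Nonempty (Tower p A R d (Ideal.span {algebraMap Λ0 A π})) := by
  classical
  have hreg : algebraMap Λ0 A π = 0 ∨ ∀ x, algebraMap Λ0 A π * x = 0 → x = 0 := by
    by_cases h : algebraMap Λ0 A π = 0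
    · exact Or.inl h
    · exact Or.inr fun x hx => (mul_eq_zero.1 hx).resolve_left h
  have hπA : algebraMap Λ0 A π ∈ maximalIdeal A := by
    rw [← residue_eq_zero_iff]
    change algebraMap Λ0 (ResidueField A) π = 0
    rw [IsScalarTower.algebraMap_apply Λ0 k0 (ResidueField A), hπ, map_zero]
  obtain ⟨Λ, h1, h2, h3⟩ := exists_coeffRing (R := A) π hk hker hπ hsec hreg
  obtain ⟨hdom, hpir, hloc, hadic, hmax, hlh⟩ := coeffRing_props π hπA hreg Λ h1 h2 h3
  let π' : Λ := algebraMap Λ0 Λ π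
  have hπ'A : (π' : A) = algebraMap Λ0 A π := rfl
  have hπ'R : algebraMap Λ R π' = algebraMap A R (algebraMap Λ0 A π) := rfl
  have hist : @IsScalarTower Λ (ResidueField A) (ResidueField R) _ _ (ResidueField.algebra (R₀ := Λ) (R := R)).toSMul :=
    let _ := ResidueField.algebra (R₀ := Λ) (R := R)
    IsScalarTower.of_algebraMap_eq fun x => rfl
  have hkerΛ : ∀ a : Λ, algebraMap Λ (ResidueField A) a = 0 → π' ∣ a := by
    intro a ha
    obtain ⟨y, hy, hay⟩ := h2 a a.2 ((residue_eq_zero_iff _).1 ha)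
    exact ⟨⟨y, hy⟩, Subtype.ext hay⟩
  have hregR : algebraMap Λ R π' = 0 ∨ ∀ x, algebraMap Λ R π' * x = 0 → x = 0 := by
    by_cases h : algebraMap Λ0 A π = 0
    · left; rw [hπ'R, h, map_zero]
    · right
      intro x hx
      rw [hπ'R, ← Algebra.smul_def] at hx
      exact (Module.Flat.isSMulRegular_of_isRegular (M := R) (IsRegular.of_ne_zero h)) (by simpa using hx)
  have hsurΛ : Function.Surjective (algebraMap Λ (ResidueField A)) := by
    intro z
    obtain ⟨x, hx, hxz⟩ := h1 z
    exact ⟨⟨x, hx⟩, hxz⟩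
  have hπ'k : algebraMap Λ (ResidueField A) π' = 0 := (residue_eq_zero_iff _).2 hπA
  have hπR : algebraMap Λ R π' ∈ maximalIdeal R := by
    rw [hπ'R]
    exact map_nonunit (algebraMap A R) _ hπA
  obtain ⟨Λ', h1', h2', h3'⟩ := exists_coeffRing (R := R) π' hsurΛ hkerΛ hπ'k hsec' hregR
  obtain ⟨hdom', hpir', hloc', hadic', hmax', hlh'⟩ := coeffRing_props π' hπR hregR Λ' h1' h2' h3'
  have hsurΛ' : Function.Surjective ((residue R).comp Λ'.val.toRingHom) := by
    intro z
    obtain ⟨x, hx, hxz⟩ := h1' z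
    exact ⟨⟨x, hx⟩, hxz⟩
  have hpf : (p = 1 ∨ (p.Prime ∧ CharP Λ p ∧ CharP Λ' p)) ∧ FProp p (algebraMap Λ Λ') := by
    rcases hp with rfl | ⟨hp1, hp2, hp3, hp4, hp5⟩
    · exact ⟨Or.inl rfl, fProp_one _⟩
    · have hbij : Function.Bijective (algebraMap Λ (ResidueField A)) := by
        refine ⟨(injective_iff_map_eq_zero _).2 fun a ha => ?_, hsurΛ⟩
        have := hkerΛ a ha
        have h0 : π' = 0 := Subtype.ext hp4
        rwa [h0, zero_dvd_iff] at this
      have hbij' : Function.Bijective ((residue R).comp Λ'.val.toRingHom) := by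
        refine ⟨(injective_iff_map_eq_zero _).2 fun a ha => ?_, hsurΛ'⟩
        obtain ⟨y, hy, hay⟩ := h2' a a.2 ((residue_eq_zero_iff _).1 ha)
        rw [hπ'R, hp4, map_zero, zero_mul] at hay
        exact Subtype.ext hay
      refine ⟨Or.inr ⟨hp1.out, ?_, ?_⟩,
        FProp.of_equiv (RingEquiv.ofBijective _ hbij) (RingEquiv.ofBijective _ hbij') (fun a => rfl)
          (fProp_of_ld p (ResidueField A) (ResidueField R) hp5)⟩
      · exact (RingHom.charP_iff _ hbij.1 p).2 hp2
      · exact (RingHom.charP_iff _ hbij'.1 p).2 hp3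
  refine ⟨{
    A0 := Λ
    B0 := Λ'
    ψ := algebraMap Λ Λ'
    α := Λ.val.toRingHom
    β := Λ'.val.toRingHom
    comm := rfl
    mapψ := ?_
    mapα := ?_
    gen := ?_
    surα := hsurΛ
    surβ := hsurΛ'
    char := hpf.1
    fprop := hpf.2 }⟩
  · rw [hmax, hmax', Ideal.map_span, Set.image_singleton]
  · rw [hmax, Ideal.map_span, Set.image_singleton]; rfl
  · rcases hd with hd | hd
    · refine ⟨∅, by simp, ?_⟩
      rw [hmax]
      have h0 : π' = 0 := Subtype.ext hd
      change _ = Ideal.span {π'}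
      rw [h0, Finset.coe_empty, Ideal.span_empty, Ideal.span_singleton_eq_bot.2 rfl]
    · exact ⟨{π'}, by simpa using hd, by rw [hmax]; simp [π']⟩

theorem exists_tower_aux (A : Type u) (R : Type v)
    [CommRing A] [CommRing R] [IsLocalRing A] [IsLocalRing R] [IsDomain A]
    [Algebra A R] [IsNoetherianRing A] [IsNoetherianRing R] [IsAdicComplete (maximalIdeal A) A]
    [IsAdicComplete (maximalIdeal R) R] [IsLocalHom (algebraMap A R)] [Module.Flat A R]
    (hred : ∀ (L : Type u) [Field L] [Algebra (ResidueField A) L] [FiniteDimensional (ResidueField A) L],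
      IsReduced (ResidueField R ⊗[ResidueField A] L)) :
    ∃ (p d : ℕ) (π : A), ExpChar A p ∧ π ∈ maximalIdeal A ∧ ((π = 0 ∧ d = 0) ∨ (π ≠ 0 ∧ d = 1)) ∧
      Nonempty (Tower p A R d (Ideal.span {π})) := by
  obtain ⟨p, hp⟩ := CharP.exists (ResidueField A)
  have hpR : CharP (ResidueField R) p :=
    charP_of_injective_ringHom (algebraMap (ResidueField A) (ResidueField R)).injective p
  rcases CharP.char_is_prime_or_zero (ResidueField A) p with hpp | rfl
  · have : Fact p.Prime := ⟨hpp⟩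
    have hld : LD p (ResidueField A) (ResidueField R) := ld_of_isReduced p _ _ hred
    have hsec' : SectionProp (ResidueField A) (ResidueField R) := sectionProp_of_ld p _ _ hld
    have hpm : ((p : ℕ) : A) ∈ maximalIdeal A := by
      rw [← residue_eq_zero_iff, map_natCast, CharP.cast_eq_zero]
    by_cases hpA : ((p : ℕ) : A) = 0
    · have : CharP A p := by
        obtain ⟨q, hq⟩ := CharP.exists A
        have h1 : q ∣ p := (CharP.cast_eq_zero_iff A q p).1 hpA
        rcases (Nat.dvd_prime hpp).1 h1 with rfl | rfl
        · have := (CharP.cast_eq_zero_iff A 1 1).2 dvd_rfl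
          rw [Nat.cast_one] at this
          exact absurd this one_ne_zero
        · exact hq
      let _ : Algebra (ZMod p) A := ZMod.algebra A p
      have hsec : SectionProp (ZMod p) (ResidueField A) := sectionProp_of_ld p _ _ (ld_zmod p _)
      have := exists_tower_base (Λ0 := ZMod p) (k0 := ZMod p) (A := A) (R := R) 0 Function.surjective_id
        (fun a ha => by rw [show a = 0 from ha]) (map_zero _) hsec hsec' p 0 (Or.inl (map_zero _))
        (Or.inr ⟨inferInstance, inferInstance, inferInstance, map_zero _, hld⟩)
      refine ⟨p, 0, 0, ExpChar.prime hpp, zero_mem _, Or.inl ⟨rfl, rfl⟩, ?_⟩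
      rwa [map_zero] at this
    · let _ : Algebra (ZMod p) (ResidueField A) := ZMod.algebra _ p
      have hsec : SectionProp (ZMod p) (ResidueField A) := sectionProp_of_ld p _ _ (ld_zmod p _)
      have hist : @IsScalarTower ℤ (ZMod p) (ResidueField A) _ _ (ResidueField.algebra (R₀ := ℤ) (R := A)).toSMul :=
        let _ := ResidueField.algebra (R₀ := ℤ) (R := A)
        IsScalarTower.of_algebraMap_eq fun x => by simp
      have := exists_tower_base (Λ0 := ℤ) (k0 := ZMod p) (A := A) (R := R) (p : ℤ) ZMod.intCast_surjective
        (fun a ha => (ZMod.intCast_zmod_eq_zero_iff_dvd a p).1 ha) (by simp) hsec hsec' 1 1 (Or.inr le_rfl)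
        (Or.inl rfl)
      have hcz : CharZero A := by
        obtain ⟨q, hq⟩ := CharP.exists A
        rcases CharP.char_is_prime_or_zero A q with hqq | rfl
        · exfalso
          have h1 : ((q : ℕ) : ResidueField A) = 0 := by
            rw [← map_natCast (residue A), CharP.cast_eq_zero, map_zero]
          have h2 := (CharP.cast_eq_zero_iff (ResidueField A) p q).1 h1
          rw [(Nat.prime_dvd_prime_iff_eq hpp hqq).1 h2, CharP.cast_eq_zero] at hpA
          exact hpA rfl
        · exact CharP.charP_to_charZero A
      refine ⟨1, 1, p, ExpChar.zero, hpm, Or.inr ⟨hpA, rfl⟩, ?_⟩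
      simpa using this
  · have : CharZero (ResidueField A) := CharP.charP_to_charZero _
    have hu : ∀ y : nonZeroDivisors ℤ, IsUnit (Int.castRingHom A y) := by
      intro y
      by_contra h
      have h1 : residue A (Int.castRingHom A y) = 0 := (residue_eq_zero_iff _).2 h
      rw [eq_intCast, map_intCast, Int.cast_eq_zero] at h1
      exact nonZeroDivisors.coe_ne_zero y h1
    let _ : Algebra ℚ A := (IsLocalization.lift (M := nonZeroDivisors ℤ) (S := ℚ) hu).toAlgebra
    let _ : Algebra ℚ (ResidueField A) := ResidueField.algebra (R₀ := ℚ) (R := A)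
    have hsec : SectionProp ℚ (ResidueField A) := sectionProp_of_charZero _ _
    have hsec' : SectionProp (ResidueField A) (ResidueField R) := sectionProp_of_charZero _ _
    have := exists_tower_base (Λ0 := ℚ) (k0 := ℚ) (A := A) (R := R) 0 Function.surjective_id
        (fun a ha => by rw [show a = 0 from ha]) (map_zero _) hsec hsec' 1 0 (Or.inl (map_zero _))
        (Or.inl rfl)
    have hcz : CharZero A := charZero_of_injective_ringHom (algebraMap ℚ A).injective
    refine ⟨1, 0, 0, ExpChar.zero, zero_mem _, Or.inl ⟨rfl, rfl⟩, ?_⟩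
    rwa [map_zero] at this

theorem exists_parameters (A : Type*) [CommRing A] [IsLocalRing A] [IsNoetherianRing A] (π : A)
    (hπ : π ∈ maximalIdeal A) : ∃ s : Finset A, (∀ x ∈ s, x ∈ maximalIdeal A) ∧
      ((s.card : ℕ) : WithBot ℕ∞) ≤ ringKrullDim (A ⧸ Ideal.span {π}) ∧
      ∃ n, maximalIdeal A ^ n ≤ Ideal.span {π} ⊔ Ideal.span (s : Set A) := by
  classical
  have hne : Ideal.span {π} ≠ ⊤ := fun h => (Ideal.span_singleton_eq_top.1 h |> fun hu => hπ hu)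
  have : Nontrivial (A ⧸ Ideal.span {π}) := Ideal.Quotient.nontrivial_iff.2 hne
  have : IsLocalRing (A ⧸ Ideal.span {π}) := .of_surjective' _ Ideal.Quotient.mk_surjective
  obtain ⟨s, hs, hcard⟩ := Ideal.exists_finset_card_eq_height_of_isNoetherianRing (maximalIdeal (A ⧸ Ideal.span {π}))
  set f := Ideal.Quotient.mk (Ideal.span {π}) with hf
  have hsurj : Function.Surjective f := Ideal.Quotient.mk_surjective
  choose g hg using hsurj
  have hsurj : Function.Surjective f := Ideal.Quotient.mk_surjective
  have hlh : IsLocalHom f := .of_surjective f hsurj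
  have hrad : maximalIdeal (A ⧸ Ideal.span {π}) ≤ (Ideal.span (s : Set (A ⧸ Ideal.span {π}))).radical := by
    rw [Ideal.radical_eq_sInf]
    refine le_sInf fun J hJ => hs.2 ⟨hJ.2, hJ.1⟩ (le_maximalIdeal hJ.2.ne_top)
  have hmap : (Ideal.span (s.image g : Set A)).map f = Ideal.span (s : Set (A ⧸ Ideal.span {π})) := by
    rw [Ideal.map_span, Finset.coe_image, Set.image_image]
    simp [hg]
  refine ⟨s.image g, ?_, ?_, ?_⟩
  · intro x hx
    obtain ⟨y, hy, rfl⟩ := Finset.mem_image.1 hx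
    have : y ∈ maximalIdeal (A ⧸ Ideal.span {π}) := hs.1.2 (Ideal.subset_span hy)
    intro hu
    exact this (by rw [← hg y]; exact hu.map f)
  · rw [← maximalIdeal_height_eq_ringKrullDim, ← hcard]
    exact_mod_cast Finset.card_image_le
  · apply Ideal.exists_pow_le_of_le_radical_of_fg_radical
    · intro x hx
      have h1 : f x ∈ maximalIdeal (A ⧸ Ideal.span {π}) := map_nonunit f x hx
      obtain ⟨n, hn⟩ := hrad h1
      refine ⟨n, ?_⟩
      rw [← map_pow, ← hmap, ← Ideal.mem_comap, Ideal.comap_map_of_surjective f hsurj] at hn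
      have : Ideal.comap f ⊥ = Ideal.span {π} := Ideal.mk_ker
      rwa [this, sup_comm] at hn
    · exact IsNoetherian.noetherian _

theorem exists_tower (A : Type u) (R : Type v)
    [CommRing A] [CommRing R] [IsLocalRing A] [IsLocalRing R] [IsDomain A]
    [Algebra A R] [IsNoetherianRing A] [IsNoetherianRing R] [IsAdicComplete (maximalIdeal A) A]
    [IsAdicComplete (maximalIdeal R) R] [IsLocalHom (algebraMap A R)] [Module.Flat A R]
    (hred : ∀ (L : Type u) [Field L] [Algebra (ResidueField A) L] [FiniteDimensional (ResidueField A) L],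
      IsReduced (ResidueField R ⊗[ResidueField A] L)) :
    ∃ (p d : ℕ) (J : Ideal A), ExpChar A p ∧ (∃ n, maximalIdeal A ^ n ≤ J) ∧ (d : WithBot ℕ∞) ≤ ringKrullDim A ∧
      Nonempty (Tower p A R d J) := by
  obtain ⟨p, d, π, hexp, hπ, hd, ⟨T⟩⟩ := exists_tower_aux A R hred
  obtain ⟨s, hs, hcard, hn⟩ := exists_parameters A π hπ
  refine ⟨p, d + s.card, _, hexp, hn, ?_, T.steps s hs⟩
  rcases hd with ⟨rfl, rfl⟩ | ⟨h1, rfl⟩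
  · rw [zero_add]
    exact hcard.trans (ringKrullDim_le_of_surjective _ Ideal.Quotient.mk_surjective)
  · refine le_trans ?_ (ringKrullDim_quotient_succ_le_of_nonZeroDivisor (mem_nonZeroDivisors_of_ne_zero h1))
    rw [add_comm, Nat.cast_add, Nat.cast_one]
    gcongr

theorem isPrecomplete_pi {R : Type*} [CommRing R] (I : Ideal R) [IsPrecomplete I R] (r : ℕ) :
    IsPrecomplete I (Fin r → R) := by
  classical
  have hmem : ∀ n (x : Fin r → R), x ∈ (I ^ n • ⊤ : Submodule R (Fin r → R)) ↔ ∀ i, x i ∈ I ^ n := by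
    intro n x
    constructor
    · intro hx i
      refine Submodule.smul_induction_on (p := fun x => x i ∈ I ^ n) hx (fun a ha y _ => ?_) (fun y z hy hz => ?_)
      · exact Ideal.mul_mem_right _ _ ha
      · exact add_mem hy hz
    · intro hx
      rw [pi_eq_sum_univ x]
      exact Submodule.sum_mem _ fun i _ => Submodule.smul_mem_smul (hx i) trivial
  refine ⟨fun f hf => ?_⟩
  have hex : ∀ i, ∃ L, ∀ n, f n i - L ∈ I ^ n := fun i => exists_limit I (fun n => f n i) fun n => by
    have := (hf (Nat.le_succ n))
    rw [SModEq.sub_mem, hmem] at this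
    have := this i
    rw [← neg_mem_iff]
    simpa using this
  choose L hL using hex
  refine ⟨L, fun n => ?_⟩
  rw [SModEq.sub_mem, hmem]
  exact fun i => hL i n

theorem finite_of_complete {A0 A : Type*} [CommRing A0] [IsLocalRing A0] [IsAdicComplete (maximalIdeal A0) A0]
    [CommRing A] [IsLocalRing A] [IsNoetherianRing A] [Algebra A0 A]
    (hloc : (maximalIdeal A0).map (algebraMap A0 A) ≤ maximalIdeal A)
    {n : ℕ} (hn : maximalIdeal A ^ n ≤ (maximalIdeal A0).map (algebraMap A0 A))
    (hsur : Function.Surjective ((residue A).comp (algebraMap A0 A))) : Module.Finite A0 A := by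
  classical
  have hdec : ∀ a : A, ∃ a0 : A0, a - algebraMap A0 A a0 ∈ maximalIdeal A := by
    intro a
    obtain ⟨a0, h⟩ := hsur (residue A a)
    refine ⟨a0, ?_⟩
    rw [← residue_eq_zero_iff, map_sub, sub_eq_zero]
    exact h.symm
  have key : ∀ i : ℕ, ∃ N : Submodule A0 A, N.FG ∧ ∀ a : A, ∃ x ∈ N, a - x ∈ maximalIdeal A ^ i := by
    intro i
    induction i with
    | zero => exact ⟨⊥, Submodule.fg_bot, fun a => ⟨0, zero_mem _, by simp⟩⟩
    | succ i ih =>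
      obtain ⟨N, hN, hN'⟩ := ih
      obtain ⟨s, hs⟩ := (IsNoetherian.noetherian (maximalIdeal A ^ i) : (maximalIdeal A ^ i).FG)
      refine ⟨N ⊔ Submodule.span A0 (s : Set A), hN.sup ⟨s, rfl⟩, ?_⟩
      have h2 : ∀ b ∈ maximalIdeal A ^ i, ∃ x ∈ Submodule.span A0 (s : Set A), b - x ∈ maximalIdeal A ^ (i + 1) := by
        intro b hb
        rw [← hs] at hb
        induction hb using Submodule.span_induction with
        | mem y hy => exact ⟨y, Submodule.subset_span hy, by simp⟩
        | zero => exact ⟨0, zero_mem _, by simp⟩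
        | add y z hy hz ihy ihz =>
          obtain ⟨y', hy1, hy2⟩ := ihy
          obtain ⟨z', hz1, hz2⟩ := ihz
          refine ⟨y' + z', add_mem hy1 hz1, ?_⟩
          rw [add_sub_add_comm]
          exact add_mem hy2 hz2
        | smul c y hy ihy =>
          obtain ⟨y', hy1, hy2⟩ := ihy
          obtain ⟨c0, hc0⟩ := hdec c
          refine ⟨c0 • y', Submodule.smul_mem _ _ hy1, ?_⟩
          have e : c • y - c0 • y' = (c - algebraMap A0 A c0) * y + algebraMap A0 A c0 * (y - y') := by
            rw [smul_eq_mul, Algebra.smul_def]; ring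
          rw [e]
          refine add_mem ?_ (Ideal.mul_mem_left _ _ hy2)
          rw [pow_succ']
          exact Ideal.mul_mem_mul hc0 (by rw [← hs]; exact hy)
      intro a
      obtain ⟨x, hx, hax⟩ := hN' a
      obtain ⟨x', hx', hax'⟩ := h2 _ hax
      exact ⟨x + x', add_mem (Submodule.mem_sup_left hx) (Submodule.mem_sup_right hx'), by rwa [← sub_sub]⟩
  obtain ⟨N, hN, hN'⟩ := key n
  obtain ⟨r, g, hg⟩ := Submodule.fg_iff_exists_fin_generating_family.1 hN
  let f : (Fin r → A0) →ₗ[A0] A := Fintype.linearCombination A0 g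
  have : IsPrecomplete (maximalIdeal A0) (Fin r → A0) := isPrecomplete_pi _ r
  have hsm : ∀ i, ∀ x ∈ (maximalIdeal A0 ^ i • ⊤ : Submodule A0 A), x ∈ (maximalIdeal A0).map (algebraMap A0 A) ^ i := by
    intro i x hx
    rw [← Ideal.map_pow]
    refine Submodule.smul_induction_on hx (fun a ha b _ => ?_) (fun _ _ => add_mem)
    rw [Algebra.smul_def]
    exact Ideal.mul_mem_right _ _ (Ideal.mem_map_of_mem _ ha)
  have : IsHausdorff (maximalIdeal A0) A := by
    refine ⟨fun x hx => ?_⟩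
    have h3 : x ∈ (⊥ : Ideal A) := mem_of_forall_mem_sup_pow (⊥ : Ideal A) (fun l => Ideal.mem_sup_right (by
      have h1 := hx l
      rw [SModEq.zero] at h1
      exact Ideal.pow_right_mono hloc l (hsm l x h1)))
    simpa using h3
  refine Module.Finite.of_surjective f (surjective_of_mkQ_comp_surjective (I := maximalIdeal A0) ?_)
  intro y
  obtain ⟨a, rfl⟩ := Submodule.mkQ_surjective _ y
  obtain ⟨x, hx, hax⟩ := hN' a
  rw [← hg] at hx
  obtain ⟨c, hc⟩ := (Submodule.mem_span_range_iff_exists_fun A0).1 hx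
  refine ⟨c, ?_⟩
  have hfc : f c = x := by simp [f, Fintype.linearCombination_apply, hc]
  rw [LinearMap.comp_apply, hfc, ← sub_eq_zero, ← map_sub, Submodule.mkQ_apply, Submodule.Quotient.mk_eq_zero,
    ← neg_mem_iff, neg_sub]
  have h4 := hn hax
  rw [Ideal.smul_top_eq_map]
  exact h4

theorem injective_of_dim {A0 A : Type*} [CommRing A0] [IsLocalRing A0] [IsDomain A0] [IsNoetherianRing A0]
    [CommRing A] [Algebra A0 A] [Module.Finite A0 A] (d : ℕ)
    (hgen : ∃ s : Finset A0, s.card ≤ d ∧ Ideal.span (s : Set A0) = maximalIdeal A0)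
    (hd : (d : WithBot ℕ∞) ≤ ringKrullDim A) : Function.Injective (algebraMap A0 A) := by
  rw [injective_iff_map_eq_zero]
  intro c hc
  by_contra hc0
  have h1 := ringKrullDim_quotient_succ_le_of_nonZeroDivisor (mem_nonZeroDivisors_of_ne_zero hc0)
  obtain ⟨s, hs, hs'⟩ := hgen
  have h2 : ringKrullDim A0 ≤ d := by
    rw [← maximalIdeal_height_eq_ringKrullDim]
    have := Ideal.height_le_card_of_mem_minimalPrimes_span_finset (p := maximalIdeal A0) (s := s)
      (by rw [hs']; exact ⟨⟨inferInstance, le_rfl⟩, fun _ h _ => h.2⟩)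
    exact_mod_cast this.trans (by exact_mod_cast hs)
  let f : A0 ⧸ Ideal.span {c} →+* A := Ideal.Quotient.lift _ (algebraMap A0 A) fun a ha => by
    obtain ⟨b, rfl⟩ := Ideal.mem_span_singleton'.1 ha
    rw [map_mul, hc, mul_zero]
  let _ : Algebra (A0 ⧸ Ideal.span {c}) A := f.toAlgebra
  have : IsScalarTower A0 (A0 ⧸ Ideal.span {c}) A := IsScalarTower.of_algebraMap_eq fun x => rfl
  have : Module.Finite (A0 ⧸ Ideal.span {c}) A := Module.Finite.of_restrictScalars_finite A0 _ _
  have h3 : ringKrullDim A ≤ ringKrullDim (A0 ⧸ Ideal.span {c}) := by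
    refine Order.krullDim_le_of_strictMono (PrimeSpectrum.comap (algebraMap (A0 ⧸ Ideal.span {c}) A)) ?_
    intro P Q hPQ
    exact Ideal.IsIntegral.comap_lt_comap (show P.asIdeal < Q.asIdeal from hPQ)
  have h4 : ((d : WithBot ℕ∞)) + 1 ≤ d := by
    calc ((d : WithBot ℕ∞)) + 1 ≤ ringKrullDim (A0 ⧸ Ideal.span {c}) + 1 := by gcongr; exact hd.trans h3
      _ ≤ _ := h1.trans h2
  have h5 : d + 1 ≤ d := by exact_mod_cast h4
  omega

theorem ker_le_mul {A C R : Type*} [CommRing A] [CommRing C] [CommRing R] [Algebra A C] [Algebra A R] [Module.Flat A R]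
    (φ : C →ₐ[A] R) (hφ : Function.Surjective φ) (m : Ideal A) (h : RingHom.ker φ ≤ m.map (algebraMap A C)) :
    RingHom.ker φ ≤ m.map (algebraMap A C) * RingHom.ker φ := by
  intro x hx
  have hx2 := h hx
  change x ∈ Submodule.span C _ at hx2
  rw [Submodule.mem_span_set'] at hx2
  obtain ⟨n, f, g, hfg⟩ := hx2
  have hg : ∀ i, ∃ a ∈ m, algebraMap A C a = g i := fun i => (g i).2
  choose a ha hag using hg
  have h0 : ∑ i, a i • φ (f i) = 0 := by
    rw [← show φ x = 0 from hx, ← hfg, map_sum]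
    refine Finset.sum_congr rfl fun i _ => ?_
    rw [← hag, smul_eq_mul, mul_comm, ← Algebra.smul_def, map_smul]
  obtain ⟨k, b, y, h1, h2⟩ := Module.Flat.isTrivialRelation_of_sum_smul_eq_zero (R := A) (M := R) (f := a) (x := fun i => φ (f i)) h0
  choose d hd using fun j => hφ (y j)
  have hx3 : x = ∑ i, algebraMap A C (a i) * (f i - ∑ j, b i j • d j) := by
    have e : ∑ i, algebraMap A C (a i) * ∑ j, b i j • d j = 0 := by
      simp_rw [Finset.mul_sum]
      rw [Finset.sum_comm]
      refine Finset.sum_eq_zero fun j _ => ?_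
      have : ∑ i, algebraMap A C (a i) * b i j • d j = algebraMap A C (∑ i, a i * b i j) * d j := by
        rw [map_sum, Finset.sum_mul]
        refine Finset.sum_congr rfl fun i _ => ?_
        rw [Algebra.smul_def, map_mul, mul_assoc]
      rw [this, h2, map_zero, zero_mul]
    simp_rw [mul_sub]
    rw [Finset.sum_sub_distrib, e, sub_zero, ← hfg]
    exact Finset.sum_congr rfl fun i _ => by rw [hag, smul_eq_mul, mul_comm]
  rw [hx3]
  refine Ideal.sum_mem _ fun i _ => Ideal.mul_mem_mul (Ideal.mem_map_of_mem _ (ha i)) ?_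
  rw [RingHom.mem_ker, map_sub, show φ (f i) = _ from h1 i, map_sum, sub_eq_zero]
  exact Finset.sum_congr rfl fun j _ => by rw [map_smul, hd]

section
variable {A0 B0 A R : Type*} [CommRing A0] [CommRing B0] [CommRing A] [CommRing R]
  [Algebra A0 A] [Algebra A0 B0] [Algebra B0 R] [Algebra A R] [Algebra A0 R] [IsScalarTower A0 A R] [IsScalarTower A0 B0 R]
  [IsLocalRing A0] [IsLocalRing B0] [IsLocalRing A] [IsLocalRing R]
  [IsNoetherianRing B0] [IsNoetherianRing A] [Module.Finite A0 A] [Module.Finite B0 R] [Module.Flat A R]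

/-- the comparison map -/
noncomputable def compMap (A0 B0 A R : Type*) [CommRing A0] [CommRing B0] [CommRing A] [CommRing R]
    [Algebra A0 A] [Algebra A0 B0] [Algebra B0 R] [Algebra A R] [Algebra A0 R] [IsScalarTower A0 A R]
    [IsScalarTower A0 B0 R] : A ⊗[A0] B0 →ₐ[A0] R :=
  Algebra.TensorProduct.productMap (IsScalarTower.toAlgHom A0 A R) (IsScalarTower.toAlgHom A0 B0 R)

theorem compMap_tmul {A0 B0 A R : Type*} [CommRing A0] [CommRing B0] [CommRing A] [CommRing R]
    [Algebra A0 A] [Algebra A0 B0] [Algebra B0 R] [Algebra A R] [Algebra A0 R] [IsScalarTower A0 A R]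
    [IsScalarTower A0 B0 R] (a : A) (b : B0) : compMap A0 B0 A R (a ⊗ₜ b) = algebraMap A R a * algebraMap B0 R b := by
  simp [compMap]

theorem compMap_surjective (hmax : maximalIdeal R = (maximalIdeal A).map (algebraMap A R))
    (hψ : (maximalIdeal A0).map (algebraMap A0 B0) = maximalIdeal B0)
    {n : ℕ} (hn : maximalIdeal A ^ n ≤ (maximalIdeal A0).map (algebraMap A0 A))
    (hβ : Function.Surjective ((residue R).comp (algebraMap B0 R))) : Function.Surjective (compMap A0 B0 A R) := by
  set C := (compMap A0 B0 A R).range with hC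
  have hA : ∀ a, algebraMap A R a ∈ C := fun a => ⟨a ⊗ₜ 1, by change compMap A0 B0 A R _ = _; rw [compMap_tmul, map_one, mul_one]⟩
  have hB : ∀ a, algebraMap B0 R a ∈ C := fun a => ⟨1 ⊗ₜ a, by change compMap A0 B0 A R _ = _; rw [compMap_tmul, map_one, one_mul]⟩
  have key : ∀ (i : ℕ) (r : R), ∃ c ∈ C, r - c ∈ (maximalIdeal A ^ i).map (algebraMap A R) := by
    intro i
    induction i with
    | zero => intro r; exact ⟨0, zero_mem _, by simp [Ideal.one_eq_top, Ideal.map_top]⟩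
    | succ i ih =>
      intro r
      have h2 : ∀ x ∈ (maximalIdeal A ^ i).map (algebraMap A R), ∃ c ∈ C, x - c ∈ (maximalIdeal A ^ (i+1)).map (algebraMap A R) := by
        intro x hx
        rw [Ideal.map] at hx
        induction hx using Submodule.span_induction with
        | mem y hy => obtain ⟨a, -, rfl⟩ := hy; exact ⟨_, hA a, by simp⟩
        | zero => exact ⟨0, zero_mem _, by simp⟩
        | add y z hy hz ihy ihz =>
          obtain ⟨y', hy1, hy2⟩ := ihy
          obtain ⟨z', hz1, hz2⟩ := ihz
          refine ⟨y' + z', add_mem hy1 hz1, ?_⟩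
          rw [add_sub_add_comm]
          exact add_mem hy2 hz2
        | smul c y hy ihy =>
          obtain ⟨y', hy1, hy2⟩ := ihy
          obtain ⟨c0, hc0⟩ := hβ (residue R c)
          have hc0' : c - algebraMap B0 R c0 ∈ maximalIdeal R := by
            rw [← residue_eq_zero_iff, map_sub, sub_eq_zero]
            exact hc0.symm
          refine ⟨algebraMap B0 R c0 * y', mul_mem (hB _) hy1, ?_⟩
          have e : c • y - algebraMap B0 R c0 * y' = (c - algebraMap B0 R c0) * y + algebraMap B0 R c0 * (y - y') := by
            rw [smul_eq_mul]; ring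
          rw [e]
          refine add_mem ?_ (Ideal.mul_mem_left _ _ hy2)
          rw [pow_succ', Ideal.map_mul, ← hmax]
          exact Ideal.mul_mem_mul hc0' hy
      obtain ⟨c, hc, h3⟩ := ih r
      obtain ⟨c', hc', h4⟩ := h2 _ h3
      exact ⟨c + c', add_mem hc hc', by rwa [← sub_sub]⟩
  let N : Submodule B0 R :=
    { carrier := C
      add_mem' := add_mem
      zero_mem' := zero_mem C
      smul_mem' := fun b x hx => by rw [Algebra.smul_def]; exact mul_mem (hB b) hx }
  have hN : (⊤ : Submodule B0 R) ≤ N := by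
    refine Submodule.le_of_le_smul_of_le_jacobson_bot (I := maximalIdeal B0) Module.Finite.fg_top
      (maximalIdeal_le_jacobson _) ?_
    intro r _
    obtain ⟨c, hc, h⟩ := key n r
    refine Submodule.mem_sup.2 ⟨c, hc, r - c, ?_, by ring⟩
    rw [Ideal.smul_top_eq_map]
    change r - c ∈ (maximalIdeal B0).map (algebraMap B0 R)
    rw [← hψ, Ideal.map_map, ← IsScalarTower.algebraMap_eq, IsScalarTower.algebraMap_eq A0 A R, ← Ideal.map_map]
    exact Ideal.map_mono hn h
  exact fun r => hN (Submodule.mem_top (x := r))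

theorem compMap_injective [IsLocalHom (algebraMap B0 R)] (hmax : maximalIdeal R = (maximalIdeal A).map (algebraMap A R))
    (hloc : (maximalIdeal A0).map (algebraMap A0 A) ≤ maximalIdeal A)
    (hψ : (maximalIdeal A0).map (algebraMap A0 B0) = maximalIdeal B0)
    {n : ℕ} (hn : maximalIdeal A ^ n ≤ (maximalIdeal A0).map (algebraMap A0 A))
    (hα : Function.Surjective ((residue A).comp (algebraMap A0 A)))
    (hsurj : Function.Surjective (compMap A0 B0 A R)) : Function.Injective (compMap A0 B0 A R) := by
  set I := RingHom.ker (compMap A0 B0 A R) with hI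
  set mC := (maximalIdeal A).map (algebraMap A (A ⊗[A0] B0)) with hmC
  have hdec : ∀ c : A ⊗[A0] B0, ∃ b : B0, c - 1 ⊗ₜ b ∈ mC := by
    intro c
    induction c using TensorProduct.induction_on with
    | zero => exact ⟨0, by simp⟩
    | add x y hx hy =>
      obtain ⟨x', hx⟩ := hx
      obtain ⟨y', hy⟩ := hy
      refine ⟨x' + y', ?_⟩
      rw [tmul_add, add_sub_add_comm]
      exact add_mem hx hy
    | tmul a b =>
      obtain ⟨a0, ha0⟩ := hα (residue A a)
      have ha0' : a - algebraMap A0 A a0 ∈ maximalIdeal A := by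
        rw [← residue_eq_zero_iff, map_sub, sub_eq_zero]
        exact ha0.symm
      refine ⟨a0 • b, ?_⟩
      have : a ⊗ₜ[A0] b - 1 ⊗ₜ[A0] (a0 • b) = ((a - algebraMap A0 A a0) ⊗ₜ[A0] 1) * ((1 : A) ⊗ₜ[A0] b) := by
        rw [Algebra.TensorProduct.tmul_mul_tmul, mul_one, one_mul, sub_tmul, ← smul_tmul, Algebra.algebraMap_eq_smul_one]
      rw [this]
      exact Ideal.mul_mem_right _ _ (Ideal.mem_map_of_mem (algebraMap A (A ⊗[A0] B0)) ha0')
  have hIm : I ≤ mC := by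
    intro x hx
    obtain ⟨b, hb⟩ := hdec x
    have h1 : compMap A0 B0 A R (x - 1 ⊗ₜ b) ∈ maximalIdeal R := by
      rw [hmax]
      have := Ideal.mem_map_of_mem (compMap A0 B0 A R).toRingHom hb
      have e : (compMap A0 B0 A R).toRingHom.comp (algebraMap A (A ⊗[A0] B0)) = algebraMap A R := by
        ext a
        change compMap A0 B0 A R (a ⊗ₜ 1) = _
        rw [compMap_tmul, map_one, mul_one]
      rw [hmC, Ideal.map_map, e] at this
      exact this
    rw [map_sub, show compMap A0 B0 A R x = 0 from hx, zero_sub, neg_mem_iff, compMap_tmul, map_one, one_mul] at h1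
    have h2 : b ∈ maximalIdeal B0 := fun hu => h1 (hu.map _)
    rw [← hψ] at h2
    have h3 : (1 : A) ⊗ₜ[A0] b ∈ mC := by
      have := Ideal.mem_map_of_mem (Algebra.TensorProduct.includeRight : B0 →ₐ[A0] A ⊗[A0] B0).toRingHom h2
      rw [Ideal.map_map] at this
      have e : (Algebra.TensorProduct.includeRight : B0 →ₐ[A0] A ⊗[A0] B0).toRingHom.comp (algebraMap A0 B0) =
        (algebraMap A (A ⊗[A0] B0)).comp (algebraMap A0 A) := by
        ext x
        simp
      rw [e, ← Ideal.map_map] at this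
      exact Ideal.map_mono hloc this
    simpa using add_mem hb h3
  have hII : I ≤ mC * I := by
    let φ : A ⊗[A0] B0 →ₐ[A] R :=
      { (compMap A0 B0 A R).toRingHom with
        commutes' := fun a => by change compMap A0 B0 A R (a ⊗ₜ 1) = _; rw [compMap_tmul, map_one, mul_one] }
    exact ker_le_mul φ hsurj (maximalIdeal A) hIm
  have hIn : I ≤ mC ^ n * I := by
    clear hn
    induction n with
    | zero => simp
    | succ n ih =>
      calc I ≤ mC * I := hII
        _ ≤ mC * (mC ^ n * I) := Ideal.mul_mono_right ih
        _ = _ := by rw [pow_succ', mul_assoc]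
  let ρ : B0 →+* A ⊗[A0] B0 := (Algebra.TensorProduct.includeRight : B0 →ₐ[A0] A ⊗[A0] B0).toRingHom
  have hmn : mC ^ n ≤ (maximalIdeal B0).map ρ := by
    rw [← hψ, Ideal.map_map, hmC, ← Ideal.map_pow]
    refine (Ideal.map_mono hn).trans ?_
    rw [Ideal.map_map]
    apply le_of_eq
    congr 1
    ext x
    simp [ρ]
  let _ : Algebra B0 (A ⊗[A0] B0) := ρ.toAlgebra
  let f : B0 ⊗[A0] A →ₐ[B0] A ⊗[A0] B0 := 
    { (Algebra.TensorProduct.comm A0 B0 A).toRingHom with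
      commutes' := fun b => by change Algebra.TensorProduct.comm A0 B0 A (b ⊗ₜ 1) = _; rfl }
  have hfs : Function.Surjective f.toLinearMap := (Algebra.TensorProduct.comm A0 B0 A).surjective
  have : Module.Finite B0 (A ⊗[A0] B0) := Module.Finite.of_surjective f.toLinearMap hfs
  have : IsNoetherian B0 (A ⊗[A0] B0) := inferInstance
  have hbot : I.restrictScalars B0 = ⊥ := by
    refine Submodule.eq_bot_of_le_smul_of_le_jacobson_bot (maximalIdeal B0) _ (IsNoetherian.noetherian _) ?_
      (maximalIdeal_le_jacobson _)
    intro x hx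
    have hx2 := Ideal.mul_mono_left hmn (hIn hx)
    refine Submodule.mul_induction_on hx2 (fun a ha b hb => ?_) (fun _ _ => add_mem)
    change a ∈ Ideal.span _ at ha
    induction ha using Submodule.span_induction generalizing b with
    | mem y hy =>
      obtain ⟨c, hc, rfl⟩ := hy
      exact Submodule.smul_mem_smul (r := c) (n := b) hc hb
    | zero => rw [zero_mul]; exact zero_mem _
    | add y z _ _ ihy ihz => rw [add_mul]; exact add_mem (ihy b hb) (ihz b hb)
    | smul c y _ ihy => 
      rw [smul_eq_mul, mul_comm c, mul_assoc]
      exact ihy _ (Ideal.mul_mem_left _ _ hb)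
  rw [injective_iff_map_eq_zero]
  intro x hx
  have : x ∈ I.restrictScalars B0 := hx
  rwa [hbot] at this
end

theorem natSepDegree_one_of_fixed {F N : Type*} [Field F] [Field N] [Algebra F N] [Normal F N] (q : ℕ) [ExpChar F q]
    (x : N) (hx : ∀ σ : N ≃ₐ[F] N, σ x = x) : ∃ n : ℕ, x ^ q ^ n ∈ (algebraMap F N).range := by
  classical
  rw [← minpoly.natSepDegree_eq_one_iff_pow_mem (F := F) q]
  have hi : IsIntegral F x := Normal.isIntegral inferInstance x
  rw [Polynomial.natSepDegree_eq_of_splits (E := N) _ (Normal.splits inferInstance x)]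
  rw [Finset.card_eq_one]
  refine ⟨x, ?_⟩
  ext y
  rw [Multiset.mem_toFinset, Finset.mem_singleton, Polynomial.mem_aroots]
  constructor
  · rintro ⟨_, hy⟩
    obtain ⟨σ, hσ⟩ := minpoly.exists_algEquiv_of_root (K := F) hi.isAlgebraic hy
    apply σ.injective
    rw [hσ, hx]
  · rintro rfl
    exact ⟨minpoly.ne_zero hi, minpoly.aeval _ _⟩

/-- Elements of `L0 ⊗ E` integral over `B1` lie in `B1 ⊗ E`. -/
def GProp {K0 L0 : Type*} [Field K0] [Field L0] [Algebra K0 L0] (B1 : Subalgebra K0 L0) (E : Type*) [Field E] [Algebra K0 E] : Prop :=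
  ∀ z : L0 ⊗[K0] E, IsIntegral B1 z → z ∈ Submodule.span B1 (Set.range fun e : E => (1 : L0) ⊗ₜ[K0] e)

/-- Field version of the functional property. -/
def FieldF (q : ℕ) {K0 L0 : Type*} [Field K0] [Field L0] [Algebra K0 L0] (B1 : Subalgebra K0 L0) : Prop :=
  ∀ w : K0, w ≠ 0 → ∃ (φA : K0 →+ K0) (φB : L0 →+ L0), (∀ a, algebraMap K0 L0 (φA a) = φB (algebraMap K0 L0 a)) ∧
    (∀ f g, φA (f ^ q * g) = f * φA g) ∧ (∀ f g, φB (f ^ q * g) = f * φB g) ∧ φA w ≠ 0 ∧ ∀ b ∈ B1, φB b ∈ B1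

section
variable {K0 L0 : Type*} [Field K0] [Field L0] [Algebra K0 L0] {B1 : Subalgebra K0 L0}

theorem FieldF.pow {p : ℕ} (h : FieldF p B1) (n : ℕ) : FieldF (p ^ n) B1 := by
  induction n with
  | zero => exact fun w hw => ⟨AddMonoidHom.id _, AddMonoidHom.id _, by simp, by simp, by simp, by simpa using hw, by simp⟩
  | succ n ih =>
    intro w hw
    obtain ⟨a1, b1, h1, h2, h3, h4, h5⟩ := ih w hw
    obtain ⟨a2, b2, g1, g2, g3, g4, g5⟩ := h _ h4
    refine ⟨a2.comp a1, b2.comp b1, fun a => ?_, fun f g => ?_, fun f g => ?_, g4, fun b hb => g5 _ (h5 _ hb)⟩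
    · simp [g1, h1]
    · simp [pow_succ', pow_mul, h2, g2]
    · simp [pow_succ', pow_mul, h3, g3]

theorem gProp_of_pow {q : ℕ} (hF : FieldF q B1) (hB : ∀ x : L0, IsIntegral B1 x → x ∈ B1)
    {P : Type*} [Field P] [Algebra K0 P] [FiniteDimensional K0 P]
    (hadd : ∀ (ι : Type) (s : Finset ι) (f : ι → L0 ⊗[K0] P), (∑ i ∈ s, f i) ^ q = ∑ i ∈ s, f i ^ q)
    (hadd' : ∀ (ι : Type) (s : Finset ι) (f : ι → P), (∑ i ∈ s, f i) ^ q = ∑ i ∈ s, f i ^ q)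
    (hq0 : q ≠ 0)
    (hP : ∀ x : P, x ^ q ∈ (algebraMap K0 P).range) : GProp B1 P := by
  classical
  intro z hz
  let e := Module.finBasis K0 P
  let c := (Algebra.TensorProduct.basis L0 e).repr z
  have hzc : z = ∑ i, c i ⊗ₜ[K0] e i := by
    conv_lhs => rw [← (Algebra.TensorProduct.basis L0 e).sum_repr z]
    refine Finset.sum_congr rfl fun i _ => ?_
    rw [Algebra.TensorProduct.basis_apply, TensorProduct.smul_tmul', smul_eq_mul, mul_one]
  choose u hu using fun i => hP (e i)
  set w : L0 := ∑ i, u i • c i ^ q with hw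
  have hzq : z ^ q = algebraMap L0 _ w := by
    rw [hzc, hadd, hw, map_sum]
    refine Finset.sum_congr rfl fun i _ => ?_
    rw [Algebra.TensorProduct.tmul_pow, ← hu, Algebra.TensorProduct.algebraMap_apply, Algebra.algebraMap_self, RingHom.id_apply,
      Algebra.algebraMap_eq_smul_one, TensorProduct.tmul_smul, TensorProduct.smul_tmul']
  have hwB : w ∈ B1 := by
    apply hB
    have := hz.pow q
    rw [hzq] at this
    exact (isIntegral_algebraMap_iff (algebraMap L0 (L0 ⊗[K0] P)).injective).1 this
  -- span
  let V : Submodule K0 (Fin (Module.finrank K0 P) → K0) := Submodule.span K0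
    {v | ∃ (φA : K0 →+ K0) (φB : L0 →+ L0), (∀ a, algebraMap K0 L0 (φA a) = φB (algebraMap K0 L0 a)) ∧
    (∀ f g, φA (f ^ q * g) = f * φA g) ∧ (∀ f g, φB (f ^ q * g) = f * φB g) ∧ (∀ b ∈ B1, φB b ∈ B1) ∧ v = fun i => φA (u i)}
  have hV : V = ⊤ := by
    by_contra hne
    obtain ⟨f, hf0, hf⟩ := Submodule.exists_le_ker_of_lt_top V (lt_top_iff_ne_top.2 hne)
    let lam : Fin (Module.finrank K0 P) → K0 := fun i => f (Pi.single i 1)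
    have hflam : ∀ v, f v = ∑ i, lam i * v i := by
      intro v
      conv_lhs => rw [pi_eq_sum_univ' v, map_sum]
      refine Finset.sum_congr rfl fun i _ => ?_
      rw [map_smul, smul_eq_mul, mul_comm]
    have hx : ∑ i, lam i • e i ≠ 0 := by
      intro h0
      apply hf0
      have h1 := Fintype.linearIndependent_iff.1 e.linearIndependent lam h0
      ext v
      simp [h1, hflam]
    have hxq : (∑ i, lam i • e i) ^ q = algebraMap K0 P (∑ i, lam i ^ q * u i) := by
      rw [hadd', map_sum]
      refine Finset.sum_congr rfl fun i _ => ?_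
      rw [smul_pow, ← hu, map_mul, Algebra.smul_def]
    have hw0 : ∑ i, lam i ^ q * u i ≠ 0 := by
      intro h0
      rw [h0, map_zero] at hxq
      exact hx (pow_eq_zero_iff hq0 |>.1 hxq)
    obtain ⟨a, b, h1, h2, h3, h4, h5⟩ := hF _ hw0
    apply h4
    rw [map_sum]
    have := hf (Submodule.subset_span ⟨a, b, h1, h2, h3, h5, rfl⟩)
    rw [LinearMap.mem_ker, hflam] at this
    simpa [h2] using this
  have hc : ∀ v ∈ V, ∑ i, v i • c i ∈ B1 := by
    intro v hv
    induction hv using Submodule.span_induction with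
    | mem v hv =>
      obtain ⟨a, b, h1, h2, h3, h5, rfl⟩ := hv
      have := h5 _ hwB
      rw [hw, map_sum] at this
      convert this using 2 with i
      rw [Algebra.smul_def, Algebra.smul_def, mul_comm (algebraMap K0 L0 (u i)), h3, h1, mul_comm]
    | zero => simp
    | add x y _ _ hx hy => simpa [add_smul, Finset.sum_add_distrib] using add_mem hx hy
    | smul a x _ hx => simpa [mul_smul, Finset.smul_sum] using B1.smul_mem hx a
  have hcB : ∀ i, c i ∈ B1 := by
    intro i
    have := hc (Pi.single i 1) (by rw [hV]; trivial)
    simpa [Pi.single_apply] using this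
  rw [hzc]
  refine Submodule.sum_mem _ fun i _ => ?_
  have : c i ⊗ₜ[K0] e i = (⟨c i, hcB i⟩ : B1) • ((1 : L0) ⊗ₜ[K0] e i) := by
    have h := TensorProduct.smul_tmul' (R := K0) (⟨c i, hcB i⟩ : B1) (1 : L0) (e i)
    refine Eq.trans ?_ h.symm
    rw [Subalgebra.smul_def, smul_eq_mul, mul_one]
  rw [this]
  exact Submodule.smul_mem _ _ (Submodule.subset_span ⟨_, rfl⟩)

theorem gProp_of_retract {K N : Type*} [Field K] [Field N] [Algebra K0 K] [Algebra K0 N] (i : K →ₐ[K0] N)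
    (h : GProp B1 N) : GProp B1 K := by
  intro z hz
  obtain ⟨ρ, hρ⟩ := i.toLinearMap.exists_leftInverse_of_injective (LinearMap.ker_eq_bot.2 i.toRingHom.injective)
  let I : L0 ⊗[K0] K →ₐ[L0] L0 ⊗[K0] N := Algebra.TensorProduct.map (AlgHom.id L0 L0) i
  have h1 : IsIntegral B1 (I z) := hz.map (I.restrictScalars B1)
  have h2 := h _ h1
  let Rr : L0 ⊗[K0] N →ₗ[L0] L0 ⊗[K0] K := TensorProduct.AlgebraTensorModule.map LinearMap.id ρ
  have h3 : ∀ y, Rr (I y) = y := by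
    intro y
    induction y with
    | zero => simp
    | add x y hx hy => rw [map_add, map_add, hx, hy]
    | tmul x y =>
      have : ρ (i y) = y := LinearMap.congr_fun hρ y
      simp [Rr, I, this]
  have h4 := Submodule.mem_map_of_mem (f := Rr.restrictScalars B1) h2
  rw [Submodule.map_span] at h4
  have h5 : (Rr.restrictScalars B1) (I z) = z := h3 z
  rw [h5] at h4
  refine Submodule.span_mono ?_ h4
  rintro _ ⟨_, ⟨e, rfl⟩, rfl⟩
  exact ⟨ρ e, by simp [Rr]⟩

theorem gProp_of_galois {P N : Type*} [Field P] [Field N] [Algebra K0 P] [Algebra K0 N] [Algebra P N] [IsScalarTower K0 P N]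
    [FiniteDimensional K0 N] [FiniteDimensional P N] [IsGalois P N] (h : GProp B1 P) : GProp B1 N := by
  classical
  intro z hz
  let b := Module.finBasis P N
  let I : L0 ⊗[K0] P →ₐ[L0] L0 ⊗[K0] N := Algebra.TensorProduct.map (AlgHom.id L0 L0) (IsScalarTower.toAlgHom K0 P N)
  have hI : Function.Injective I := by
    have := Module.Flat.lTensor_preserves_injective_linearMap (M := L0) (IsScalarTower.toAlgHom K0 P N).toLinearMap
      (algebraMap P N).injective
    exact this
  let Tr : L0 ⊗[K0] N →ₗ[L0] L0 ⊗[K0] P := TensorProduct.AlgebraTensorModule.map LinearMap.id ((Algebra.trace P N).restrictScalars K0)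
  let S : (N ≃ₐ[P] N) → (L0 ⊗[K0] N →ₐ[L0] L0 ⊗[K0] N) := fun σ =>
    Algebra.TensorProduct.map (AlgHom.id L0 L0) ((σ : N →ₐ[P] N).restrictScalars K0)
  have hTr : ∀ y, I (Tr y) = ∑ σ, S σ y := by
    intro y
    induction y with
    | zero => simp
    | add x y hx hy => simp only [map_add, hx, hy, Finset.sum_add_distrib]
    | tmul x y => simp [I, Tr, S, trace_eq_sum_automorphisms, TensorProduct.tmul_sum]
  have hz1 : ∀ n : N, Tr ((1 ⊗ₜ n) * z) ∈ Submodule.span B1 (Set.range fun e : P => (1 : L0) ⊗ₜ[K0] e) := by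
    intro n
    apply h
    have hn : IsIntegral B1 ((1 : L0) ⊗ₜ[K0] n) := by
      have h1 : IsIntegral K0 n := Algebra.IsIntegral.isIntegral n
      have h2 : IsIntegral K0 ((1 : L0) ⊗ₜ[K0] n) := h1.map (Algebra.TensorProduct.includeRight (R := K0) (A := L0) (B := N))
      exact h2.tower_top
    have h3 : IsIntegral B1 (I (Tr ((1 ⊗ₜ n) * z))) := by
      rw [hTr]
      exact IsIntegral.sum _ fun σ _ => (hn.mul hz).map ((S σ).restrictScalars B1)
    exact (isIntegral_algHom_iff (I.restrictScalars B1) hI).1 h3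
  have hid : ∀ y : L0 ⊗[K0] N, y = ∑ i, (1 ⊗ₜ b i) * I (Tr ((1 ⊗ₜ b.traceDual i) * y)) := by
    intro y
    induction y with
    | zero => simp
    | add x y hx hy =>
      conv_lhs => rw [hx, hy]
      simp only [mul_add, map_add, Finset.sum_add_distrib]
    | tmul x y =>
      have : y = ∑ i, b i * algebraMap P N (Algebra.trace P N (b.traceDual i * y)) := by
        conv_lhs => rw [← b.sum_repr y]
        refine Finset.sum_congr rfl fun i _ => ?_
        have := b.traceDual.traceDual_repr_apply y i
        rw [Module.Basis.traceDual_traceDual] at this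
        rw [this, Algebra.traceForm_apply, mul_comm y, Algebra.smul_def, mul_comm]
      conv_lhs => rw [this]
      simp [I, Tr, TensorProduct.tmul_sum]
  rw [hid z]
  refine Submodule.sum_mem _ fun i _ => ?_
  have h6 := hz1 (b.traceDual i)
  generalize Tr ((1 ⊗ₜ b.traceDual i) * z) = t at h6
  induction h6 using Submodule.span_induction with
  | mem x hx =>
    obtain ⟨e, rfl⟩ := hx
    exact Submodule.subset_span ⟨b i * algebraMap P N e, by simp [I]⟩
  | zero => simp
  | add x y _ _ hx hy => rw [map_add, mul_add]; exact add_mem hx hy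
  | smul a x _ hx =>
    have : I (a • x) = a • I x := map_smul (I.restrictScalars B1) a x
    rw [this, mul_smul_comm]
    exact Submodule.smul_mem _ _ hx

theorem gProp_normal {p : ℕ} [ExpChar K0 p] (hF : FieldF p B1) (hB : ∀ x : L0, IsIntegral B1 x → x ∈ B1)
    (N : Type*) [Field N] [Algebra K0 N] [FiniteDimensional K0 N] [Normal K0 N] : GProp B1 N := by
  let P : IntermediateField K0 N := IntermediateField.fixedField (⊤ : Subgroup (N ≃ₐ[K0] N))
  have : IsGalois P N := IsGalois.of_fixed_field N (⊤ : Subgroup (N ≃ₐ[K0] N))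
  refine gProp_of_galois (P := P) ?_
  have hx : ∀ x : P, ∃ n : ℕ, x ^ p ^ n ∈ (algebraMap K0 P).range := by
    intro x
    obtain ⟨n, y, hy⟩ := natSepDegree_one_of_fixed (F := K0) p (x : N) fun σ => x.2 ⟨σ, trivial⟩
    exact ⟨n, y, Subtype.ext hy⟩
  let e := Module.finBasis K0 P
  choose n hn using fun i => hx (e i)
  let m := ∑ i, n i
  have : ExpChar P p := expChar_of_injective_algebraMap (algebraMap K0 P).injective p
  have : ExpChar (L0 ⊗[K0] P) p := expChar_of_injective_algebraMap (algebraMap K0 _).injective p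
  have hadd' : ∀ (ι : Type) (s : Finset ι) (f : ι → P), (∑ i ∈ s, f i) ^ p ^ m = ∑ i ∈ s, f i ^ p ^ m :=
    fun ι s f => map_sum (iterateFrobenius P p m) f s
  refine gProp_of_pow (hF.pow m) hB (fun ι s f => map_sum (iterateFrobenius (L0 ⊗[K0] P) p m) f s) hadd'
    (pow_ne_zero _ (expChar_pos K0 p).ne') fun x => ?_
  rw [← e.sum_repr x, hadd']
  refine sum_mem fun i _ => ?_
  rw [smul_pow, Algebra.smul_def]
  refine mul_mem ⟨_, rfl⟩ ?_
  have : m = n i + (m - n i) := (Nat.add_sub_cancel' (Finset.single_le_sum (f := n) (fun _ _ => Nat.zero_le _) (Finset.mem_univ i))).symm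
  rw [this, pow_add, pow_mul]
  exact pow_mem (hn i) _

theorem gProp {p : ℕ} [ExpChar K0 p] (hF : FieldF p B1) (hB : ∀ x : L0, IsIntegral B1 x → x ∈ B1)
    (K : Type*) [Field K] [Algebra K0 K] [FiniteDimensional K0 K] : GProp B1 K := by
  let N := IntermediateField.normalClosure K0 K (AlgebraicClosure K)
  have : Normal K0 N := normalClosure.normal K0 K (AlgebraicClosure K)
  have : FiniteDimensional K0 N := normalClosure.is_finiteDimensional K0 K (AlgebraicClosure K)
  exact gProp_of_retract (IsScalarTower.toAlgHom K0 K N) (gProp_normal hF hB N)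

end

theorem exists_extend_functional {D K : Type*} [CommRing D] [IsDomain D] [Field K] [Algebra D K] [IsFractionRing D K]
    {q : ℕ} (hq : q ≠ 0) (φ : D →+ D) (hφ : ∀ f g, φ (f ^ q * g) = f * φ g) :
    ∃ Φ : K →+ K, (∀ x c d, d ≠ 0 → x * algebraMap D K d ^ q = algebraMap D K c → Φ x = algebraMap D K (φ c) / algebraMap D K d) ∧
      ∀ x y, Φ (x ^ q * y) = x * Φ y := by
  have hne : ∀ d : D, d ≠ 0 → algebraMap D K d ≠ 0 := fun d hd => by
    rwa [Ne, FaithfulSMul.algebraMap_eq_zero_iff]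
  have hinj : Function.Injective (algebraMap D K) := IsFractionRing.injective D K
  have hex : ∀ x : K, ∃ c d : D, d ≠ 0 ∧ x * algebraMap D K d ^ q = algebraMap D K c := by
    intro x
    obtain ⟨f, g, hg, rfl⟩ := IsFractionRing.div_surjective (A := D) x
    have hg0 : g ≠ 0 := nonZeroDivisors.ne_zero hg
    refine ⟨f * g ^ (q - 1), g, hg0, ?_⟩
    have := hne g hg0
    obtain ⟨r, rfl⟩ := Nat.exists_eq_succ_of_ne_zero hq
    rw [Nat.succ_sub_one, map_mul, map_pow, pow_succ]
    field_simp
  choose c d hd hcd using hex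
  have hwd : ∀ x c' d', d' ≠ 0 → x * algebraMap D K d' ^ q = algebraMap D K c' →
      algebraMap D K (φ (c x)) / algebraMap D K (d x) = algebraMap D K (φ c') / algebraMap D K d' := by
    intro x c' d' hd' h
    have h1 : d' ^ q * c x = d x ^ q * c' := by
      apply hinj
      rw [map_mul, map_mul, ← h, ← hcd, map_pow, map_pow]; ring
    have h2 := congrArg φ h1
    rw [hφ, hφ] at h2
    rw [div_eq_div_iff (hne _ (hd x)) (hne _ hd'), ← map_mul, ← map_mul, mul_comm, h2, mul_comm]
  refine ⟨AddMonoidHom.mk' (fun x => algebraMap D K (φ (c x)) / algebraMap D K (d x)) fun x y => ?_, fun x c' d' hd' h => hwd x c' d' hd' h,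
    fun x y => ?_⟩
  · have h1 := hne _ (hd x)
    have h2 := hne _ (hd y)
    rw [hwd (x + y) (d y ^ q * c x + d x ^ q * c y) (d x * d y) (mul_ne_zero (hd x) (hd y)) ?_]
    · rw [map_add, hφ, hφ]
      simp only [map_add, map_mul]
      field_simp
    · simp only [map_add, map_mul, map_pow, ← hcd]; ring
  · obtain ⟨f, g, hg, rfl⟩ := IsFractionRing.div_surjective (A := D) x
    have hg0 : g ≠ 0 := nonZeroDivisors.ne_zero hg
    have h1 := hne _ hg0
    have h2 := hne _ (hd y)
    change algebraMap D K (φ (c _)) / algebraMap D K (d _) = _ * (algebraMap D K (φ (c y)) / algebraMap D K (d y))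
    rw [hwd _ (f ^ q * c y) (g * d y) (mul_ne_zero hg0 (hd y)) ?_]
    · rw [hφ]
      simp only [map_mul]
      field_simp
    · simp only [map_mul, map_pow, ← hcd, mul_pow, div_pow]; field_simp

theorem algebraMap_ne_zero_aux {A0 K0 L0 : Type*} [CommRing A0] [Field K0] [Field L0]
    [Algebra A0 K0] [Algebra A0 L0] [Algebra K0 L0] [IsFractionRing A0 K0] [IsScalarTower A0 K0 L0]
    {a : A0} (ha : a ≠ 0) : algebraMap A0 L0 a ≠ 0 := by
  rw [IsScalarTower.algebraMap_apply A0 K0 L0, Ne, FaithfulSMul.algebraMap_eq_zero_iff]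
  rwa [IsFractionRing.to_map_eq_zero_iff]

section
variable (A0 B0 K0 L0 : Type*) [CommRing A0] [CommRing B0] [IsDomain A0] [IsDomain B0] [Field K0] [Field L0]
  [Algebra A0 B0] [Algebra A0 K0] [Algebra A0 L0] [Algebra B0 L0] [Algebra K0 L0] [IsFractionRing A0 K0] [IsFractionRing B0 L0]
  [IsScalarTower A0 B0 L0] [IsScalarTower A0 K0 L0]

/-- The subalgebra `K0 ⬝ B0` of `L0`. -/
def subB : Subalgebra K0 L0 where
  carrier := {x | ∃ a : A0, a ≠ 0 ∧ ∃ b : B0, algebraMap A0 L0 a * x = algebraMap B0 L0 b}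
  mul_mem' := by
    rintro x y ⟨a, ha, b, h⟩ ⟨a', ha', b', h'⟩
    exact ⟨a * a', mul_ne_zero ha ha', b * b', by rw [map_mul, map_mul, ← h, ← h']; ring⟩
  add_mem' := by
    rintro x y ⟨a, ha, b, h⟩ ⟨a', ha', b', h'⟩
    refine ⟨a * a', mul_ne_zero ha ha', algebraMap A0 B0 a' * b + algebraMap A0 B0 a * b', ?_⟩
    rw [map_mul, map_add, map_mul, map_mul, ← h, ← h', ← IsScalarTower.algebraMap_apply, ← IsScalarTower.algebraMap_apply]; ring
  algebraMap_mem' := by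
    intro x
    obtain ⟨f, g, hg, rfl⟩ := IsFractionRing.div_surjective (A := A0) x
    have hg0 : g ≠ 0 := nonZeroDivisors.ne_zero hg
    have h1 : algebraMap A0 L0 g ≠ 0 := by
      rw [IsScalarTower.algebraMap_apply A0 K0 L0, Ne, FaithfulSMul.algebraMap_eq_zero_iff, FaithfulSMul.algebraMap_eq_zero_iff]
      exact hg0
    refine ⟨g, hg0, algebraMap A0 B0 f, ?_⟩
    rw [map_div₀, ← IsScalarTower.algebraMap_apply, ← IsScalarTower.algebraMap_apply, ← IsScalarTower.algebraMap_apply]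
    field_simp

variable {A0 B0 K0 L0}

theorem mem_subB {x : L0} : x ∈ subB A0 B0 K0 L0 ↔ ∃ a : A0, a ≠ 0 ∧ ∃ b : B0, algebraMap A0 L0 a * x = algebraMap B0 L0 b := Iff.rfl

theorem subB_isIntegrallyClosed [IsIntegrallyClosed B0] (x : L0) (hx : IsIntegral (subB A0 B0 K0 L0) x) : x ∈ subB A0 B0 K0 L0 := by
  let f : B0 →+* subB A0 B0 K0 L0 := (algebraMap B0 L0).codRestrict (subB A0 B0 K0 L0).toSubring fun b => ⟨1, one_ne_zero, b, by simp⟩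
  let _ : Algebra B0 (subB A0 B0 K0 L0) := f.toAlgebra
  have : IsScalarTower B0 (subB A0 B0 K0 L0) L0 := IsScalarTower.of_algebraMap_eq fun b => rfl
  have hM : IsLocalization (Algebra.algebraMapSubmonoid B0 (nonZeroDivisors A0)) (subB A0 B0 K0 L0) := by
    refine ⟨?_, ?_, ?_⟩
    · rintro ⟨_, a, ha, rfl⟩
      have ha0 := nonZeroDivisors.ne_zero ha
      have h1 : algebraMap B0 (subB A0 B0 K0 L0) (algebraMap A0 B0 a) = algebraMap K0 _ (algebraMap A0 K0 a) := by
        apply Subtype.ext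
        change algebraMap B0 L0 _ = algebraMap K0 L0 _
        rw [← IsScalarTower.algebraMap_apply, ← IsScalarTower.algebraMap_apply]
      change IsUnit (algebraMap B0 (subB A0 B0 K0 L0) (algebraMap A0 B0 a))
      rw [h1]
      refine IsUnit.map _ (IsUnit.mk0 _ ?_)
      rwa [Ne, IsFractionRing.to_map_eq_zero_iff]
    · rintro ⟨x, a, ha, b, h⟩
      refine ⟨⟨b, ⟨_, a, mem_nonZeroDivisors_of_ne_zero ha, rfl⟩⟩, ?_⟩
      apply Subtype.ext
      change x * algebraMap B0 L0 (algebraMap A0 B0 a) = algebraMap B0 L0 b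
      rw [← h, ← IsScalarTower.algebraMap_apply, mul_comm]
    · intro x y h
      refine ⟨1, ?_⟩
      rw [IsFractionRing.injective B0 L0 (congrArg Subtype.val h)]
  obtain ⟨⟨_, a, ha, rfl⟩, hm⟩ := IsIntegral.exists_multiple_integral_of_isLocalization (Algebra.algebraMapSubmonoid B0 (nonZeroDivisors A0)) x hx
  obtain ⟨b, hb⟩ := IsIntegrallyClosed.isIntegral_iff.1 hm
  refine ⟨a, nonZeroDivisors.ne_zero ha, b, ?_⟩
  rw [hb, Submonoid.smul_def, Algebra.smul_def, ← IsScalarTower.algebraMap_apply]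

theorem fieldF_subB {p : ℕ} (hp : p ≠ 0) (h : FProp p (algebraMap A0 B0)) : FieldF p (subB A0 B0 K0 L0) := by
  intro w hw
  have hneL : ∀ {a : A0}, a ≠ 0 → algebraMap A0 L0 a ≠ 0 := fun {a} ha => algebraMap_ne_zero_aux (K0 := K0) ha
  have hAB : ∀ {a : A0}, a ≠ 0 → algebraMap A0 B0 a ≠ 0 := fun {a} ha h0 => hneL ha (by
    rw [IsScalarTower.algebraMap_apply A0 B0 L0, h0, map_zero])
  obtain ⟨f, g, hg, rfl⟩ := IsFractionRing.div_surjective (A := A0) w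
  have hg0 : g ≠ 0 := nonZeroDivisors.ne_zero hg
  have hf0 : f ≠ 0 := by rintro rfl; simp at hw
  have hgK : algebraMap A0 K0 g ≠ 0 := by rwa [Ne, IsFractionRing.to_map_eq_zero_iff]
  obtain ⟨φA, φB, h1, h2, h3, h4⟩ := h (f * g ^ (p - 1)) (mul_ne_zero hf0 (pow_ne_zero _ hg0))
  obtain ⟨ΦA, hA1, hA2⟩ := exists_extend_functional (K := K0) hp φA h2
  obtain ⟨ΦB, hB1, hB2⟩ := exists_extend_functional (K := L0) hp φB h3
  refine ⟨ΦA, ΦB, fun x => ?_, hA2, hB2, ?_, ?_⟩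
  · obtain ⟨f, g, hg, rfl⟩ := IsFractionRing.div_surjective (A := A0) x
    have hg0 : g ≠ 0 := nonZeroDivisors.ne_zero hg
    have hgK : algebraMap A0 K0 g ≠ 0 := by rwa [Ne, IsFractionRing.to_map_eq_zero_iff]
    have hx : algebraMap A0 K0 f / algebraMap A0 K0 g * algebraMap A0 K0 g ^ p = algebraMap A0 K0 (f * g ^ (p - 1)) := by
      obtain ⟨r, rfl⟩ := Nat.exists_eq_succ_of_ne_zero hp
      rw [Nat.succ_sub_one, map_mul, map_pow, pow_succ]
      field_simp
    rw [hA1 _ _ _ hg0 hx]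
    have hx' := congrArg (algebraMap K0 L0) hx
    rw [map_mul, map_pow, ← IsScalarTower.algebraMap_apply, ← IsScalarTower.algebraMap_apply, IsScalarTower.algebraMap_apply A0 B0 L0,
      IsScalarTower.algebraMap_apply A0 B0 L0] at hx'
    rw [hB1 _ _ _ (hAB hg0) hx', ← h1, map_div₀]
    simp only [← IsScalarTower.algebraMap_apply]
  · rw [hA1 _ (f * g ^ (p - 1)) g hg0]
    · refine div_ne_zero ?_ hgK
      rwa [Ne, IsFractionRing.to_map_eq_zero_iff]
    · obtain ⟨r, rfl⟩ := Nat.exists_eq_succ_of_ne_zero hp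
      rw [Nat.succ_sub_one, map_mul, map_pow, pow_succ]
      field_simp
  · rintro x ⟨a, ha, b, hab⟩
    have hx : x * algebraMap B0 L0 (algebraMap A0 B0 a) ^ p = algebraMap B0 L0 (algebraMap A0 B0 a ^ (p - 1) * b) := by
      obtain ⟨r, rfl⟩ := Nat.exists_eq_succ_of_ne_zero hp
      rw [Nat.succ_sub_one, map_mul, map_pow, pow_succ, ← hab, ← IsScalarTower.algebraMap_apply]
      ring
    rw [hB1 _ _ _ (hAB ha) hx, ← IsScalarTower.algebraMap_apply]
    refine ⟨a, ha, _, mul_div_cancel₀ _ (hneL ha)⟩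

/-- Main output: integral elements of `L0 ⊗ K` have a denominator from `A0`. -/
theorem integral_tensor [IsIntegrallyClosed B0] {p : ℕ} [ExpChar K0 p] (h : FProp p (algebraMap A0 B0))
    (K : Type*) [Field K] [Algebra K0 K] [FiniteDimensional K0 K] : GProp (subB A0 B0 K0 L0) K :=
  gProp (fieldF_subB (expChar_pos K0 p).ne' h) subB_isIntegrallyClosed K
end

theorem integralElem_trans {B0 R T : Type*} [CommRing B0] [CommRing R] [CommRing T] [Algebra B0 R] [Module.Finite B0 R]
    (j : R →+* T) {z : T} (hz : j.IsIntegralElem z) : (j.comp (algebraMap B0 R)).IsIntegralElem z := by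
  let _ : Algebra R T := j.toAlgebra
  let _ : Algebra B0 T := (j.comp (algebraMap B0 R)).toAlgebra
  have : IsScalarTower B0 R T := IsScalarTower.of_algebraMap_eq fun _ => rfl
  have h1 : IsIntegral R z := hz
  exact isIntegral_trans (R := B0) z h1


theorem exists_basis_denom (A0 A K0 K : Type*) [CommRing A0] [CommRing A] [IsDomain A0] [IsDomain A] [Field K0] [Field K]
    [Algebra A0 A] [Algebra A0 K0] [Algebra A K] [Algebra K0 K] [Algebra A0 K]
    [IsFractionRing A0 K0] [IsFractionRing A K] [IsScalarTower A0 A K] [IsScalarTower A0 K0 K] [Module.Finite A0 A] :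
    (∀ k : K, ∃ (d : A0) (a : A), d ≠ 0 ∧ algebraMap A0 K d * k = algebraMap A K a) ∧
    FiniteDimensional K0 K ∧
    ∃ (n : ℕ) (x : Fin n → A) (e : Module.Basis (Fin n) K0 K) (d : A0), (∀ i, e i = algebraMap A K (x i)) ∧ d ≠ 0 ∧
      ∀ a : A, ∃ c : Fin n → A0, d • a = ∑ i, c i • x i := by
  classical
  have hneK : ∀ {a : A0}, a ≠ 0 → algebraMap A0 K a ≠ 0 := fun {a} ha => algebraMap_ne_zero_aux (K0 := K0) ha
  have hinj : Function.Injective (algebraMap A0 A) := by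
    rw [injective_iff_map_eq_zero]
    intro a ha
    by_contra h
    exact hneK h (by rw [IsScalarTower.algebraMap_apply A0 A K, ha, map_zero])
  have : FaithfulSMul A0 A := (faithfulSMul_iff_algebraMap_injective A0 A).2 hinj
  have : Algebra.IsAlgebraic A0 A := inferInstance
  have h1 : ∀ k : K, ∃ (d : A0) (a : A), d ≠ 0 ∧ algebraMap A0 K d * k = algebraMap A K a := by
    intro k
    obtain ⟨f, g, hg, rfl⟩ := IsFractionRing.div_surjective (A := A) k
    have hg0 := nonZeroDivisors.ne_zero hg
    obtain ⟨c, d, hd, h⟩ := Algebra.IsAlgebraic.exists_smul_eq_mul A0 f hg0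
    refine ⟨d, c, hd, ?_⟩
    have hgK : algebraMap A K g ≠ 0 := by rwa [Ne, IsFractionRing.to_map_eq_zero_iff]
    have := congrArg (algebraMap A K) h
    rw [Algebra.smul_def, map_mul, map_mul, ← IsScalarTower.algebraMap_apply] at this
    field_simp
    rw [this]
  have hspan : Submodule.span K0 (Set.range (algebraMap A K)) = ⊤ := by
    rw [eq_top_iff]
    intro k _
    obtain ⟨d, a, hd, h⟩ := h1 k
    have : k = (algebraMap A0 K0 d)⁻¹ • algebraMap A K a := by
      rw [← h, Algebra.smul_def, map_inv₀, ← IsScalarTower.algebraMap_apply, inv_mul_cancel_left₀ (hneK hd)]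
    rw [this]
    exact Submodule.smul_mem _ _ (Submodule.subset_span ⟨a, rfl⟩)
  obtain ⟨s, hs⟩ := (inferInstance : Module.Finite A0 A)
  have hspan2 : ∀ a : A, algebraMap A K a ∈ Submodule.span K0 (algebraMap A K '' (s : Set A)) := by
    intro a
    have ha : a ∈ Submodule.span A0 (s : Set A) := by rw [hs]; trivial
    induction ha using Submodule.span_induction with
    | mem x hx => exact Submodule.subset_span ⟨x, hx, rfl⟩
    | zero => simp
    | add x y _ _ hx hy => rw [map_add]; exact add_mem hx hy
    | smul a x _ hx =>
      rw [Algebra.smul_def, map_mul, ← IsScalarTower.algebraMap_apply, IsScalarTower.algebraMap_apply A0 K0 K, ← Algebra.smul_def]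
      exact Submodule.smul_mem _ _ hx
  have hspan3 : Submodule.span K0 (algebraMap A K '' (s : Set A)) = ⊤ := by
    rw [eq_top_iff, ← hspan, Submodule.span_le]
    rintro _ ⟨a, rfl⟩
    exact hspan2 a
  have hfd : FiniteDimensional K0 K := ⟨⟨s.image (algebraMap A K), by rw [Finset.coe_image]; exact hspan3⟩⟩
  refine ⟨h1, hfd, ?_⟩
  obtain ⟨κ, a, ha, hspan4, hli⟩ := exists_linearIndependent' K0 (algebraMap A K)
  let b : Module.Basis κ K0 K := Module.Basis.mk hli (by rw [hspan4, hspan])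
  have : Fintype κ := FiniteDimensional.fintypeBasisIndex b
  let e := b.reindex (Fintype.equivFin κ)
  let x : Fin (Fintype.card κ) → A := fun i => a ((Fintype.equivFin κ).symm i)
  have hex : ∀ i, e i = algebraMap A K (x i) := fun i => by simp [e, b, x]
  obtain ⟨⟨d, hd⟩, hd'⟩ := IsLocalization.exist_integer_multiples_of_finset (nonZeroDivisors A0)
    ((s ×ˢ (Finset.univ : Finset (Fin (Fintype.card κ)))).image fun q => e.repr (algebraMap A K q.1) q.2)
  refine ⟨_, x, e, d, hex, nonZeroDivisors.ne_zero hd, fun a => ?_⟩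
  have ha : a ∈ Submodule.span A0 (s : Set A) := by rw [hs]; trivial
  induction ha using Submodule.span_induction with
  | mem y hy =>
    have : ∀ i, ∃ c : A0, algebraMap A0 K0 c = d • e.repr (algebraMap A K y) i := fun i =>
      hd' _ (Finset.mem_image.2 ⟨⟨y, i⟩, by simpa using hy, rfl⟩)
    choose c hc using this
    refine ⟨c, IsFractionRing.injective A K ?_⟩
    rw [Algebra.smul_def, map_mul, ← IsScalarTower.algebraMap_apply, map_sum]
    conv_lhs => rw [← e.sum_repr (algebraMap A K y), Finset.mul_sum]
    refine Finset.sum_congr rfl fun i _ => ?_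
    rw [hex, Algebra.smul_def (c i), map_mul, ← IsScalarTower.algebraMap_apply, IsScalarTower.algebraMap_apply A0 K0 K (c i), hc,
      Algebra.smul_def d, map_mul, ← IsScalarTower.algebraMap_apply, Algebra.smul_def, mul_assoc]
  | zero => exact ⟨0, by simp⟩
  | add y z _ _ hy hz =>
    obtain ⟨c, hc⟩ := hy
    obtain ⟨c', hc'⟩ := hz
    exact ⟨c + c', by simp [smul_add, hc, hc', add_smul, Finset.sum_add_distrib]⟩
  | smul t y _ hy =>
    obtain ⟨c, hc⟩ := hy
    exact ⟨t • c, by rw [smul_comm, hc, Finset.smul_sum]; simp [mul_smul]⟩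

section
variable (A0 B0 A R K0 L0 K : Type*) [CommRing A0] [CommRing B0] [CommRing A] [CommRing R] [IsDomain A0] [IsDomain B0] [IsDomain A]
  [Field K0] [Field L0] [Field K]
  [Algebra A0 B0] [Algebra A0 K0] [Algebra A0 L0] [Algebra B0 L0] [Algebra K0 L0] [IsFractionRing A0 K0] [IsFractionRing B0 L0]
  [IsScalarTower A0 B0 L0] [IsScalarTower A0 K0 L0]
  [Algebra A0 A] [Algebra A K] [Algebra K0 K] [Algebra A0 K]
  [IsFractionRing A K] [IsScalarTower A0 A K] [IsScalarTower A0 K0 K] [Module.Finite A0 A]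
  [Algebra B0 R] [Algebra A R] [Algebra A0 R] [IsScalarTower A0 A R]
    [IsScalarTower A0 B0 R] [Module.Finite B0 R] [Module.Flat A R]

theorem exists_total_frac (hbij : Function.Bijective (compMap A0 B0 A R)) [IsIntegrallyClosed B0] {p : ℕ} [ExpChar K0 p]
    (h : FProp p (algebraMap A0 B0)) :
    ∃ j : R →+* L0 ⊗[K0] K, IsArtinianRing (L0 ⊗[K0] K) ∧ Function.Injective j ∧
      (∀ t, ∃ (b : B0) (r : R), IsUnit (j (algebraMap B0 R b)) ∧ j (algebraMap B0 R b) * t = j r) ∧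
      ∀ z, j.IsIntegralElem z → ∃ (a : A0) (r : R), a ≠ 0 ∧ j (algebraMap A0 R a) * z = j r := by
  obtain ⟨hden, hfd, n, x, e, d, hex, hd, hdA⟩ := exists_basis_denom A0 A K0 K
  have hneL : ∀ {a : A0}, a ≠ 0 → algebraMap A0 L0 a ≠ 0 := fun {a} ha => algebraMap_ne_zero_aux (K0 := K0) ha
  have hneK : ∀ {a : A0}, a ≠ 0 → algebraMap A0 K a ≠ 0 := fun {a} ha => algebraMap_ne_zero_aux (K0 := K0) ha
  have hAA : ∀ {a : A0}, a ≠ 0 → algebraMap A0 A a ≠ 0 := fun {a} ha h0 => hneK ha (by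
    rw [IsScalarTower.algebraMap_apply A0 A K, h0, map_zero])
  -- the two maps
  let f : A →ₐ[A0] L0 ⊗[K0] K :=
    { (Algebra.TensorProduct.includeRight (R := K0) (A := L0) (B := K)).toRingHom.comp (algebraMap A K) with
      commutes' := fun a => by
        change (1 : L0) ⊗ₜ[K0] algebraMap A K (algebraMap A0 A a) = algebraMap A0 L0 a ⊗ₜ[K0] (1 : K)
        rw [← IsScalarTower.algebraMap_apply, IsScalarTower.algebraMap_apply A0 K0 K, IsScalarTower.algebraMap_apply A0 K0 L0,
          Algebra.algebraMap_eq_smul_one (A := K), Algebra.algebraMap_eq_smul_one (A := L0), TensorProduct.smul_tmul] }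
  let g : B0 →ₐ[A0] L0 ⊗[K0] K :=
    { (algebraMap L0 (L0 ⊗[K0] K)).comp (algebraMap B0 L0) with
      commutes' := fun a => by
        change (algebraMap B0 L0 (algebraMap A0 B0 a)) ⊗ₜ[K0] (1 : K) = algebraMap A0 L0 a ⊗ₜ[K0] (1 : K)
        rw [← IsScalarTower.algebraMap_apply] }
  let E := AlgEquiv.ofBijective (compMap A0 B0 A R) hbij
  let J : A ⊗[A0] B0 →ₐ[A0] L0 ⊗[K0] K := Algebra.TensorProduct.productMap f g
  let j : R →+* L0 ⊗[K0] K := (J.comp E.symm.toAlgHom).toRingHom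
  have hjE : ∀ y, j (compMap A0 B0 A R y) = J y := fun y => congrArg J (E.symm_apply_apply y)
  have hjA : ∀ a, j (algebraMap A R a) = 1 ⊗ₜ algebraMap A K a := fun a => by
    have := hjE (a ⊗ₜ 1)
    rw [compMap_tmul, map_one, mul_one] at this
    rw [this]
    simp only [J, Algebra.TensorProduct.productMap_apply_tmul, map_one, mul_one]
    rfl
  have hjB : ∀ b, j (algebraMap B0 R b) = algebraMap B0 L0 b ⊗ₜ 1 := fun b => by
    have := hjE (1 ⊗ₜ b)
    rw [compMap_tmul, map_one, one_mul] at this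
    rw [this]
    simp only [J, Algebra.TensorProduct.productMap_apply_tmul, map_one, one_mul]
    rfl
  have hjA0 : ∀ a, j (algebraMap A0 R a) = algebraMap A0 L0 a ⊗ₜ 1 := fun a => by
    rw [IsScalarTower.algebraMap_apply A0 B0 R, hjB, ← IsScalarTower.algebraMap_apply]
  have hjA0' : ∀ a, j (algebraMap A0 R a) = 1 ⊗ₜ algebraMap A0 K a := fun a => by
    rw [IsScalarTower.algebraMap_apply A0 A R, hjA, ← IsScalarTower.algebraMap_apply]
  -- coordinates
  have hcoord : ∀ y : A ⊗[A0] B0, ∃ v : Fin n → B0, algebraMap A0 R d * compMap A0 B0 A R y = ∑ i, algebraMap A R (x i) * algebraMap B0 R (v i) := by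
    intro y
    induction y with
    | zero => exact ⟨0, by simp⟩
    | add y z hy hz =>
      obtain ⟨v, hv⟩ := hy
      obtain ⟨w, hw⟩ := hz
      exact ⟨v + w, by rw [map_add, mul_add, hv, hw, ← Finset.sum_add_distrib]; simp [mul_add]⟩
    | tmul a b =>
      obtain ⟨c, hc⟩ := hdA a
      refine ⟨fun i => algebraMap A0 B0 (c i) * b, ?_⟩
      rw [compMap_tmul, ← mul_assoc, IsScalarTower.algebraMap_apply A0 A R, ← map_mul, ← Algebra.smul_def d a, hc, map_sum, Finset.sum_mul]
      refine Finset.sum_congr rfl fun i _ => ?_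
      rw [Algebra.smul_def, map_mul, map_mul, ← IsScalarTower.algebraMap_apply, ← IsScalarTower.algebraMap_apply]; ring
  have hinj : Function.Injective j := by
    rw [injective_iff_map_eq_zero]
    intro r hr
    obtain ⟨y, rfl⟩ := hbij.2 r
    obtain ⟨v, hv⟩ := hcoord y
    have h1 : ∑ i, algebraMap B0 L0 (v i) • (Algebra.TensorProduct.basis L0 e) i = 0 := by
      have := congrArg j hv
      rw [map_mul, hr, mul_zero, map_sum] at this
      rw [this]
      refine Finset.sum_congr rfl fun i _ => ?_
      rw [map_mul, hjA, hjB, Algebra.TensorProduct.tmul_mul_tmul, Algebra.TensorProduct.basis_apply, TensorProduct.smul_tmul', hex]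
      simp
    have h2 := Fintype.linearIndependent_iff.1 (Algebra.TensorProduct.basis L0 e).linearIndependent _ h1
    have h3 : ∀ i, v i = 0 := fun i => IsFractionRing.injective B0 L0 (by rw [h2 i, map_zero])
    simp only [h3, map_zero, mul_zero, Finset.sum_const_zero] at hv
    rw [IsScalarTower.algebraMap_apply A0 A R, ← Algebra.smul_def] at hv
    exact (Module.Flat.isSMulRegular_of_isRegular (M := R) (IsRegular.of_ne_zero (hAA hd))) (by simpa using hv)
  refine ⟨j, ?_, hinj, ?_, ?_⟩
  · have : Module.Finite L0 (L0 ⊗[K0] K) := inferInstance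
    exact IsArtinianRing.of_finite L0 _
  · have hu : ∀ b : B0, b ≠ 0 → IsUnit (j (algebraMap B0 R b)) := by
      intro b hb
      rw [hjB]
      have hbL : algebraMap B0 L0 b ≠ 0 := by rwa [Ne, IsFractionRing.to_map_eq_zero_iff]
      exact IsUnit.map (algebraMap L0 (L0 ⊗[K0] K)) (IsUnit.mk0 _ hbL)
    suffices H : ∀ t, ∃ (b : B0) (r : R), b ≠ 0 ∧ j (algebraMap B0 R b) * t = j r by
      intro t
      obtain ⟨b, r, h1, h2⟩ := H t
      exact ⟨b, r, hu b h1, h2⟩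
    intro t
    induction t with
    | zero => exact ⟨1, 0, one_ne_zero, by simp⟩
    | add y z hy hz =>
      obtain ⟨b, r, hb, h⟩ := hy
      obtain ⟨b', r', hb', h'⟩ := hz
      refine ⟨b * b', algebraMap B0 R b' * r + algebraMap B0 R b * r', mul_ne_zero hb hb', ?_⟩
      rw [map_add j, map_mul j, map_mul j, ← h, ← h', map_mul, map_mul]; ring
    | tmul l k =>
      obtain ⟨b1, b2, hb2, rfl⟩ := IsFractionRing.div_surjective (A := B0) l
      have hb20 := nonZeroDivisors.ne_zero hb2
      have hb2L : algebraMap B0 L0 b2 ≠ 0 := by rwa [Ne, IsFractionRing.to_map_eq_zero_iff]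
      obtain ⟨a, a', ha, hak⟩ := hden k
      have haB : algebraMap A0 B0 a ≠ 0 := fun h0 => hneL ha (by rw [IsScalarTower.algebraMap_apply A0 B0 L0, h0, map_zero])
      refine ⟨b2 * algebraMap A0 B0 a, algebraMap A R a' * algebraMap B0 R b1, mul_ne_zero hb20 haB, ?_⟩
      rw [map_mul, map_mul, map_mul, ← IsScalarTower.algebraMap_apply, hjA0', hjA, hjB, hjB, Algebra.TensorProduct.tmul_mul_tmul,
        Algebra.TensorProduct.tmul_mul_tmul, Algebra.TensorProduct.tmul_mul_tmul, mul_one, one_mul, one_mul, mul_one, hak,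
        mul_div_cancel₀ _ hb2L]
  · intro z hz
    have hG := integral_tensor (L0 := L0) (K0 := K0) h K
    have hz1 : IsIntegral (subB A0 B0 K0 L0) z := by
      have h2 : (j.comp (algebraMap B0 R)).IsIntegralElem z := integralElem_trans j hz
      let f : B0 →+* subB A0 B0 K0 L0 := (algebraMap B0 L0).codRestrict (subB A0 B0 K0 L0).toSubring fun b => ⟨1, one_ne_zero, b, by simp⟩
      have h3 : j.comp (algebraMap B0 R) = (algebraMap (subB A0 B0 K0 L0) (L0 ⊗[K0] K)).comp f := by
        ext b
        exact hjB b
      rw [h3] at h2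
      exact h2.of_comp
    have hz2 := hG z hz1
    clear hz hz1
    induction hz2 using Submodule.span_induction with
    | mem y hy =>
      obtain ⟨k, rfl⟩ := hy
      obtain ⟨a, a', ha, hak⟩ := hden k
      exact ⟨a, algebraMap A R a', ha, by simp only [hjA0', hjA, Algebra.TensorProduct.tmul_mul_tmul, one_mul, hak]⟩
    | zero => exact ⟨1, 0, one_ne_zero, by simp⟩
    | add y z _ _ hy hz =>
      obtain ⟨b, r, hb, h⟩ := hy
      obtain ⟨b', r', hb', h'⟩ := hz
      refine ⟨b * b', algebraMap A0 R b' * r + algebraMap A0 R b * r', mul_ne_zero hb hb', ?_⟩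
      rw [map_add j, map_mul j, map_mul j, ← h, ← h', map_mul, map_mul]; ring
    | smul s y _ hy =>
      obtain ⟨b, r, hb, h⟩ := hy
      obtain ⟨s, a, ha, b', hs⟩ := s
      refine ⟨a * b, algebraMap B0 R b' * r, mul_ne_zero ha hb, ?_⟩
      rw [Algebra.smul_def]
      change _ * ((s ⊗ₜ 1) * y) = _
      rw [map_mul j, map_mul, map_mul, ← h, hjB, ← hs, hjA0 a]
      have : (algebraMap A0 L0 a * s) ⊗ₜ[K0] (1 : K) = (algebraMap A0 L0 a ⊗ₜ 1) * (s ⊗ₜ 1) := by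
        rw [Algebra.TensorProduct.tmul_mul_tmul, one_mul]
      rw [this]; ring
end

theorem intRel_of_frac {R T : Type*} [CommRing R] [CommRing T] (j : R →+* T) (hj : Function.Injective j) {b y r a : R} {z : T}
    (hy : IsUnit (j y)) (hrel : IntRel b y) (hz : j y * z = j b) (hr : j a * z = j r) : IntRel r a ∧ a * b = y * r := by
  obtain ⟨p, hp, h⟩ := hrel
  refine ⟨⟨p, hp, hj ?_⟩, hj ?_⟩
  · have h1 := congrArg j h
    rw [map_zero, map_sum] at h1 ⊢
    have h2 : j y ^ p.natDegree * ∑ i ∈ Finset.range (p.natDegree + 1), j (p.coeff i) * z ^ i = 0 := by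
      rw [← h1, Finset.mul_sum]
      refine Finset.sum_congr rfl fun i hi => ?_
      have hi' : p.natDegree = i + (p.natDegree - i) := by have := Finset.mem_range.1 hi; omega
      rw [map_mul, map_mul, map_pow, map_pow, ← hz, mul_pow]
      conv_lhs => rw [hi', pow_add]
      ring
    have h3 := (hy.pow _).mul_right_eq_zero.1 h2
    have h4 : j a ^ p.natDegree * ∑ i ∈ Finset.range (p.natDegree + 1), j (p.coeff i) * z ^ i = 0 := by rw [h3, mul_zero]
    rw [← h4, Finset.mul_sum]
    refine Finset.sum_congr rfl fun i hi => ?_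
    have hi' : p.natDegree = i + (p.natDegree - i) := by have := Finset.mem_range.1 hi; omega
    rw [map_mul, map_mul, map_pow, map_pow, ← hr, mul_pow]
    conv_rhs => rw [hi', pow_add]
    ring
  · rw [map_mul, map_mul, ← hz, ← hr]; ring

theorem isIntegralElem_of_frac {R T : Type*} [CommRing R] [CommRing T] (j : R →+* T) {b y : R} {z : T}
    (hy : IsUnit (j y)) (hrel : IntRel b y) (hz : j y * z = j b) : j.IsIntegralElem z := by
  obtain ⟨p, hp, h⟩ := hrel
  refine ⟨p, hp, ?_⟩
  have h1 := congrArg j h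
  rw [map_zero, map_sum] at h1
  rw [Polynomial.eval₂_eq_sum_range]
  refine (hy.pow p.natDegree).mul_right_eq_zero.1 ?_
  rw [← h1, Finset.mul_sum]
  refine Finset.sum_congr rfl fun i hi => ?_
  have hi' : p.natDegree = i + (p.natDegree - i) := by have := Finset.mem_range.1 hi; omega
  rw [map_mul, map_mul, map_pow, map_pow, ← hz, mul_pow]
  conv_lhs => rw [hi', pow_add]
  ring

theorem exists_denominator_aux (A0 B0 A R : Type*) [CommRing A0] [CommRing B0] [CommRing A] [CommRing R] [IsDomain A0] [IsDomain B0] [IsDomain A]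
  [Algebra A0 B0] [FaithfulSMul A0 B0]
  [Algebra A0 A] [FaithfulSMul A0 A] [Module.Finite A0 A]
  [Algebra B0 R] [Algebra A R] [Algebra A0 R] [IsScalarTower A0 A R]
    [IsScalarTower A0 B0 R] [Module.Finite B0 R] [Module.Flat A R]
    (hbij : Function.Bijective (compMap A0 B0 A R)) [IsIntegrallyClosed B0] {p : ℕ} [ExpChar A p]
    (h : FProp p (algebraMap A0 B0)) {b y : R} (hy : y ∈ nonZeroDivisors R) (hrel : IntRel b y) :
    ∃ (a : A) (r : R), a ≠ 0 ∧ IntRel r (algebraMap A R a) ∧ algebraMap A R a * b = y * r := by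
  let K0 := FractionRing A0
  let L0 := FractionRing B0
  let K := FractionRing A
  have hinjL : Function.Injective (algebraMap A0 L0) := by
    rw [IsScalarTower.algebraMap_eq A0 B0 L0]
    exact (IsFractionRing.injective B0 L0).comp (FaithfulSMul.algebraMap_injective A0 B0)
  have hinjK : Function.Injective (algebraMap A0 K) := by
    rw [IsScalarTower.algebraMap_eq A0 A K]
    exact (IsFractionRing.injective A K).comp (FaithfulSMul.algebraMap_injective A0 A)
  let _ : Algebra K0 L0 := (IsFractionRing.lift (K := K0) hinjL).toAlgebra
  let _ : Algebra K0 K := (IsFractionRing.lift (K := K0) hinjK).toAlgebra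
  have : IsScalarTower A0 K0 L0 := IsScalarTower.of_algebraMap_eq fun a => (IsFractionRing.lift_algebraMap hinjL a).symm
  have : IsScalarTower A0 K0 K := IsScalarTower.of_algebraMap_eq fun a => (IsFractionRing.lift_algebraMap hinjK a).symm
  have : ExpChar K p := expChar_of_injective_algebraMap (IsFractionRing.injective A K) p
  have : ExpChar K0 p := (RingHom.expChar_iff (algebraMap K0 K) (algebraMap K0 K).injective p).2 this
  obtain ⟨j, hart, hinj, hden, hIntg⟩ := exists_total_frac A0 B0 A R K0 L0 K hbij h
  have hyT : j y ∈ nonZeroDivisors (L0 ⊗[K0] K) := by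
    rw [mem_nonZeroDivisors_iff_right]
    intro t ht
    obtain ⟨b', r, hb', hr⟩ := hden t
    have h1 : j (r * y) = 0 := by rw [map_mul, ← hr, mul_assoc, ht, mul_zero]
    have h2 : r * y = 0 := hinj (by rw [h1, map_zero])
    have h3 : r = 0 := mem_nonZeroDivisors_iff_right.1 hy r h2
    rw [h3, map_zero] at hr
    exact hb'.mul_right_eq_zero.1 hr
  have hyu : IsUnit (j y) := IsArtinianRing.isUnit_of_mem_nonZeroDivisors hyT
  obtain ⟨z, hz⟩ : ∃ z, j y * z = j b := ⟨hyu.unit⁻¹ * j b, by rw [← mul_assoc, IsUnit.mul_val_inv, one_mul]⟩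
  obtain ⟨a, r, ha, har⟩ := hIntg z (isIntegralElem_of_frac j hyu hrel hz)
  obtain ⟨h1, h2⟩ := intRel_of_frac j hinj hyu hrel hz har
  refine ⟨algebraMap A0 A a, r, ?_, ?_, ?_⟩
  · rwa [Ne, FaithfulSMul.algebraMap_eq_zero_iff]
  · rwa [← IsScalarTower.algebraMap_apply]
  · rwa [← IsScalarTower.algebraMap_apply]

theorem exists_denominator (A : Type u) (R : Type v)
    [CommRing A] [CommRing R] [IsLocalRing A] [IsLocalRing R] [IsDomain A]
    [Algebra A R] [IsNoetherianRing A] [IsNoetherianRing R] [IsAdicComplete (maximalIdeal A) A]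
    [IsAdicComplete (maximalIdeal R) R] [IsLocalHom (algebraMap A R)] [Module.Flat A R]
    (hred : ∀ (L : Type u) [Field L] [Algebra (ResidueField A) L] [FiniteDimensional (ResidueField A) L],
      IsReduced (ResidueField R ⊗[ResidueField A] L))
    (hmax : maximalIdeal R = (maximalIdeal A).map (algebraMap A R))
    {b y : R} (hy : y ∈ nonZeroDivisors R) (hrel : IntRel b y) :
    ∃ (a : A) (r : R), a ≠ 0 ∧ IntRel r (algebraMap A R a) ∧ algebraMap A R a * b = y * r := by
  obtain ⟨p, d, J, hexp, ⟨n, hn⟩, hd, ⟨T⟩⟩ := exists_tower A R hred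
  obtain ⟨A0, B0, ψ, α, β, comm, mapψ, mapα, gen, surα, surβ, char, fprop⟩ := T
  let _ : Algebra A0 A := α.toAlgebra
  let _ : Algebra A0 B0 := ψ.toAlgebra
  let _ : Algebra B0 R := β.toAlgebra
  let _ : Algebra A0 R := ((algebraMap A R).comp α).toAlgebra
  have : IsScalarTower A0 A R := IsScalarTower.of_algebraMap_eq fun _ => rfl
  have : IsScalarTower A0 B0 R := IsScalarTower.of_algebraMap_eq fun a => RingHom.congr_fun comm a
  have hnA : maximalIdeal A ^ n ≤ (maximalIdeal A0).map (algebraMap A0 A) := by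
    change _ ≤ (maximalIdeal A0).map α
    rw [mapα]; exact hn
  have hαloc : (maximalIdeal A0).map (algebraMap A0 A) ≤ maximalIdeal A := by
    rw [Ideal.map_le_iff_le_comap]
    have hmx : (RingHom.ker ((residue A).comp α)).IsMaximal := RingHom.ker_isMaximal_of_surjective _ surα
    have h1 := IsLocalRing.eq_maximalIdeal hmx
    intro x hx
    rw [← h1, RingHom.mem_ker] at hx
    rw [Ideal.mem_comap]
    exact (residue_eq_zero_iff _).1 hx
  have hβeq : (maximalIdeal B0).map (algebraMap B0 R) = ((maximalIdeal A0).map (algebraMap A0 A)).map (algebraMap A R) := by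
    rw [← mapψ, Ideal.map_map, Ideal.map_map]
    congr 1
    exact comm.symm
  have hβloc : (maximalIdeal B0).map (algebraMap B0 R) ≤ maximalIdeal R := by
    rw [hβeq, hmax]
    exact Ideal.map_mono hαloc
  have hnR : maximalIdeal R ^ n ≤ (maximalIdeal B0).map (algebraMap B0 R) := by
    rw [hβeq, hmax, ← Ideal.map_pow]
    exact Ideal.map_mono hnA
  have : Module.Finite A0 A := finite_of_complete hαloc hnA surα
  have : Module.Finite B0 R := finite_of_complete hβloc hnR surβ
  have hinj := injective_of_dim (A := A) d gen hd
  have hlh : IsLocalHom (algebraMap B0 R) := by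
    refine ⟨fun a ha => ?_⟩
    by_contra h
    exact (mem_maximalIdeal _).1 (hβloc (Ideal.mem_map_of_mem _ ((mem_maximalIdeal a).2 h))) ha
  have hs := compMap_surjective (A := A) hmax mapψ hnA surβ
  have hi := compMap_injective (A := A) hmax hαloc mapψ hnA surα hs
  have hff : Module.FaithfullyFlat A R := Module.FaithfullyFlat.of_flat_of_isLocalHom
  have : FaithfulSMul A0 A := (faithfulSMul_iff_algebraMap_injective A0 A).2 hinj
  have : FaithfulSMul A0 B0 := by
    rw [faithfulSMul_iff_algebraMap_injective]
    have h1 : Function.Injective ((algebraMap B0 R).comp (algebraMap A0 B0)) := by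
      have h2 : (algebraMap B0 R).comp (algebraMap A0 B0) = (algebraMap A R).comp (algebraMap A0 A) := comm.symm
      rw [h2]
      exact (FaithfulSMul.algebraMap_injective A R).comp hinj
    exact Function.Injective.of_comp h1
  exact exists_denominator_aux A0 B0 A R ⟨hi, hs⟩ fprop hy hrel

theorem IntRel.mul {S : Type*} [CommRing S] {b y : S} (h : IntRel b y) (s : S) : IntRel (s * b) (s * y) := by
  obtain ⟨p, hp, h⟩ := h
  refine ⟨p, hp, ?_⟩
  rw [← mul_zero (s ^ p.natDegree), ← h, Finset.mul_sum]
  refine Finset.sum_congr rfl fun i hi => ?_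
  have hi' : p.natDegree = i + (p.natDegree - i) := by have := Finset.mem_range.1 hi; omega
  rw [mul_pow, mul_pow]
  conv_rhs => rw [hi', pow_add]
  simp only [Nat.add_sub_cancel_left]
  ring

theorem IntRel.cancel {S : Type*} [CommRing S] {b y s : S} (hs : ∀ x, s * x = 0 → x = 0) (h : IntRel (s * b) (s * y)) : IntRel b y := by
  obtain ⟨p, hp, h⟩ := h
  refine ⟨p, hp, ?_⟩
  have hs' : ∀ n x, s ^ n * x = 0 → x = 0 := by
    intro n
    induction n with
    | zero => intro x hx; simpa using hx
    | succ n ih => intro x hx; exact ih x (hs _ (by rw [← hx]; ring))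
  apply hs' p.natDegree
  rw [← h, Finset.mul_sum]
  refine Finset.sum_congr rfl fun i hi => ?_
  have hi' : p.natDegree = i + (p.natDegree - i) := by have := Finset.mem_range.1 hi; omega
  rw [mul_pow, mul_pow]
  conv_lhs => rw [hi', pow_add]
  simp only [Nat.add_sub_cancel_left]
  ring

theorem IntRel.pow_mem {S : Type*} [CommRing S] {b y : S} (h : IntRel b y) (I : Ideal S) (hy : y ∈ I) : ∃ n, b ^ n ∈ I := by
  obtain ⟨p, hp, h⟩ := h
  refine ⟨p.natDegree, ?_⟩
  rw [Finset.sum_range_succ, hp.coeff_natDegree, Nat.sub_self, pow_zero, mul_one, one_mul] at h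
  rw [eq_neg_of_add_eq_zero_right h]
  refine I.neg_mem (Ideal.sum_mem _ fun i hi => ?_)
  have := Finset.mem_range.1 hi
  exact I.mul_mem_left _ (I.pow_mem_of_mem hy _ (by omega))

theorem exists_uniformizer {A : Type*} [CommRing A] [IsDomain A] [IsNoetherianRing A] [IsIntegrallyClosed A]
    {a c : A} (ha : a ≠ 0) (P : Ideal A) [P.IsPrime] (hP : ∀ x, x ∈ P ↔ a ∣ x * c) :
    ∃ t ∈ P, ∃ u ∉ P, t ≠ 0 ∧ ∀ x ∈ P, t ∣ u * x := by
  have haP : a ∈ P := (hP a).2 (dvd_mul_right _ _)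
  have key : ∃ t ∈ P, ∃ u ∉ P, t * c = a * u := by
    by_contra! hcon
    let K := FractionRing A
    have haK : algebraMap A K a ≠ 0 := by rwa [Ne, IsFractionRing.to_map_eq_zero_iff]
    have hIntg : IsIntegral A (algebraMap A K c / algebraMap A K a) := by
      refine isIntegral_of_smul_mem_submodule (R := A) (A := K) (M := K) (Submodule.map (Algebra.linearMap A K) P) ?_ ?_ _ ?_
      · intro h0
        have : algebraMap A K a ∈ Submodule.map (Algebra.linearMap A K) P := ⟨a, haP, rfl⟩
        rw [h0] at this
        exact haK this
      · exact Submodule.FG.map _ (IsNoetherian.noetherian P)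
      · rintro _ ⟨x, hx, rfl⟩
        obtain ⟨u, hu⟩ := (hP x).1 hx
        have huP : u ∈ P := by
          by_contra hu'
          exact hcon x hx u hu' hu
        refine ⟨u, huP, ?_⟩
        rw [Algebra.linearMap_apply, Algebra.linearMap_apply, smul_eq_mul, div_mul_eq_mul_div, eq_div_iff haK, ← map_mul, ← map_mul, mul_comm u, ← hu, mul_comm]
    obtain ⟨d, hd⟩ := IsIntegrallyClosed.algebraMap_eq_of_integral hIntg
    rw [eq_div_iff haK, ← map_mul] at hd
    have hd' := IsFractionRing.injective A K hd
    have : (1 : A) ∈ P := (hP 1).2 ⟨d, by rw [one_mul, ← hd', mul_comm]⟩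
    exact (Ideal.ne_top_iff_one P).1 Ideal.IsPrime.ne_top' this
  obtain ⟨t, ht, u, hu, htu⟩ := key
  have hu0 : u ≠ 0 := fun h => hu (h ▸ P.zero_mem)
  refine ⟨t, ht, u, hu, ?_, ?_⟩
  · rintro rfl
    rw [zero_mul] at htu
    exact mul_ne_zero ha hu0 htu.symm
  · intro x hx
    obtain ⟨x', hx'⟩ := (hP x).1 hx
    refine ⟨x', mul_left_cancel₀ ha ?_⟩
    calc a * (u * x) = (a * u) * x := by ring
      _ = t * (x * c) := by rw [← htu]; ring
      _ = a * (t * x') := by rw [hx']; ring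

theorem exists_not_mem_dvd {A R : Type*} [CommRing A] [IsDomain A] [IsNoetherianRing A] [CommRing R] [Algebra A R] [Module.Flat A R]
    (P : Ideal A) [P.IsPrime] (hred : ∀ (n : ℕ) (b : R), b ^ n ∈ P.map (algebraMap A R) → b ∈ P.map (algebraMap A R))
    {t u : A} (htP : t ∈ P) (hu : u ∉ P) (ht0 : t ≠ 0) (htu : ∀ x ∈ P, t ∣ u * x) (a : A) (ha : a ≠ 0) (b : R)
    (hrel : IntRel b (algebraMap A R a)) : ∃ s ∉ P, algebraMap A R a ∣ algebraMap A R s * b := by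
  have hreg : ∀ {a : A}, a ≠ 0 → ∀ x : R, algebraMap A R a * x = 0 → x = 0 := by
    intro a ha x hx
    rw [← Algebra.smul_def] at hx
    exact (Module.Flat.isSMulRegular_of_isRegular (M := R) (IsRegular.of_ne_zero ha)) (by simpa using hx)
  have hu0 : u ≠ 0 := fun h => hu (h ▸ P.zero_mem)
  have hle : P.primeCompl ≤ nonZeroDivisors A := P.primeCompl_le_nonZeroDivisors
  have : IsDomain (Localization.AtPrime P) := IsLocalization.isDomain_localization hle
  have hinj : Function.Injective (algebraMap A (Localization.AtPrime P)) := IsLocalization.injective _ hle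
  obtain ⟨I, hI⟩ : ∃ I : Ideal (Localization.AtPrime P), I = Ideal.span {algebraMap A (Localization.AtPrime P) a} := ⟨_, rfl⟩
  induction I using WellFoundedGT.induction generalizing a b with
  | _ I ih =>
  by_cases haP : a ∈ P
  · have hb : b ∈ P.map (algebraMap A R) := by
      obtain ⟨n, hn⟩ := hrel.pow_mem (P.map (algebraMap A R)) (Ideal.mem_map_of_mem _ haP)
      exact hred n b hn
    have hub : algebraMap A R t ∣ algebraMap A R u * b := by
      clear hrel
      rw [← Ideal.mem_span_singleton]
      induction hb using Submodule.span_induction with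
      | mem y hy =>
        obtain ⟨x, hx, rfl⟩ := hy
        rw [← map_mul, Ideal.mem_span_singleton]
        exact map_dvd _ (htu x hx)
      | zero => simp
      | add y z _ _ hy hz => rw [mul_add]; exact add_mem hy hz
      | smul r y _ hy => rw [smul_eq_mul, mul_left_comm]; exact Ideal.mul_mem_left _ _ hy
    obtain ⟨a1, ha1⟩ := htu a haP
    obtain ⟨b1, hb1⟩ := hub
    have ha10 : a1 ≠ 0 := by
      rintro rfl
      rw [mul_zero] at ha1
      exact mul_ne_zero hu0 ha ha1
    have h1 : IntRel b1 (algebraMap A R a1) := by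
      have := hrel.mul (algebraMap A R u)
      rw [hb1, ← map_mul, ha1, map_mul] at this
      exact this.cancel (hreg ht0)
    obtain ⟨s, hs, b', hb'⟩ := ih _ (by
      rw [hI, Ideal.span_singleton_lt_span_singleton]
      have huu : IsUnit (algebraMap A (Localization.AtPrime P) u) := IsLocalization.map_units (M := P.primeCompl) _ ⟨u, hu⟩
      refine ⟨fun h => ha10 (hinj (by rw [h, map_zero])), algebraMap A _ t * ↑(huu.unit⁻¹), ?_, ?_⟩
      · intro h
        have h2 := isUnit_of_mul_isUnit_left h
        rw [IsLocalization.AtPrime.isUnit_to_map_iff (Localization.AtPrime P) P] at h2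
        exact h2 htP
      · rw [mul_comm, mul_assoc, mul_comm _ (algebraMap A _ a1), ← mul_assoc, ← map_mul, ← ha1, map_mul,
          mul_right_comm, IsUnit.mul_val_inv, one_mul]) a1 ha10 b1 h1 rfl
    refine ⟨s, hs, b', ?_⟩
    have : algebraMap A R u * (algebraMap A R s * b - algebraMap A R a * b') = 0 := by
      calc _ = algebraMap A R s * (algebraMap A R u * b) - algebraMap A R (u * a) * b' := by rw [map_mul]; ring
        _ = algebraMap A R t * (algebraMap A R s * b1 - algebraMap A R a1 * b') := by rw [hb1, ha1, map_mul]; ring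
        _ = 0 := by rw [hb']; ring
    exact sub_eq_zero.1 (hreg hu0 _ this)
  · exact ⟨a, haP, dvd_mul_right _ _⟩

/-- Lemma I -/
theorem dvd_of_intRel_base {A R : Type*} [CommRing A] [IsDomain A] [IsNoetherianRing A] [IsIntegrallyClosed A] [CommRing R] [Algebra A R] [Module.Flat A R]
    (hred : ∀ (P : Ideal A) [P.IsPrime] (n : ℕ) (b : R), b ^ n ∈ P.map (algebraMap A R) → b ∈ P.map (algebraMap A R))
    (a : A) (ha : a ≠ 0) (b : R) (hrel : IntRel b (algebraMap A R a)) : algebraMap A R a ∣ b := by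
  let I : Ideal A := 
    { carrier := {s | algebraMap A R a ∣ algebraMap A R s * b}
      add_mem' := fun {x y} hx hy => by
        change algebraMap A R a ∣ algebraMap A R (x + y) * b
        rw [map_add, add_mul]; exact dvd_add hx hy
      zero_mem' := by
        change algebraMap A R a ∣ algebraMap A R 0 * b
        simp
      smul_mem' := fun c x hx => by
        change algebraMap A R a ∣ algebraMap A R (c • x) * b
        rw [smul_eq_mul, map_mul, mul_assoc]; exact Dvd.dvd.mul_left hx _ }
  have hfin := associatedPrimes.finite A (A ⧸ Ideal.span {a})
  have hnot : ¬ ((I : Set A) ⊆ ⋃ p ∈ associatedPrimes A (A ⧸ Ideal.span {a}), (p : Set A)) := by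
    rw [Ideal.subset_union_prime_finite hfin (f := fun p => p) ⊥ ⊥ (fun i hi _ _ => hi.1)]
    rintro ⟨P, hP, hIP⟩
    obtain ⟨hPp, x, hx⟩ := isAssociatedPrime_iff.1 hP
    obtain ⟨c, rfl⟩ := Ideal.Quotient.mk_surjective x
    have hP' : ∀ x, x ∈ P ↔ a ∣ x * c := by
      intro x
      rw [hx, Submodule.mem_colon_singleton, Submodule.mem_bot, Algebra.smul_def, ← Ideal.mem_span_singleton, ← Ideal.Quotient.eq_zero_iff_mem, map_mul]
      rfl
    obtain ⟨t, ht, u, hu, ht0, htu⟩ := exists_uniformizer ha P hP'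
    obtain ⟨s, hs, hsb⟩ := exists_not_mem_dvd P (hred P) ht hu ht0 htu a ha b hrel
    exact hs (hIP hsb)
  rw [biUnion_associatedPrimes_eq_zero_divisors, Set.not_subset] at hnot
  obtain ⟨s, ⟨r, hr⟩, hs⟩ := hnot
  have hs' : ∀ x, a ∣ s * x → a ∣ x := by
    intro x hx
    by_contra hcon
    refine hs ⟨Ideal.Quotient.mk _ x, ?_, ?_⟩
    · rwa [Ne, Ideal.Quotient.eq_zero_iff_mem, Ideal.mem_span_singleton]
    · rw [Algebra.smul_def]
      change Ideal.Quotient.mk _ s * Ideal.Quotient.mk _ x = 0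
      rwa [← map_mul, Ideal.Quotient.eq_zero_iff_mem, Ideal.mem_span_singleton]
  have h0 : ∑ i : Fin 2, (![s, -a] : Fin 2 → A) i • (![b, r] : Fin 2 → R) i = 0 := by
    simp [Fin.sum_univ_two, Algebra.smul_def, hr]
  obtain ⟨k, α, y, h1, h2⟩ := Module.Flat.isTrivialRelation_of_sum_smul_eq_zero (R := A) (M := R) (f := ![s, -a]) (x := ![b, r]) h0
  have h10 := h1 0
  simp only [Matrix.cons_val_zero] at h10
  rw [h10]
  refine Finset.dvd_sum fun j _ => ?_
  rw [Algebra.smul_def]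
  refine Dvd.dvd.mul_right (map_dvd _ (hs' _ ⟨α 1 j, ?_⟩)) _
  have := h2 j
  simp [Fin.sum_univ_two] at this
  linear_combination this

theorem includeRight_surj {A K X : Type*} [CommRing A] [CommRing K] [CommRing X] [Algebra A K] [Algebra A X]
    (h : Function.Surjective (algebraMap A K)) (t : K ⊗[A] X) : ∃ x : X, (1 : K) ⊗ₜ[A] x = t := by
  induction t with
  | zero => exact ⟨0, tmul_zero _ _⟩
  | add y z hy hz =>
    obtain ⟨y, rfl⟩ := hy
    obtain ⟨z, rfl⟩ := hz
    exact ⟨y + z, tmul_add _ _ _⟩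
  | tmul k x =>
    obtain ⟨a, rfl⟩ := h k
    exact ⟨a • x, by rw [← smul_tmul, Algebra.algebraMap_eq_smul_one]⟩

theorem mem_map_ker_of_one_tmul {A : Type u} {S : Type v} {W : Type u} [CommRing A] [CommRing S] [CommRing W]
    [Algebra A S] [Algebra A W] [Module.Flat A S] {s : S} (h : (1 : W) ⊗ₜ[A] s = 0) :
    s ∈ (RingHom.ker (algebraMap A W)).map (algebraMap A S) := by
  apply mem_map_ker_of_tmul_eq_zero
  have := congrArg (TensorProduct.comm A W S) h
  rw [comm_tmul, map_zero] at this
  exact this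

theorem one_tmul_eq_zero {A : Type u} {S : Type v} {W : Type u} [CommRing A] [CommRing S] [CommRing W]
    [Algebra A S] [Algebra A W] {s : S} {I : Ideal A} (hI : ∀ a ∈ I, algebraMap A W a = 0) (h : s ∈ I.map (algebraMap A S)) :
    (1 : W) ⊗ₜ[A] s = 0 := by
  induction h using Submodule.span_induction with
  | mem y hy =>
    obtain ⟨a, ha, rfl⟩ := hy
    rw [Algebra.algebraMap_eq_smul_one, ← smul_tmul, ← Algebra.algebraMap_eq_smul_one, hI a ha, zero_tmul]
  | zero => exact tmul_zero _ _
  | add y z _ _ hy hz => rw [tmul_add, hy, hz, add_zero]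
  | smul r y _ hy =>
    have : (1 : W) ⊗ₜ[A] (r • y) = (1 ⊗ₜ r) * (1 ⊗ₜ y) := by simp
    rw [this, hy, mul_zero]

theorem reduced_quot_aux {A : Type u} {S : Type v} {D : Type u} [CommRing A] [IsLocalRing A] [IsNoetherianRing A]
    [IsAdicComplete (maximalIdeal A) A]
    [CommRing S] [IsLocalRing S] [IsNoetherianRing S] [Algebra A S] [IsLocalHom (algebraMap A S)]
    [Module.Flat A S]
    (hS : ∀ (L : Type u) [Field L] [Algebra A L] [Module.Finite A L], IsNormalRing (S ⊗[A] L))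
    [CommRing D] [IsDomain D] [Algebra A D] (hD : Function.Surjective (algebraMap A D)) : IsReduced (D ⊗[A] S) := by
  have : IsLocalRing D := IsLocalRing.of_surjective' _ hD
  have : IsNoetherianRing D := isNoetherianRing_of_surjective A D _ hD
  have : IsAdicComplete (maximalIdeal D) D := isAdicComplete_of_surjective _ hD
  have hsurj : Function.Surjective (Algebra.TensorProduct.includeRight : S →ₐ[A] D ⊗[A] S).toRingHom :=
    fun t => includeRight_surj hD t
  have : Nontrivial (D ⊗[A] S) := by
    refine ⟨1, 0, fun h => ?_⟩
    have h1 : (1 : S) ∈ (RingHom.ker (algebraMap A D)).map (algebraMap A S) := mem_map_ker_of_one_tmul h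
    have h2 : (RingHom.ker (algebraMap A D)).map (algebraMap A S) ≤ maximalIdeal S := by
      rw [Ideal.map_le_iff_le_comap, maximalIdeal_comap]
      exact IsLocalRing.le_maximalIdeal (RingHom.ker_ne_top _)
    exact (Ideal.ne_top_iff_one _).1 Ideal.IsPrime.ne_top' (h2 h1)
  have : IsLocalRing (D ⊗[A] S) := IsLocalRing.of_surjective' _ hsurj
  have : IsNoetherianRing (D ⊗[A] S) := isNoetherianRing_of_surjective S _ _ hsurj
  have : IsLocalHom (algebraMap A D) := IsLocalHom.of_surjective _ hD
  have : IsLocalHom (algebraMap D (D ⊗[A] S)) := by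
    refine ⟨fun d hd => ?_⟩
    obtain ⟨a, rfl⟩ := hD d
    have hl : IsLocalHom (Algebra.TensorProduct.includeRight : S →ₐ[A] D ⊗[A] S).toRingHom := IsLocalHom.of_surjective _ hsurj
    have h1 : algebraMap D (D ⊗[A] S) (algebraMap A D a) = (Algebra.TensorProduct.includeRight : S →ₐ[A] D ⊗[A] S).toRingHom (algebraMap A S a) := by
      change algebraMap A D a ⊗ₜ[A] (1 : S) = 1 ⊗ₜ algebraMap A S a
      rw [Algebra.algebraMap_eq_smul_one, Algebra.algebraMap_eq_smul_one, smul_tmul]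
    rw [h1] at hd
    exact IsUnit.map _ (isUnit_of_map_unit (algebraMap A S) _ (hl.1 _ hd))
  refine eq_zero_of_intRel_zero (A := D) ?_
  intro L _ _ _
  let _ : Algebra A L := ((algebraMap D L).comp (algebraMap A D)).toAlgebra
  have : IsScalarTower A D L := IsScalarTower.of_algebraMap_eq fun _ => rfl
  have : Module.Finite A D := Module.Finite.of_surjective (Algebra.linearMap A D) hD
  have : Module.Finite A L := Module.Finite.trans D L
  exact (hS L).of_ringEquiv ((Algebra.TensorProduct.comm A S L).toRingEquiv.trans
    ((Algebra.TensorProduct.cancelBaseChange A D L L S).symm.toRingEquiv.trans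
      (Algebra.TensorProduct.comm D L (D ⊗[A] S)).toRingEquiv))

theorem mem_map_of_pow_mem {A : Type u} {S : Type v} [CommRing A] [IsLocalRing A] [IsNoetherianRing A]
    [IsAdicComplete (maximalIdeal A) A]
    [CommRing S] [IsLocalRing S] [IsNoetherianRing S] [Algebra A S] [IsLocalHom (algebraMap A S)]
    [Module.Flat A S]
    (hS : ∀ (L : Type u) [Field L] [Algebra A L] [Module.Finite A L], IsNormalRing (S ⊗[A] L))
    (P : Ideal A) [P.IsPrime] (n : ℕ) (b : S) (hb : b ^ n ∈ P.map (algebraMap A S)) : b ∈ P.map (algebraMap A S) := by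
  have hr := reduced_quot_aux (D := A ⧸ P) hS Ideal.Quotient.mk_surjective
  have h1 : ((1 : A ⧸ P) ⊗ₜ[A] b) ^ n = 0 := by
    rw [Algebra.TensorProduct.tmul_pow, one_pow]
    exact one_tmul_eq_zero (fun a ha => Ideal.Quotient.eq_zero_iff_mem.2 ha) hb
  have h2 := mem_map_ker_of_one_tmul (eq_zero_of_pow_eq_zero h1)
  have h3 : RingHom.ker (algebraMap A (A ⧸ P)) = P := Ideal.mk_ker
  rwa [h3] at h2

theorem isNormalRing_of_isReduced {T : Type*} [CommRing T] [IsArtinianRing T] [IsReduced T] : IsNormalRing T := by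
  intro P hP
  have : IsReduced (Localization.AtPrime P) := inferInstance
  have : IsArtinianRing (Localization.AtPrime P) := inferInstance
  have hf : IsField (Localization.AtPrime P) := IsArtinianRing.isField_of_isReduced_of_isLocalRing _
  let _ := hf.toField
  exact ⟨hf.isDomain, inferInstance⟩

theorem IsNormalRing.isReduced {T : Type*} [CommRing T] (h : IsNormalRing T) : IsReduced T := by
  refine ⟨fun x hx => ?_⟩
  have : (0 : T) ∣ x := dvd_of_forall_localization fun M hM => by
    have := (h M inferInstance).1
    rw [map_zero, (hx.map (algebraMap T (Localization.AtPrime M))).eq_zero]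
  exact zero_dvd_iff.1 this

/-- fibre tensor a field -/
theorem exists_tensor_equiv {A : Type u} {X : Type v} [CommRing A] [IsLocalRing A]
    [CommRing X] [IsLocalRing X] [Algebra A X] [IsLocalHom (algebraMap A X)]
    (hmax : maximalIdeal X = (maximalIdeal A).map (algebraMap A X))
    (L : Type u) [Field L] [Algebra (ResidueField A) L] [Algebra A L] [IsScalarTower A (ResidueField A) L] :
    Nonempty (X ⊗[A] L ≃+* ResidueField X ⊗[ResidueField A] L) := by
  have : IsScalarTower A X (ResidueField X) := inferInstance
  have : IsScalarTower A (ResidueField A) (ResidueField X) := IsScalarTower.of_algebraMap_eq fun _ => rfl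
  let f : ResidueField A ⊗[A] X →ₐ[ResidueField A] ResidueField X :=
    Algebra.TensorProduct.lift (Algebra.ofId _ _) (IsScalarTower.toAlgHom A X (ResidueField X)) fun _ _ => Commute.all _ _
  have hf : ∀ x : X, f (1 ⊗ₜ x) = residue X x := fun x => by
    simp only [f, Algebra.TensorProduct.lift_tmul, map_one, one_mul]
    rfl
  have hsurj : Function.Surjective f := fun y => by
    obtain ⟨x, rfl⟩ := residue_surjective y
    exact ⟨_, hf x⟩
  have hinj : Function.Injective f := by
    rw [injective_iff_map_eq_zero]
    intro t ht
    obtain ⟨x, rfl⟩ := includeRight_surj (A := A) (K := ResidueField A) residue_surjective t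
    rw [hf, residue_eq_zero_iff, hmax] at ht
    exact one_tmul_eq_zero (fun a ha => (residue_eq_zero_iff a).2 ha) ht
  let e := AlgEquiv.ofBijective f ⟨hinj, hsurj⟩
  exact ⟨(Algebra.TensorProduct.comm A X L).toRingEquiv.trans
    ((Algebra.TensorProduct.cancelBaseChange A (ResidueField A) L L X).symm.toRingEquiv.trans
      ((Algebra.TensorProduct.comm (ResidueField A) L (ResidueField A ⊗[A] X)).toRingEquiv.trans
        (Algebra.TensorProduct.congr e AlgEquiv.refl).toRingEquiv))⟩

theorem exists_residue_algebra (A L : Type u) [CommRing A] [IsLocalRing A] [Field L] [Algebra A L] [Module.Finite A L] :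
    ∃ _ : Algebra (ResidueField A) L, IsScalarTower A (ResidueField A) L := by
  have hker : (RingHom.ker (algebraMap A L)) = maximalIdeal A := by
    refine IsLocalRing.eq_maximalIdeal ?_
    have h1 : Algebra.IsIntegral A L := inferInstance
    have := Ideal.isMaximal_comap_of_isIntegral_of_isMaximal (R := A) (⊥ : Ideal L)
    exact this
  let _ : Algebra (ResidueField A) L := (Ideal.Quotient.lift (maximalIdeal A) (algebraMap A L) (fun a ha => by
    rw [← hker] at ha; exact ha)).toAlgebra
  exact ⟨inferInstance, IsScalarTower.of_algebraMap_eq fun _ => rfl⟩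

/-- transport reducedness of fibres from hS-form to the residue field -/
theorem hred_of_hS {A : Type u} {X : Type v} [CommRing A] [IsLocalRing A]
    [CommRing X] [IsLocalRing X] [Algebra A X] [IsLocalHom (algebraMap A X)]
    (hmax : maximalIdeal X = (maximalIdeal A).map (algebraMap A X))
    (hS : ∀ (L : Type u) [Field L] [Algebra A L] [Module.Finite A L], IsNormalRing (X ⊗[A] L))
    (L : Type u) [Field L] [Algebra (ResidueField A) L] [FiniteDimensional (ResidueField A) L] :
      IsReduced (ResidueField X ⊗[ResidueField A] L) := by
  let _ : Algebra A L := ((algebraMap (ResidueField A) L).comp (residue A)).toAlgebra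
  have : IsScalarTower A (ResidueField A) L := IsScalarTower.of_algebraMap_eq fun _ => rfl
  have : Module.Finite A (ResidueField A) := Module.Finite.of_surjective (Algebra.linearMap A (ResidueField A)) residue_surjective
  have : Module.Finite A L := Module.Finite.trans (ResidueField A) L
  obtain ⟨e⟩ := exists_tensor_equiv hmax L
  exact ((hS L).of_ringEquiv e).isReduced

theorem hS_of_hred {A : Type u} {X : Type v} [CommRing A] [IsLocalRing A]
    [CommRing X] [IsLocalRing X] [Algebra A X] [IsLocalHom (algebraMap A X)]
    (hmax : maximalIdeal X = (maximalIdeal A).map (algebraMap A X))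
    (hred : ∀ (L : Type u) [Field L] [Algebra (ResidueField A) L] [FiniteDimensional (ResidueField A) L],
      IsReduced (ResidueField X ⊗[ResidueField A] L))
    (L : Type u) [Field L] [Algebra A L] [Module.Finite A L] : IsNormalRing (X ⊗[A] L) := by
  obtain ⟨_, _⟩ := exists_residue_algebra A L
  have : FiniteDimensional (ResidueField A) L := Module.Finite.of_restrictScalars_finite A _ L
  obtain ⟨e⟩ := exists_tensor_equiv hmax L
  have := hred L
  have : IsArtinianRing (ResidueField X ⊗[ResidueField A] L) := IsArtinianRing.of_finite (ResidueField X) _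
  exact (isNormalRing_of_isReduced (T := ResidueField X ⊗[ResidueField A] L)).of_ringEquiv e.symm

/-- passing to a bigger ring with the same residue field -/
theorem hred_of_residue {A : Type u} {X R : Type v} [CommRing A] [IsLocalRing A]
    [CommRing X] [IsLocalRing X] [Algebra A X] [IsLocalHom (algebraMap A X)]
    [CommRing R] [IsLocalRing R] [Algebra A R] [IsLocalHom (algebraMap A R)] [Algebra X R] [IsLocalHom (algebraMap X R)]
    [IsScalarTower A X R] (hsurj : Function.Surjective (ResidueField.map (algebraMap X R)))
    (hred : ∀ (L : Type u) [Field L] [Algebra (ResidueField A) L] [FiniteDimensional (ResidueField A) L],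
      IsReduced (ResidueField X ⊗[ResidueField A] L))
    (L : Type u) [Field L] [Algebra (ResidueField A) L] [FiniteDimensional (ResidueField A) L] :
      IsReduced (ResidueField R ⊗[ResidueField A] L) := by
  let f : ResidueField X →ₐ[ResidueField A] ResidueField R :=
    { ResidueField.map (algebraMap X R) with
      commutes' := fun a => by
        obtain ⟨a, rfl⟩ := residue_surjective a
        change residue R (algebraMap X R (algebraMap A X a)) = residue R (algebraMap A R a)
        rw [← IsScalarTower.algebraMap_apply] }
  let e := AlgEquiv.ofBijective f ⟨(ResidueField.map (algebraMap X R)).injective, hsurj⟩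
  have := hred L
  let E : ResidueField X ⊗[ResidueField A] L ≃ₐ[ResidueField A] ResidueField R ⊗[ResidueField A] L :=
    Algebra.TensorProduct.congr e AlgEquiv.refl
  exact isReduced_of_injective E.symm E.symm.injective

theorem fg_of_sup_fg {R : Type*} [CommRing R] (I : Ideal R) [IsAdicComplete I R] {x : R} (hxI : x ∈ I) (Q : Ideal R) [Q.IsPrime]
    (hx : x ∉ Q) (hfg : (Q ⊔ Ideal.span {x}).FG) : Q.FG := by
  obtain ⟨S, hS⟩ := hfg
  have h1 : ∀ s : S, ∃ q ∈ Q, ∃ r, (s : R) = q + r * x := fun s => by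
    have : (s : R) ∈ Q ⊔ Ideal.span {x} := by rw [← hS]; exact Ideal.subset_span s.2
    obtain ⟨q, hq, y, hy, hqy⟩ := Submodule.mem_sup.1 this
    obtain ⟨r, rfl⟩ := Ideal.mem_span_singleton'.1 hy
    exact ⟨q, hq, r, hqy.symm⟩
  choose p hpQ r hr using h1
  have h2 : ∀ q : Q, ∃ (c : S → R) (q' : Q), (q : R) = ∑ s, c s * p s + x * q' := by
    intro q
    have : (q : R) ∈ Ideal.span (Set.range fun s : S => (s : R)) := by
      rw [Subtype.range_coe_subtype]
      have : (q : R) ∈ Ideal.span (S : Set R) := by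
        rw [hS]; exact Ideal.mem_sup_left q.2
      exact this
    obtain ⟨c, hc⟩ := Ideal.mem_span_range_iff_exists_fun.1 this
    have h3 : (q : R) = ∑ s, c s * p s + x * ∑ s, c s * r s := by
      rw [← hc, Finset.mul_sum, ← Finset.sum_add_distrib]
      refine Finset.sum_congr rfl fun s _ => ?_
      conv_lhs => rw [hr s]
      ring
    have h4 : x * ∑ s, c s * r s ∈ Q := by
      have : x * ∑ s, c s * r s = q - ∑ s, c s * p s := by rw [h3]; ring
      rw [this]
      exact Q.sub_mem q.2 (Ideal.sum_mem _ fun s _ => Q.mul_mem_left _ (hpQ s))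
    exact ⟨c, ⟨_, (Ideal.IsPrime.mem_or_mem inferInstance h4).resolve_left hx⟩, h3⟩
  choose c g hg using h2
  have key : Q = Ideal.span (Set.range p) := by
    apply le_antisymm
    · intro q hq
      let w : ℕ → Q := fun n => g^[n] ⟨q, hq⟩
      have hw : ∀ n, w (n + 1) = g (w n) := fun n => Function.iterate_succ_apply' _ _ _
      let f : S → ℕ → R := fun s n => ∑ k ∈ Finset.range n, x ^ k * c (w k) s
      have hf : ∀ n, q = ∑ s, f s n * p s + x ^ n * w n := by
        intro n
        induction n with
        | zero => simp [f, w]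
        | succ n ih =>
          rw [ih, hg (w n), ← hw]
          simp only [f, Finset.sum_range_succ, add_mul, Finset.sum_add_distrib, mul_add, Finset.mul_sum, pow_succ]
          simp only [mul_assoc, add_assoc]
      have hlim : ∀ s, ∃ b, ∀ n, f s n - b ∈ I ^ n := fun s => exists_limit I (f s) fun n => by
        simp only [f, Finset.sum_range_succ, add_sub_cancel_left]
        exact Ideal.mul_mem_right _ _ (Ideal.pow_mem_pow hxI n)
      choose b hb using hlim
      have : q - ∑ s, b s * p s = 0 := by
        refine IsHausdorff.haus (I := I) inferInstance _ fun n => ?_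
        rw [SModEq.zero, smul_eq_mul, Ideal.mul_top]
        have : q - ∑ s, b s * p s = ∑ s, (f s n - b s) * p s + x ^ n * w n := by
          conv_lhs => rw [hf n]
          simp only [sub_mul, Finset.sum_sub_distrib]
          ring
        rw [this]
        exact add_mem (Ideal.sum_mem _ fun s _ => Ideal.mul_mem_right _ _ (hb s n)) (Ideal.mul_mem_right _ _ (Ideal.pow_mem_pow hxI n))
      rw [sub_eq_zero.1 this]
      exact Ideal.sum_mem _ fun s _ => Ideal.mul_mem_left _ _ (Ideal.subset_span ⟨s, rfl⟩)
    · rw [Ideal.span_le]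
      rintro _ ⟨s, rfl⟩
      exact hpQ s
  rw [key]
  exact ⟨(Set.finite_range p).toFinset, by rw [Set.Finite.coe_toFinset]⟩

theorem isNoetherianRing_quotient_iff {R : Type*} [CommRing R] (J : Ideal R) (hJ : J.FG) :
    IsNoetherianRing (R ⧸ J) ↔ ∀ K : Ideal R, J ≤ K → K.FG := by
  constructor
  · intro h K hK
    have h1 : (K.map (Ideal.Quotient.mk J)).FG := h.noetherian _
    have h2 : Submodule.FG (K.restrictScalars R) := by
      refine Submodule.fg_of_fg_map_of_fg_inf_ker (J.mkQ) ?_ ?_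
      · have hk : Submodule.map J.mkQ K = (K.map (Ideal.Quotient.mk J)).restrictScalars R := by
          ext y
          constructor
          · rintro ⟨z, hz, rfl⟩
            exact Ideal.mem_map_of_mem _ hz
          · intro hy
            obtain ⟨z, hz, rfl⟩ := (Ideal.mem_map_iff_of_surjective _ Ideal.Quotient.mk_surjective).1 hy
            exact ⟨z, hz, rfl⟩
        change (Submodule.map J.mkQ K).FG
        rw [hk]
        exact Submodule.FG.restrictScalars_of_surjective h1 Ideal.Quotient.mk_surjective
      · change (K ⊓ LinearMap.ker J.mkQ).FG
        rw [Submodule.ker_mkQ, inf_eq_right.2 hK]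
        exact hJ
    exact h2
  · intro h
    refine ⟨fun K => ?_⟩
    have h1 := h (Ideal.comap (Ideal.Quotient.mk J) K) (fun x hx => by
      rw [Ideal.mem_comap, Ideal.Quotient.eq_zero_iff_mem.2 hx]; exact K.zero_mem)
    have h2 := Ideal.FG.map h1 (Ideal.Quotient.mk J)
    rwa [Ideal.map_comap_of_surjective _ Ideal.Quotient.mk_surjective] at h2

theorem isNoetherianRing_of_complete {R : Type*} [CommRing R] (I : Ideal R) [IsAdicComplete I R] (hI : I.FG)
    [IsNoetherianRing (R ⧸ I)] : IsNoetherianRing R := by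
  classical
  have key : ∀ (T : Finset R), ∀ J : Ideal R, J.FG → J ⊔ Ideal.span (T : Set R) = I → ∀ K : Ideal R, J ≤ K → K.FG := by
    intro T
    induction T using Finset.induction_on with
    | empty =>
      intro J hJ hJI K hK
      have : J = I := by simpa using hJI
      subst this
      exact (isNoetherianRing_quotient_iff J hJ).1 inferInstance K hK
    | insert x T _ ih =>
      intro J hJ hJI
      have ih' := ih (J ⊔ Ideal.span {x}) (Submodule.FG.sup hJ (Submodule.fg_span_singleton x)) (by
        rw [sup_assoc, ← Ideal.span_union, ← hJI, Finset.coe_insert, Set.singleton_union])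
      have hxI : x ∈ I := by
        rw [← hJI]
        exact Ideal.mem_sup_right (Ideal.subset_span (by simp))
      rw [← isNoetherianRing_quotient_iff J hJ]
      refine IsNoetherianRing.of_prime fun P hP => ?_
      have hQ : (P.comap (Ideal.Quotient.mk J)).IsPrime := Ideal.comap_isPrime _ _
      have hJQ : J ≤ P.comap (Ideal.Quotient.mk J) := fun x hx => by
        rw [Ideal.mem_comap, Ideal.Quotient.eq_zero_iff_mem.2 hx]; exact P.zero_mem
      have h1 : (P.comap (Ideal.Quotient.mk J)).FG := by
        by_cases hx : x ∈ P.comap (Ideal.Quotient.mk J)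
        · exact ih' _ (sup_le hJQ ((Ideal.span_singleton_le_iff_mem _).2 hx))
        · exact fg_of_sup_fg I hxI _ hx (ih' _ (sup_le_sup_right hJQ _))
      have h2 := Ideal.FG.map h1 (Ideal.Quotient.mk J)
      rwa [Ideal.map_comap_of_surjective _ Ideal.Quotient.mk_surjective] at h2
  obtain ⟨T, hT⟩ := hI
  exact ⟨fun K => key T ⊥ Submodule.fg_bot (by rw [bot_sup_eq]; exact hT) K bot_le⟩

instance isNoetherianRing_adicCompletion (X : Type*) [CommRing X] [IsLocalRing X] [IsNoetherianRing X] :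
    IsNoetherianRing (AdicCompletion (maximalIdeal X) X) := by
  have h : (maximalIdeal (AdicCompletion (maximalIdeal X) X)).FG := by
    rw [AdicCompletion.maximalIdeal_eq_map]
    exact Ideal.FG.map (Ideal.fg_of_isNoetherianRing _) _
  have : IsNoetherianRing (AdicCompletion (maximalIdeal X) X ⧸ maximalIdeal (AdicCompletion (maximalIdeal X) X)) :=
    inferInstanceAs (IsNoetherianRing (ResidueField _))
  exact isNoetherianRing_of_complete _ h

theorem eq_zero_of_mul_self {R : Type*} [CommRing R] [IsReduced R] {z : R} (h : z * z = 0) : z = 0 :=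
  eq_zero_of_pow_eq_zero (n := 2) (by rw [pow_two, h])

theorem isIntegrallyClosed_of_forall_dvd {S : Type*} [CommRing S] [IsDomain S]
    (h : ∀ b y : S, y ≠ 0 → IntRel b y → y ∣ b) : IsIntegrallyClosed S := by
  rw [isIntegrallyClosed_iff (FractionRing S)]
  intro z hz
  obtain ⟨b, y, hy, rfl⟩ := IsFractionRing.div_surjective (A := S) z
  have hy0 := nonZeroDivisors.ne_zero hy
  obtain ⟨c, rfl⟩ := h b y hy0 (exists_relation_of_isIntegral hy0 hz)
  have hyK : algebraMap S (FractionRing S) y ≠ 0 := by rwa [Ne, IsFractionRing.to_map_eq_zero_iff]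
  exact ⟨c, by rw [map_mul, mul_div_cancel_left₀ _ hyK]⟩

theorem isDomain_of_forall_dvd {R : Type*} [CommRing R] [IsLocalRing R] [IsNoetherianRing R] [IsReduced R]
    (h : ∀ b y : R, y ∈ nonZeroDivisors R → IntRel b y → y ∣ b) : IsDomain R := by
  have hnz : NoZeroDivisors R := by
    refine ⟨fun {f g} hfg => ?_⟩
    by_contra! hcon
    obtain ⟨hf, hg⟩ := hcon
    let J : Ideal R := Ideal.span {f} ⊔ (Submodule.colon ⊥ {f})
    have hnot : ¬ ((J : Set R) ⊆ ⋃ p ∈ associatedPrimes R R, (p : Set R)) := by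
      rw [Ideal.subset_union_prime_finite (associatedPrimes.finite R R) (f := fun p => p) ⊥ ⊥ (fun i hi _ _ => hi.1)]
      rintro ⟨P, hP, hJP⟩
      obtain ⟨hPp, z, hz⟩ := isAssociatedPrime_iff.1 hP
      have hzf : f * z = 0 := by
        have : f ∈ P := hJP (Ideal.mem_sup_left (Ideal.mem_span_singleton_self f))
        rw [hz, Submodule.mem_colon_singleton, Submodule.mem_bot] at this
        exact this
      have hzP : z ∈ P := hJP (Ideal.mem_sup_right (by
        rw [Submodule.mem_colon_singleton, Submodule.mem_bot, smul_eq_mul, mul_comm]; exact hzf))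
      rw [hz, Submodule.mem_colon_singleton, Submodule.mem_bot, smul_eq_mul] at hzP
      have hz0 : z = 0 := eq_zero_of_mul_self hzP
      rw [hz0] at hz
      exact hPp.ne_top (by rw [hz]; exact Ideal.eq_top_of_isUnit_mem _ (by simp) isUnit_one)
    rw [biUnion_associatedPrimes_eq_zero_divisors, Set.not_subset] at hnot
    obtain ⟨y, hyJ, hy⟩ := hnot
    have hreg : ∀ x, y * x = 0 → x = 0 := by
      intro x hx
      by_contra hx0
      exact hy ⟨x, hx0, hx⟩
    obtain ⟨f', hf', k, hk, rfl⟩ := Submodule.mem_sup.1 hyJ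
    obtain ⟨c, rfl⟩ := Ideal.mem_span_singleton'.1 hf'
    rw [Submodule.mem_colon_singleton, Submodule.mem_bot, smul_eq_mul] at hk
    have hk' : c * f * k = 0 := by rw [mul_assoc, mul_comm f, hk, mul_zero]
    have hrel : IntRel (c * f) (c * f + k) := by
      refine ⟨Polynomial.X ^ 2 - Polynomial.X, by monicity!, ?_⟩
      have : (Polynomial.X ^ 2 - Polynomial.X : Polynomial R).natDegree = 2 := by compute_degree!
      rw [this]
      simp [Finset.sum_range_succ, Polynomial.coeff_X]
      linear_combination (-1) * hk'
    obtain ⟨d, hd⟩ := h _ _ (mem_nonZeroDivisors_iff_left.2 hreg) hrel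
    rcases isUnit_or_isUnit_one_sub_self d with hu | hu
    · have h1 : d * (k * k) = 0 := by linear_combination (-k) * hd + (1 - d) * hk'
      have h2 : k = 0 := eq_zero_of_mul_self (hu.mul_right_eq_zero.1 h1)
      rw [h2, add_zero] at hreg
      exact hg (hreg g (by rw [mul_assoc, hfg, mul_zero]))
    · have h1 : (1 - d) * ((c * f) * (c * f)) = 0 := by linear_combination (c * f) * hd + d * hk'
      have h2 : c * f = 0 := eq_zero_of_mul_self (hu.mul_right_eq_zero.1 h1)
      rw [h2, zero_add] at hreg
      exact hf (hreg f hk)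
  exact NoZeroDivisors.to_isDomain R

theorem inflation_complete (A : Type u) (R : Type v)
    [CommRing A] [CommRing R] [IsLocalRing A] [IsLocalRing R] [IsDomain A] [IsIntegrallyClosed A]
    [Algebra A R] [IsNoetherianRing A] [IsNoetherianRing R] [IsAdicComplete (maximalIdeal A) A]
    [IsAdicComplete (maximalIdeal R) R] [IsLocalHom (algebraMap A R)] [Module.Flat A R]
    (hred : ∀ (L : Type u) [Field L] [Algebra (ResidueField A) L] [FiniteDimensional (ResidueField A) L],
      IsReduced (ResidueField R ⊗[ResidueField A] L))
    (hmax : maximalIdeal R = (maximalIdeal A).map (algebraMap A R)) :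
    IsDomain R ∧ ∀ b y : R, y ≠ 0 → IntRel b y → y ∣ b := by
  have hS : ∀ (L : Type u) [Field L] [Algebra A L] [Module.Finite A L], IsNormalRing (R ⊗[A] L) :=
    fun L _ _ _ => hS_of_hred hmax hred L
  have hd : ∀ b y : R, y ∈ nonZeroDivisors R → IntRel b y → y ∣ b := by
    intro b y hy hrel
    obtain ⟨a, r, ha, hra, hab⟩ := exists_denominator A R hred hmax hy hrel
    obtain ⟨s, hs⟩ := dvd_of_intRel_base (fun P _ n b hb => mem_map_of_pow_mem hS P n b hb) a ha r hra
    refine ⟨s, ?_⟩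
    have h1 : a • (b - y * s) = 0 := by
      rw [Algebra.smul_def, mul_sub, hab, hs]; ring
    have := (Module.Flat.isSMulRegular_of_isRegular (M := R) (IsRegular.of_ne_zero ha)) (show a • (b - y * s) = a • 0 by rw [h1, smul_zero])
    exact sub_eq_zero.1 this
  have : IsReduced R := eq_zero_of_intRel_zero hS
  have hdom := isDomain_of_forall_dvd hd
  exact ⟨hdom, fun b y hy => hd b y (mem_nonZeroDivisors_of_ne_zero hy)⟩

theorem inflation_descent (A : Type u) (X R : Type v)
    [CommRing A] [CommRing R] [IsLocalRing A] [IsLocalRing R] [IsDomain A] [IsIntegrallyClosed A]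
    [CommRing X] [IsLocalRing X] [Algebra A X] [IsLocalHom (algebraMap A X)] [Module.Flat A X]
    [IsNoetherianRing A] [IsNoetherianRing R] [IsAdicComplete (maximalIdeal A) A]
    [IsAdicComplete (maximalIdeal R) R] [Algebra X R] [IsLocalHom (algebraMap X R)] [Module.Flat X R]
    (hsurj : Function.Surjective (ResidueField.map (algebraMap X R)))
    (hRX : maximalIdeal R = (maximalIdeal X).map (algebraMap X R))
    (hmax : maximalIdeal X = (maximalIdeal A).map (algebraMap A X))
    (hS : ∀ (L : Type u) [Field L] [Algebra A L] [Module.Finite A L], IsNormalRing (X ⊗[A] L)) :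
    IsDomain X ∧ IsIntegrallyClosed X := by
  let _ : Algebra A R := ((algebraMap X R).comp (algebraMap A X)).toAlgebra
  have : IsScalarTower A X R := IsScalarTower.of_algebraMap_eq fun _ => rfl
  have : IsLocalHom (algebraMap A R) := RingHom.isLocalHom_comp (algebraMap X R) (algebraMap A X)
  have : Module.Flat A R := Module.Flat.trans A X R
  have hff : Module.FaithfullyFlat X R := Module.FaithfullyFlat.of_flat_of_isLocalHom
  have hmax' : maximalIdeal R = (maximalIdeal A).map (algebraMap A R) := by
    rw [hRX, hmax, Ideal.map_map]; rfl
  have hred : ∀ (L : Type u) [Field L] [Algebra (ResidueField A) L] [FiniteDimensional (ResidueField A) L],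
      IsReduced (ResidueField R ⊗[ResidueField A] L) := fun L _ _ _ =>
    hred_of_residue (A := A) (X := X) (R := R) hsurj (fun L _ _ _ => hred_of_hS hmax hS L) L
  obtain ⟨hd, hdvd⟩ := inflation_complete A R hred hmax'
  have hinj : Function.Injective (algebraMap X R) := FaithfulSMul.algebraMap_injective X R
  have hdX : IsDomain X := hinj.isDomain _
  refine ⟨hdX, isIntegrallyClosed_of_forall_dvd fun b y hy hrel => ?_⟩
  have h1 := hdvd (algebraMap X R b) (algebraMap X R y) (fun h => hy (hinj (by rw [h, map_zero]))) (hrel.map _)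
  have h2 : b ∈ ((Ideal.span {y}).map (algebraMap X R)).comap (algebraMap X R) := by
    rw [Ideal.mem_comap, Ideal.map_span, Set.image_singleton, Ideal.mem_span_singleton]
    exact h1
  rw [Ideal.comap_map_eq_self_of_faithfullyFlat] at h2
  exact Ideal.mem_span_singleton.1 h2

theorem inflation (A : Type u) (X : Type v)
    [CommRing A] [IsLocalRing A] [IsDomain A] [IsIntegrallyClosed A]
    [CommRing X] [IsLocalRing X] [Algebra A X] [IsLocalHom (algebraMap A X)] [Module.Flat A X]
    [IsNoetherianRing A] [IsNoetherianRing X] [IsAdicComplete (maximalIdeal A) A]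
    (hmax : maximalIdeal X = (maximalIdeal A).map (algebraMap A X))
    (hS : ∀ (L : Type u) [Field L] [Algebra A L] [Module.Finite A L], IsNormalRing (X ⊗[A] L)) :
    IsDomain X ∧ IsIntegrallyClosed X :=
  inflation_descent A X (AdicCompletion (maximalIdeal X) X) (AdicCompletion.residueField_map_bijective X).2
    AdicCompletion.maximalIdeal_eq_map hmax hS

theorem normal_tensor_localization {A B X L : Type*} [CommRing A] [CommRing B] [CommRing X] [CommRing L]
    [Algebra A B] [Algebra A X] [Algebra B X] [IsScalarTower A B X] [Algebra A L]
    (M : Submonoid B) [IsLocalization M X] (h : IsNormalRing (B ⊗[A] L)) : IsNormalRing (X ⊗[A] L) := by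
  have h1 : IsNormalRing ((B ⊗[A] L) ⊗[B] X) :=
    IsNormalRing.of_isLocalization (Algebra.algebraMapSubmonoid (B ⊗[A] L) M) h
  have h2 : IsNormalRing (X ⊗[B] (B ⊗[A] L)) :=
    h1.of_ringEquiv (Algebra.TensorProduct.comm B (B ⊗[A] L) X).toRingEquiv
  exact h2.of_ringEquiv (Algebra.TensorProduct.cancelBaseChange A B X X L).toRingEquiv

theorem fiber_isPrime {A : Type u} {S : Type v} [CommRing A] [IsLocalRing A]
    [CommRing S] [IsLocalRing S] [Algebra A S] [IsLocalHom (algebraMap A S)] [Module.Flat A S]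
    (hS : IsNormalRing (S ⊗[A] ResidueField A)) :
    ((maximalIdeal A).map (algebraMap A S)).IsPrime := by
  have hT : IsNormalRing (ResidueField A ⊗[A] S) :=
    hS.of_ringEquiv (Algebra.TensorProduct.comm A S (ResidueField A)).toRingEquiv
  have hsurjA : Function.Surjective (algebraMap A (ResidueField A)) := IsLocalRing.residue_surjective
  have hker : RingHom.ker (algebraMap A (ResidueField A)) = maximalIdeal A := IsLocalRing.ker_residue
  let f : S →+* ResidueField A ⊗[A] S := (Algebra.TensorProduct.includeRight : S →ₐ[A] _).toRingHom
  have hf : Function.Surjective f := fun t => includeRight_surj hsurjA t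
  have hfk : ∀ s, f s = 0 ↔ s ∈ (maximalIdeal A).map (algebraMap A S) := by
    intro s
    constructor
    · intro h
      have := mem_map_ker_of_one_tmul (W := ResidueField A) (s := s) h
      rwa [hker] at this
    · intro h
      exact one_tmul_eq_zero (W := ResidueField A) (I := maximalIdeal A)
        (fun a ha => by rw [← hker] at ha; exact ha) h
  have hk : RingHom.ker f = (maximalIdeal A).map (algebraMap A S) := by
    ext s; exact hfk s
  have hne : (maximalIdeal A).map (algebraMap A S) ≠ ⊤ := by
    intro h
    have h2 : (maximalIdeal A).map (algebraMap A S) ≤ maximalIdeal S :=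
      ((IsLocalRing.local_hom_TFAE (algebraMap A S)).out 0 2).mp ‹_›
    rw [h, top_le_iff] at h2
    exact (maximalIdeal.isMaximal S).ne_top h2
  have : Nontrivial (ResidueField A ⊗[A] S) := by
    refine ⟨⟨f 1, 0, ?_⟩⟩
    intro h
    exact hne ((Ideal.eq_top_iff_one _).2 ((hfk 1).1 h))
  have : IsLocalRing (ResidueField A ⊗[A] S) := IsLocalRing.of_surjective' f hf
  have hD := hT.of_isLocalRing.1
  rw [← hk]
  exact RingHom.ker_isPrime f

theorem local_case (A : Type u) (S : Type v) [CommRing A] [IsLocalRing A] [IsDomain A]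
    [IsIntegrallyClosed A] [IsNoetherianRing A] [IsAdicComplete (maximalIdeal A) A]
    [CommRing S] [IsLocalRing S] [IsNoetherianRing S] [Algebra A S]
    [IsLocalHom (algebraMap A S)] [Module.Flat A S]
    (hS : ∀ (L : Type u) [Field L] [Algebra A L] [Module.Finite A L], IsNormalRing (S ⊗[A] L)) :
    IsDomain S ∧ IsIntegrallyClosed S := by
  have hfin : Module.Finite A (ResidueField A) :=
    Module.Finite.of_surjective (Algebra.linearMap A (ResidueField A)) IsLocalRing.residue_surjective
  have hQ : ((maximalIdeal A).map (algebraMap A S)).IsPrime := fiber_isPrime (hS (ResidueField A))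
  obtain ⟨Q, hQdef⟩ : ∃ Q, Q = (maximalIdeal A).map (algebraMap A S) := ⟨_, rfl⟩
  rw [← hQdef] at hQ
  let X := Localization.AtPrime Q
  have : Module.Flat S X := IsLocalization.flat X Q.primeCompl
  have : Module.Flat A X := Module.Flat.trans A S X
  have : IsNoetherianRing X := IsLocalization.isNoetherianRing Q.primeCompl X inferInstance
  have hmax : maximalIdeal X = (maximalIdeal A).map (algebraMap A X) := by
    rw [IsScalarTower.algebraMap_eq A S X, ← Ideal.map_map, ← hQdef]
    exact (Localization.AtPrime.map_eq_maximalIdeal).symm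
  have : IsLocalHom (algebraMap A X) := by
    refine ((IsLocalRing.local_hom_TFAE (algebraMap A X)).out 0 2).mpr ?_
    exact hmax.ge
  obtain ⟨hXd, hXi⟩ := inflation A X hmax
    (fun L _ _ _ => normal_tensor_localization (B := S) Q.primeCompl (hS L))
  have hreg : ∀ s ∉ Q, ∀ x, s * x ∈ Q → x ∈ Q := fun s hs x hx => (hQ.mem_or_mem hx).resolve_left hs
  have hnzd : ∀ s ∉ Q, ∀ x : S, s * x = 0 → x = 0 := by
    intro s hs x hx
    have h1 : (x ⊗ₜ[A] (1 : A) : S ⊗[A] A) = 0 := by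
      refine regular_tensor (y := s) (by rw [← hQdef]; exact hreg s hs) _ ?_
      rw [TensorProduct.smul_tmul', smul_eq_mul, hx, TensorProduct.zero_tmul]
    have := congrArg (TensorProduct.rid A S) h1
    simpa using this
  have hle : Q.primeCompl ≤ nonZeroDivisors S := by
    intro s hs
    rw [mem_nonZeroDivisors_iff_right]
    intro x hx
    exact hnzd s hs x (by rw [mul_comm]; exact hx)
  have hinj : Function.Injective (algebraMap S X) := IsLocalization.injective X hle
  have hD : IsDomain S := hinj.isDomain (algebraMap S X)
  refine ⟨hD, isIntegrallyClosed_of_forall_dvd ?_⟩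
  intro b y hy hrel
  obtain ⟨z, hz⟩ := (hrel.map (algebraMap S X)).dvd
  obtain ⟨⟨c, s⟩, hcs⟩ := IsLocalization.surj Q.primeCompl z
  have hsc : (s : S) * b = y * c := by
    apply hinj
    rw [map_mul, map_mul, hz, ← hcs]
    ring
  have hrel2 : IntRel (y * c) (y * s) := by
    have := hrel.mul (s : S)
    rwa [hsc, mul_comm (s : S) y] at this
  have hrel3 : IntRel c (s : S) := IntRel.cancel (fun x hx => (mul_eq_zero.1 hx).resolve_left hy) hrel2
  obtain ⟨d, hd⟩ := dvd_of_intRel hS (b := c) (y := (s : S)) (by rw [← hQdef]; exact hreg s s.2) hrel3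
  refine ⟨d, ?_⟩
  have : (s : S) * (b - y * d) = 0 := by rw [mul_sub, hsc, hd]; ring
  exact sub_eq_zero.1 (hnzd s s.2 _ this)

theorem normal_base_of_geometricallyNormal {A : Type u} {B : Type v} [CommRing A] [CommRing B] [IsLocalRing A]
    [Algebra A B] (hfib : GeometricallyNormal (ResidueField A) (ResidueField A ⊗[A] B))
    (L : Type u) [Field L] [Algebra A L] [Module.Finite A L] : IsNormalRing (B ⊗[A] L) := by
  obtain ⟨_, _⟩ := exists_residue_algebra A L
  have : Module.Finite (ResidueField A) L := Module.Finite.of_restrictScalars_finite A _ L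
  have h1 := hfib L
  have h2 : IsNormalRing (L ⊗[A] B) :=
    h1.of_ringEquiv (Algebra.TensorProduct.cancelBaseChange A (ResidueField A) L L B).toRingEquiv
  exact h2.of_ringEquiv (Algebra.TensorProduct.comm A L B).toRingEquiv

theorem main_aux (A : Type u) (B : Type v) [CommRing A] [CommRing B] [IsNoetherianRing A] [IsNoetherianRing B]
    [IsLocalRing A] [IsAdicComplete (maximalIdeal A) A]
    [Algebra A B] [Module.Flat A B]
    (hrad : Ideal.map (algebraMap A B) (maximalIdeal A) ≤ (⊥ : Ideal B).jacobson)
    (hfib : GeometricallyNormal (ResidueField A) (ResidueField A ⊗[A] B))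
    (hA : IsNormalRing A) : IsNormalRing B := by
  obtain ⟨hAd, hAi⟩ := hA.of_isLocalRing
  intro q hq
  obtain ⟨n, hn, hqn⟩ := Ideal.exists_le_maximal q hq.ne_top
  have hmn : (maximalIdeal A).map (algebraMap A B) ≤ n :=
    hrad.trans (sInf_le ⟨bot_le, hn⟩)
  let S := Localization.AtPrime n
  have : Module.Flat B S := IsLocalization.flat S n.primeCompl
  have : Module.Flat A S := Module.Flat.trans A B S
  have : IsNoetherianRing S := IsLocalization.isNoetherianRing n.primeCompl S inferInstance
  have : IsLocalHom (algebraMap A S) := by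
    refine ((IsLocalRing.local_hom_TFAE (algebraMap A S)).out 0 2).mpr ?_
    rw [IsScalarTower.algebraMap_eq A B S, ← Ideal.map_map, ← Localization.AtPrime.map_eq_maximalIdeal]
    exact Ideal.map_mono hmn
  obtain ⟨hSd, hSi⟩ := local_case A S
    (fun L _ _ _ => normal_tensor_localization (B := B) n.primeCompl (normal_base_of_geometricallyNormal hfib L))
  have hle : n.primeCompl ≤ q.primeCompl := fun x hx hxq => hx (hqn hxq)
  let T := Localization.AtPrime q
  let _ : Algebra S T := IsLocalization.localizationAlgebraOfSubmonoidLe S T n.primeCompl q.primeCompl hle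
  have : IsScalarTower B S T := IsLocalization.localization_isScalarTower_of_submonoid_le S T n.primeCompl q.primeCompl hle
  have hloc : IsLocalization (q.primeCompl.map (algebraMap B S)) T :=
    IsLocalization.isLocalization_of_submonoid_le S T n.primeCompl q.primeCompl hle
  have hnz : q.primeCompl.map (algebraMap B S) ≤ nonZeroDivisors S := by
    refine le_nonZeroDivisors_of_noZeroDivisors ?_
    intro h0
    have h2 := IsLocalization.map_units T (⟨0, h0⟩ : q.primeCompl.map (algebraMap B S))
    rw [map_zero] at h2
    exact not_isUnit_zero h2
  exact ⟨IsLocalization.isDomain_of_le_nonZeroDivisors T hnz,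
    isIntegrallyClosed_of_isLocalization T _ hnz⟩

/-- **Statement 11.** Let `σ : A → B` be a flat ring homomorphism of Noetherian
commutative rings, where `A` is a complete local ring with maximal ideal `m` and `mB` is
contained in the Jacobson radical of `B`. If the fiber `B ⧸ mB = κ(m) ⊗[A] B` is
geometrically normal over the field `A ⧸ m` and `A` is normal, then `B` is normal. -/
theorem isNormalRing_of_flat_of_geometricallyNormal_fiber
    (A B : Type*) [CommRing A] [CommRing B] [IsNoetherianRing A] [IsNoetherianRing B]
    [IsLocalRing A] [IsAdicComplete (maximalIdeal A) A]
    [Algebra A B] [Module.Flat A B]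
    (hrad : Ideal.map (algebraMap A B) (maximalIdeal A) ≤ (⊥ : Ideal B).jacobson)
    (hfib : GeometricallyNormal (ResidueField A) (ResidueField A ⊗[A] B))
    (hA : IsNormalRing A) : IsNormalRing B := by
  exact main_aux A B hrad hfib hA
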